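/- arXiv:math/0703926 — 3 statements merged into one kernel-verified Lean document; each statement's English description precedes it below -/
import Mathlib

section
/- Let A be any finite generating set of the discrete Heisenberg group H. Then the dead-end depth of elements of H with respect to A is unbounded: for every n ∈ ℕ there exists h ∈ H such that every h' ∈ H with |h'|_A > |h|_A satisfies d_A(h, h') > n (equivalently, the entire closed ball of radius n about h in the word metric is contained in the closed ball of radius |h|_A about the identity). -/
/-- The discrete Heisenberg group `H = ⟨x,y | [x,[x,y]], [y,[x,y]]⟩`, realized as triples
`⟨a, b, c⟩` of integers (the unitriangular 3×3 integer matrix with superdiagonal `a, b` and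
corner `c`), so that `x = ⟨1,0,0⟩`, `y = ⟨0,1,0⟩` and `x^i * y^j * z^k = ⟨i, j, i*j + k⟩`. -/
@[ext] structure Heis where
  a : ℤ
  b : ℤ
  c : ℤ

namespace Heis

instance : Mul Heis := ⟨fun g h => ⟨g.a + h.a, g.b + h.b, g.c + h.c + g.a * h.b⟩⟩
instance : One Heis := ⟨⟨0, 0, 0⟩⟩
instance : Inv Heis := ⟨fun g => ⟨-g.a, -g.b, g.a * g.b - g.c⟩⟩

@[simp] lemma mul_a (g h : Heis) : (g * h).a = g.a + h.a := rfl
@[simp] lemma mul_b (g h : Heis) : (g * h).b = g.b + h.b := rfl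
@[simp] lemma mul_c (g h : Heis) : (g * h).c = g.c + h.c + g.a * h.b := rfl
@[simp] lemma one_a : (1 : Heis).a = 0 := rfl
@[simp] lemma one_b : (1 : Heis).b = 0 := rfl
@[simp] lemma one_c : (1 : Heis).c = 0 := rfl
@[simp] lemma inv_a (g : Heis) : g⁻¹.a = -g.a := rfl
@[simp] lemma inv_b (g : Heis) : g⁻¹.b = -g.b := rfl
@[simp] lemma inv_c (g : Heis) : g⁻¹.c = g.a * g.b - g.c := rfl

instance : Group Heis where
  mul_assoc g h k := by ext <;> simp <;> ring
  one_mul g := by ext <;> simp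
  mul_one g := by ext <;> simp
  inv_mul_cancel g := by ext <;> simp

/-- The standard generator `x` of the Heisenberg group. -/
def x : Heis := ⟨1, 0, 0⟩
/-- The standard generator `y` of the Heisenberg group. -/
def y : Heis := ⟨0, 1, 0⟩
/-- The central element `z = [x,y] = x⁻¹y⁻¹xy`, generating the center; every element of
`Heis` is uniquely of the form `x^i * y^j * z^k`. -/
def z : Heis := ⟨0, 0, 1⟩

/-- The abelianization map `φ : Heis → Heis_ab ≅ ℤ²`, sending `x^i y^j z^k` to `(i,j)`. -/
def φ (g : Heis) : ℤ × ℤ := (g.a, g.b)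

/-- The exponent of `z` in the normal form of `g`:  the unique `k` with
`g = x^i * y^j * z^k` (where `(i,j) = φ g`). -/
def zexp (g : Heis) : ℤ := g.c - g.a * g.b

end Heis

/-- `A` is a generating set of the group `G`. -/
def IsGenSet {G : Type*} [Group G] (A : Finset G) : Prop :=
  Subgroup.closure (A : Set G) = ⊤

/-- A word in the letters of `A ∪ A⁻¹`. -/
def IsWordOn {G : Type*} [Group G] (A : Finset G) (w : List G) : Prop :=
  ∀ a ∈ w, a ∈ A ∨ a⁻¹ ∈ A

/-- The word length `|g|_A` of `g` with respect to the finite generating set `A`: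
the length of a shortest word in the letters of `A` and their inverses representing `g`. -/
noncomputable def wlen {G : Type*} [Group G] (A : Finset G) (g : G) : ℕ :=
  sInf {n | ∃ w : List G, IsWordOn A w ∧ w.length = n ∧ w.prod = g}

namespace DeadEnd

/-- Symmetrized central coordinate (twice the signed area). -/
def sy (g : Heis) : ℤ := 2 * g.c - g.a * g.b

/-- The symplectic form on the abelianization. -/
def om (g h : Heis) : ℤ := g.a * h.b - g.b * h.a

lemma sy_mul (g h : Heis) : sy (g * h) = sy g + sy h + om g h := by
  simp only [sy, om, Heis.mul_a, Heis.mul_b, Heis.mul_c]; ring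

lemma sy_one : sy 1 = 0 := by simp [sy]

lemma pow_a (g : Heis) (n : ℕ) : (g ^ n).a = n * g.a := by
  induction n with
  | zero => simp
  | succ k ih => rw [pow_succ, Heis.mul_a, ih]; push_cast; ring

lemma pow_b (g : Heis) (n : ℕ) : (g ^ n).b = n * g.b := by
  induction n with
  | zero => simp
  | succ k ih => rw [pow_succ, Heis.mul_b, ih]; push_cast; ring

lemma sy_pow (g : Heis) (n : ℕ) : sy (g ^ n) = n * sy g := by
  induction n with
  | zero => simp [sy_one]
  | succ k ih => rw [pow_succ, sy_mul, ih, om, pow_a, pow_b]; push_cast; ring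

/-! ### Word length basics -/

lemma wlen_le (A : Finset Heis) (w : List Heis) (hw : IsWordOn A w) :
    wlen A w.prod ≤ w.length := Nat.sInf_le ⟨w, hw, rfl, rfl⟩

lemma exists_word (A : Finset Heis) (hA : IsGenSet A) (g : Heis) :
    ∃ w : List Heis, IsWordOn A w ∧ w.length = wlen A g ∧ w.prod = g := by
  have hne : {n | ∃ w : List Heis, IsWordOn A w ∧ w.length = n ∧ w.prod = g}.Nonempty := by
    have hg : g ∈ Subgroup.closure (A : Set Heis) := by rw [hA]; trivial
    rw [← Subgroup.mem_toSubmonoid, Subgroup.closure_toSubmonoid] at hg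
    obtain ⟨l, hl, hp⟩ := Submonoid.exists_list_of_mem_closure hg
    exact ⟨l.length, l, fun a ha => by simpa using hl a ha, rfl, hp⟩
  exact Nat.sInf_mem hne

lemma wlen_mul_le (A : Finset Heis) (hA : IsGenSet A) (g h : Heis) :
    wlen A (g * h) ≤ wlen A g + wlen A h := by
  obtain ⟨u, hu, hul, rfl⟩ := exists_word A hA g
  obtain ⟨v, hv, hvl, rfl⟩ := exists_word A hA h
  have := wlen_le A (u ++ v) (by
    intro a ha
    rcases List.mem_append.1 ha with h | h
    · exact hu a h
    · exact hv a h)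
  rw [List.prod_append, List.length_append] at this
  omega

lemma wlen_inv_le (A : Finset Heis) (hA : IsGenSet A) (g : Heis) :
    wlen A g⁻¹ ≤ wlen A g := by
  obtain ⟨u, hu, hul, rfl⟩ := exists_word A hA g
  have := wlen_le A ((u.map (fun x => x⁻¹)).reverse) (by
    intro a ha
    simp only [List.mem_reverse, List.mem_map] at ha
    obtain ⟨b, hb, rfl⟩ := ha
    rcases hu b hb with h | h
    · right; simpa using h
    · left; exact h)
  rw [← List.prod_inv_reverse] at this
  simpa [hul] using this

lemma wlen_one (A : Finset Heis) : wlen A 1 = 0 := by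
  have := wlen_le A [] (by intro a ha; simp at ha)
  simpa using this

lemma wlen_pow_le (A : Finset Heis) (hA : IsGenSet A) (g : Heis) (n : ℕ) :
    wlen A (g ^ n) ≤ n * wlen A g := by
  induction n with
  | zero => simp [wlen_one]
  | succ k ih =>
    rw [pow_succ]
    have := wlen_mul_le A hA (g ^ k) g
    rw [add_mul]; omega

lemma wlen_zpow_le (A : Finset Heis) (hA : IsGenSet A) (g : Heis) (n : ℤ) :
    wlen A (g ^ n) ≤ n.natAbs * wlen A g := by
  rcases Int.natAbs_eq n with h | h
  · rw [h, zpow_natCast, Int.natAbs_natCast]; exact wlen_pow_le A hA g n.natAbs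
  · rw [h, zpow_neg, zpow_natCast]
    have := wlen_inv_le A hA (g ^ n.natAbs)
    have h2 := wlen_pow_le A hA g n.natAbs
    simp only [Int.natAbs_neg, Int.natAbs_natCast]
    omega

/-! ### Length of general elements -/

lemma x_zpow (i : ℤ) : Heis.x ^ i = ⟨i, 0, 0⟩ := by
  have hn : ∀ n : ℕ, Heis.x ^ n = ⟨n, 0, 0⟩ := by
    intro n
    induction n with
    | zero => rfl
    | succ k ih => rw [pow_succ, ih]; ext <;> simp [Heis.x]
  rcases Int.natAbs_eq i with h | h
  · rw [h, zpow_natCast, hn]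
  · rw [h, zpow_neg, zpow_natCast, hn]; ext <;> simp

lemma y_zpow (i : ℤ) : Heis.y ^ i = ⟨0, i, 0⟩ := by
  have hn : ∀ n : ℕ, Heis.y ^ n = ⟨0, n, 0⟩ := by
    intro n
    induction n with
    | zero => rfl
    | succ k ih => rw [pow_succ, ih]; ext <;> simp [Heis.y]
  rcases Int.natAbs_eq i with h | h
  · rw [h, zpow_natCast, hn]
  · rw [h, zpow_neg, zpow_natCast, hn]; ext <;> simp

lemma comm_wlen (A : Finset Heis) (hA : IsGenSet A) (i j : ℤ) :
    wlen A ⟨0, 0, i * j⟩ ≤ 2 * (i.natAbs * wlen A Heis.x + j.natAbs * wlen A Heis.y) := by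
  have h : (⟨0, 0, i * j⟩ : Heis)
      = (Heis.x ^ i * Heis.y ^ j) * (Heis.x ^ (-i) * Heis.y ^ (-j)) := by
    rw [x_zpow, y_zpow, x_zpow, y_zpow]; ext <;> simp
  rw [h]
  have h1 := wlen_mul_le A hA (Heis.x ^ i * Heis.y ^ j) (Heis.x ^ (-i) * Heis.y ^ (-j))
  have h2 := wlen_mul_le A hA (Heis.x ^ i) (Heis.y ^ j)
  have h3 := wlen_mul_le A hA (Heis.x ^ (-i)) (Heis.y ^ (-j))
  have h4 := wlen_zpow_le A hA Heis.x i
  have h5 := wlen_zpow_le A hA Heis.y j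
  have h6 := wlen_zpow_le A hA Heis.x (-i)
  have h7 := wlen_zpow_le A hA Heis.y (-j)
  rw [Int.natAbs_neg] at h6 h7
  omega

lemma cent_wlen_nat (A : Finset Heis) (hA : IsGenSet A) (k : ℕ) :
    wlen A ⟨0, 0, k⟩ ≤ 6 * (wlen A Heis.x + wlen A Heis.y) * (Nat.sqrt k + 1) := by
  have e1 : Nat.sqrt k * Nat.sqrt k ≤ k := Nat.sqrt_le k
  have e2 : k ≤ Nat.sqrt k * Nat.sqrt k + Nat.sqrt k + Nat.sqrt k := Nat.sqrt_le_add k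
  set r := Nat.sqrt k with hr
  obtain ⟨e, he⟩ := Nat.exists_eq_add_of_le e1
  have h : (⟨0, 0, k⟩ : Heis) = ⟨0, 0, (r : ℤ) * r⟩ * ⟨0, 0, (e : ℤ) * 1⟩ := by
    rw [he]; ext <;> simp
  have hel : e ≤ 2 * r := by omega
  rw [h]
  have h1 := wlen_mul_le A hA ⟨0, 0, (r : ℤ) * r⟩ ⟨0, 0, (e : ℤ) * 1⟩
  have h2 := comm_wlen A hA r r
  have h3 := comm_wlen A hA e 1
  simp only [Int.natAbs_natCast, Int.natAbs_one] at h2 h3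
  refine h1.trans ((add_le_add h2 h3).trans ?_)
  have h4 : e * wlen A Heis.x ≤ 2 * r * wlen A Heis.x := Nat.mul_le_mul_right _ hel
  nlinarith [Nat.zero_le (r * wlen A Heis.y), Nat.zero_le (r * wlen A Heis.x)]

lemma cent_wlen (A : Finset Heis) (hA : IsGenSet A) (k : ℤ) :
    wlen A ⟨0, 0, k⟩ ≤ 6 * (wlen A Heis.x + wlen A Heis.y) * (Nat.sqrt k.natAbs + 1) := by
  have h0 := cent_wlen_nat A hA k.natAbs
  rcases Int.natAbs_eq k with h | h
  · rw [← h] at h0; exact h0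
  · have h2 : (⟨0, 0, k⟩ : Heis) = (⟨0, 0, (k.natAbs : ℤ)⟩ : Heis)⁻¹ := by
      ext
      · simp
      · simp
      · rw [Heis.inv_c]; simp only [mul_zero, zero_sub]; exact h
    rw [h2]
    exact (wlen_inv_le A hA _).trans h0

/-- General length bound. -/
lemma wlen_general (A : Finset Heis) (hA : IsGenSet A) (g : Heis) :
    wlen A g ≤ 6 * (wlen A Heis.x + wlen A Heis.y) *
      (g.a.natAbs + g.b.natAbs + Nat.sqrt (g.c - g.a * g.b).natAbs + 1) := by
  have h : g = Heis.x ^ g.a * Heis.y ^ g.b * ⟨0, 0, g.c - g.a * g.b⟩ := by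
    rw [x_zpow, y_zpow]; ext <;> simp
  have h1 := wlen_mul_le A hA (Heis.x ^ g.a * Heis.y ^ g.b) ⟨0, 0, g.c - g.a * g.b⟩
  have h2 := wlen_mul_le A hA (Heis.x ^ g.a) (Heis.y ^ g.b)
  have h4 := wlen_zpow_le A hA Heis.x g.a
  have h5 := wlen_zpow_le A hA Heis.y g.b
  have h6 := cent_wlen A hA (g.c - g.a * g.b)
  rw [← h] at h1
  generalize wlen A g = W at *
  generalize g.a.natAbs = p at *
  generalize g.b.natAbs = q at *
  generalize Nat.sqrt (g.c - g.a * g.b).natAbs = r at *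
  generalize wlen A Heis.x = X at *
  generalize wlen A Heis.y = Y at *
  have : W ≤ p * X + q * Y + 6 * (X + Y) * (r + 1) := by omega
  refine this.trans ?_
  nlinarith [Nat.zero_le (p * X), Nat.zero_le (p * Y), Nat.zero_le (q * X), Nat.zero_le (q * Y)]

/-! ### The chain argument -/

lemma chain (A : Finset Heis) (hA : IsGenSet A) (n : ℕ)
    (hneg : ∀ h : Heis, ∃ h' : Heis, wlen A h < wlen A h' ∧ wlen A (h⁻¹ * h') ≤ n)
    (h : Heis) (T : ℕ) : ∃ b : Heis, wlen A b ≤ n * T ∧ wlen A h + T ≤ wlen A (h * b) := by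
  induction T with
  | zero => exact ⟨1, by simp [wlen_one], by simp⟩
  | succ k ih =>
    obtain ⟨b, hb1, hb2⟩ := ih
    obtain ⟨h', h1, h2⟩ := hneg (h * b)
    refine ⟨b * ((h * b)⁻¹ * h'), ?_, ?_⟩
    · have := wlen_mul_le A hA b ((h * b)⁻¹ * h')
      rw [mul_add]; omega
    · rw [show h * (b * ((h * b)⁻¹ * h')) = h' by group]
      omega

/-! ### Weighted polygons -/

noncomputable def Va : List Heis → (Heis → ℝ) → ℝ
  | [], _ => 0
  | g :: l, m => m g * g.a + Va l m

noncomputable def Vb : List Heis → (Heis → ℝ) → ℝ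
  | [], _ => 0
  | g :: l, m => m g * g.b + Vb l m

/-- total weight -/
noncomputable def Wt : List Heis → (Heis → ℝ) → ℝ
  | [], _ => 0
  | g :: l, m => m g + Wt l m

/-- weighted sum of `sy` -/
noncomputable def Vs : List Heis → (Heis → ℝ) → ℝ
  | [], _ => 0
  | g :: l, m => m g * sy g + Vs l m

/-- twice the signed area of the polygonal path with sides `m g • g`, in the order of the list. -/
noncomputable def E : List Heis → (Heis → ℝ) → ℝ
  | [], _ => 0
  | g :: l, m => m g * (g.a * Vb l m - g.b * Va l m) + E l m

lemma Va_append (l k : List Heis) (m : Heis → ℝ) : Va (l ++ k) m = Va l m + Va k m := by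
  induction l with
  | nil => simp [Va]
  | cons g l ih => simp only [List.cons_append, Va, ih]; ring

lemma Vb_append (l k : List Heis) (m : Heis → ℝ) : Vb (l ++ k) m = Vb l m + Vb k m := by
  induction l with
  | nil => simp [Vb]
  | cons g l ih => simp only [List.cons_append, Vb, ih]; ring

lemma E_append (l k : List Heis) (m : Heis → ℝ) :
    E (l ++ k) m = E l m + E k m + (Va l m * Vb k m - Vb l m * Va k m) := by
  induction l with
  | nil => simp [E, Va, Vb]
  | cons g l ih => simp only [List.cons_append, E, ih, Va, Vb, Va_append, Vb_append]; ring

lemma Va_congr (l : List Heis) (m m' : Heis → ℝ) (h : ∀ g ∈ l, m g = m' g) :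
    Va l m = Va l m' := by
  induction l with
  | nil => rfl
  | cons g l ih =>
    simp only [Va]
    rw [h g (by simp), ih (fun g hg => h g (by simp [hg]))]

lemma Vb_congr (l : List Heis) (m m' : Heis → ℝ) (h : ∀ g ∈ l, m g = m' g) :
    Vb l m = Vb l m' := by
  induction l with
  | nil => rfl
  | cons g l ih =>
    simp only [Vb]
    rw [h g (by simp), ih (fun g hg => h g (by simp [hg]))]

lemma E_congr (l : List Heis) (m m' : Heis → ℝ) (h : ∀ g ∈ l, m g = m' g) :
    E l m = E l m' := by
  induction l with
  | nil => rfl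
  | cons g l ih =>
    have h' : ∀ g ∈ l, m g = m' g := fun g hg => h g (by simp [hg])
    simp only [E]
    rw [h g (by simp), ih h', Va_congr l m m' h', Vb_congr l m m' h']

lemma Va_perm {l k : List Heis} (h : l.Perm k) (m : Heis → ℝ) : Va l m = Va k m := by
  induction h with
  | nil => rfl
  | cons x _ ih => simp only [Va, ih]
  | swap x y l => simp only [Va]; ring
  | trans _ _ h1 h2 => rw [h1, h2]

lemma Vb_perm {l k : List Heis} (h : l.Perm k) (m : Heis → ℝ) : Vb l m = Vb k m := by
  induction h with
  | nil => rfl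
  | cons x _ ih => simp only [Vb, ih]
  | swap x y l => simp only [Vb]; ring
  | trans _ _ h1 h2 => rw [h1, h2]

lemma Wt_perm {l k : List Heis} (h : l.Perm k) (m : Heis → ℝ) : Wt l m = Wt k m := by
  induction h with
  | nil => rfl
  | cons x _ ih => simp only [Wt, ih]
  | swap x y l => simp only [Wt]; ring
  | trans _ _ h1 h2 => rw [h1, h2]

lemma Va_lin (l : List Heis) (m μ : Heis → ℝ) (r t : ℝ) :
    Va l (fun g => r * m g + t * μ g) = r * Va l m + t * Va l μ := by
  induction l with
  | nil => simp [Va]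
  | cons g l ih => simp only [Va, ih]; ring

lemma Vb_lin (l : List Heis) (m μ : Heis → ℝ) (r t : ℝ) :
    Vb l (fun g => r * m g + t * μ g) = r * Vb l m + t * Vb l μ := by
  induction l with
  | nil => simp [Vb]
  | cons g l ih => simp only [Vb, ih]; ring

lemma Wt_lin (l : List Heis) (m μ : Heis → ℝ) (r t : ℝ) :
    Wt l (fun g => r * m g + t * μ g) = r * Wt l m + t * Wt l μ := by
  induction l with
  | nil => simp [Wt]
  | cons g l ih => simp only [Wt, ih]; ring

/-- parallelogram law -/
lemma E_par (l : List Heis) (m μ : Heis → ℝ) :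
    E l (fun g => 1 * m g + 1 * μ g) + E l (fun g => 1 * m g + (-1) * μ g)
      = 2 * E l m + 2 * E l μ := by
  induction l with
  | nil => simp [E]
  | cons g l ih =>
    simp only [E, Va_lin, Vb_lin]
    linear_combination ih

lemma E_smul (l : List Heis) (m : Heis → ℝ) (r : ℝ) :
    E l (fun g => r * m g) = r ^ 2 * E l m := by
  induction l with
  | nil => simp [E]
  | cons g l ih =>
    have h1 := Va_lin l m m r 0
    have h2 := Vb_lin l m m r 0
    simp only [zero_mul, add_zero] at h1 h2
    simp only [E, h1, h2, ih]; ring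

lemma Wt_nonneg (l : List Heis) (m : Heis → ℝ) (h : ∀ g, 0 ≤ m g) : 0 ≤ Wt l m := by
  induction l with
  | nil => simp [Wt]
  | cons g l ih => simp only [Wt]; linarith [h g]

lemma Wt_mono (l : List Heis) (m m' : Heis → ℝ) (h : ∀ g, m g ≤ m' g) : Wt l m ≤ Wt l m' := by
  induction l with
  | nil => simp [Wt]
  | cons g l ih => simp only [Wt]; linarith [h g]

lemma le_Wt (l : List Heis) (m : Heis → ℝ) (h : ∀ g, 0 ≤ m g) (g : Heis) (hg : g ∈ l) :
    m g ≤ Wt l m := by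
  induction l with
  | nil => simp at hg
  | cons k l ih =>
    simp only [Wt]
    rcases List.mem_cons.1 hg with rfl | hg
    · linarith [Wt_nonneg l m h]
    · linarith [ih hg, h k]

/-- inversion of all letters -/
lemma Va_inv (l : List Heis) (m : Heis → ℝ) :
    Va (l.map (fun g => g⁻¹)) (fun g => m g⁻¹) = - Va l m := by
  induction l with
  | nil => simp [Va]
  | cons g l ih =>
    simp only [List.map_cons, Va, ih, inv_inv, Heis.inv_a]; push_cast; ring

lemma Vb_inv (l : List Heis) (m : Heis → ℝ) :
    Vb (l.map (fun g => g⁻¹)) (fun g => m g⁻¹) = - Vb l m := by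
  induction l with
  | nil => simp [Vb]
  | cons g l ih =>
    simp only [List.map_cons, Vb, ih, inv_inv, Heis.inv_b]; push_cast; ring

lemma Wt_inv (l : List Heis) (m : Heis → ℝ) :
    Wt (l.map (fun g => g⁻¹)) (fun g => m g⁻¹) = Wt l m := by
  induction l with
  | nil => simp [Wt]
  | cons g l ih =>
    simp only [List.map_cons, Wt, ih, inv_inv]

lemma E_inv (l : List Heis) (m : Heis → ℝ) :
    E (l.map (fun g => g⁻¹)) (fun g => m g⁻¹) = E l m := by
  induction l with
  | nil => simp [E]
  | cons g l ih =>
    simp only [List.map_cons, E, ih, inv_inv, Va_inv, Vb_inv, Heis.inv_a, Heis.inv_b]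
    push_cast; ring

/-! ### Bounds -/

lemma Va_diff (l : List Heis) (K d : ℝ) (m m' : Heis → ℝ) (_hK : 0 ≤ K)
    (hKg : ∀ g ∈ l, |(g.a : ℝ)| ≤ K) (hd : ∀ g ∈ l, |m g - m' g| ≤ d) :
    |Va l m - Va l m'| ≤ l.length * (d * K) := by
  induction l with
  | nil => simp [Va]
  | cons g l ih =>
    have h1 := ih (fun g hg => hKg g (by simp [hg])) (fun g hg => hd g (by simp [hg]))
    have h2 : |(m g - m' g) * g.a| ≤ d * K := by
      rw [abs_mul]
      have := hd g (by simp)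
      exact mul_le_mul this (hKg g (by simp)) (abs_nonneg _) ((abs_nonneg _).trans this)
    have h3 := abs_add_le ((m g - m' g) * g.a) (Va l m - Va l m')
    simp only [Va, List.length_cons]
    rw [show m g * g.a + Va l m - (m' g * g.a + Va l m')
      = (m g - m' g) * g.a + (Va l m - Va l m') by ring]
    push_cast
    linarith

lemma Vb_diff (l : List Heis) (K d : ℝ) (m m' : Heis → ℝ) (_hK : 0 ≤ K)
    (hKg : ∀ g ∈ l, |(g.b : ℝ)| ≤ K) (hd : ∀ g ∈ l, |m g - m' g| ≤ d) :
    |Vb l m - Vb l m'| ≤ l.length * (d * K) := by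
  induction l with
  | nil => simp [Vb]
  | cons g l ih =>
    have h1 := ih (fun g hg => hKg g (by simp [hg])) (fun g hg => hd g (by simp [hg]))
    have h2 : |(m g - m' g) * g.b| ≤ d * K := by
      rw [abs_mul]
      have := hd g (by simp)
      exact mul_le_mul this (hKg g (by simp)) (abs_nonneg _) ((abs_nonneg _).trans this)
    have h3 := abs_add_le ((m g - m' g) * g.b) (Vb l m - Vb l m')
    simp only [Vb, List.length_cons]
    rw [show m g * g.b + Vb l m - (m' g * g.b + Vb l m')
      = (m g - m' g) * g.b + (Vb l m - Vb l m') by ring]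
    push_cast
    linarith

lemma Va_zero (l : List Heis) : Va l (fun _ => 0) = 0 := by
  induction l with
  | nil => rfl
  | cons g l ih => simp [Va, ih]

lemma Vb_zero (l : List Heis) : Vb l (fun _ => 0) = 0 := by
  induction l with
  | nil => rfl
  | cons g l ih => simp [Vb, ih]

lemma E_zero (l : List Heis) : E l (fun _ => 0) = 0 := by
  induction l with
  | nil => rfl
  | cons g l ih => simp [E, ih]

lemma Wt_zero (l : List Heis) : Wt l (fun _ => 0) = 0 := by
  induction l with
  | nil => rfl
  | cons g l ih => simp [Wt, ih]

lemma om_bound (a b u v K X : ℝ) (ha : |a| ≤ K) (hb : |b| ≤ K) (hu : |u| ≤ X) (hv : |v| ≤ X) :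
    |a * v - b * u| ≤ 2 * (K * X) := by
  have h1 : |a * v| ≤ K * X := by
    rw [abs_mul]; exact mul_le_mul ha hv (abs_nonneg _) ((abs_nonneg _).trans ha)
  have h2 : |b * u| ≤ K * X := by
    rw [abs_mul]; exact mul_le_mul hb hu (abs_nonneg _) ((abs_nonneg _).trans ha)
  have := abs_sub (a * v) (b * u)
  linarith

lemma E_diff (l : List Heis) (K c d : ℝ) (m m' : Heis → ℝ) (hK : 0 ≤ K) (hc : 0 ≤ c) (hd0 : 0 ≤ d)
    (hKa : ∀ g ∈ l, |(g.a : ℝ)| ≤ K) (hKb : ∀ g ∈ l, |(g.b : ℝ)| ≤ K)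
    (hm : ∀ g ∈ l, |m g| ≤ c) (hm' : ∀ g ∈ l, |m' g| ≤ c)
    (hd : ∀ g ∈ l, |m g - m' g| ≤ d) :
    |E l m - E l m'| ≤ 4 * K ^ 2 * c * d * (l.length : ℝ) ^ 2 := by
  induction l with
  | nil => simp [E]
  | cons g l ih =>
    have hKa' : ∀ g ∈ l, |(g.a : ℝ)| ≤ K := fun g hg => hKa g (by simp [hg])
    have hKb' : ∀ g ∈ l, |(g.b : ℝ)| ≤ K := fun g hg => hKb g (by simp [hg])
    have hd' : ∀ g ∈ l, |m g - m' g| ≤ d := fun g hg => hd g (by simp [hg])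
    have hmm : ∀ g ∈ l, |m g| ≤ c := fun g hg => hm g (by simp [hg])
    have h1 := ih hKa' hKb' hmm (fun g hg => hm' g (by simp [hg])) hd'
    have hVa := Va_diff l K d m m' hK hKa' hd'
    have hVb := Vb_diff l K d m m' hK hKb' hd'
    have hVa0 := Va_diff l K c m (fun _ => 0) hK hKa' (by simpa using hmm)
    have hVb0 := Vb_diff l K c m (fun _ => 0) hK hKb' (by simpa using hmm)
    rw [Va_zero, sub_zero] at hVa0
    rw [Vb_zero, sub_zero] at hVb0
    have ha := hKa g (by simp)
    have hb := hKb g (by simp)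
    have o1 := om_bound _ _ _ _ _ _ ha hb hVa0 hVb0
    have o2 := om_bound _ _ _ _ _ _ ha hb hVa hVb
    simp only [E, List.length_cons]
    set n : ℝ := (l.length : ℝ) with hn
    have hn0 : 0 ≤ n := by positivity
    have p1 : |(m g - m' g) * (g.a * Vb l m - g.b * Va l m)| ≤ d * (2 * (K * (n * (c * K)))) := by
      rw [abs_mul]; exact mul_le_mul (hd g (by simp)) o1 (abs_nonneg _) hd0
    have p2 : |m' g * (g.a * (Vb l m - Vb l m') - g.b * (Va l m - Va l m'))|
        ≤ c * (2 * (K * (n * (d * K)))) := by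
      rw [abs_mul]; exact mul_le_mul (hm' g (by simp)) o2 (abs_nonneg _) hc
    rw [show m g * (g.a * Vb l m - g.b * Va l m) + E l m
        - (m' g * (g.a * Vb l m' - g.b * Va l m') + E l m')
        = (m g - m' g) * (g.a * Vb l m - g.b * Va l m)
        + m' g * (g.a * (Vb l m - Vb l m') - g.b * (Va l m - Va l m')) + (E l m - E l m') by ring]
    have t1 := abs_add_le ((m g - m' g) * (g.a * Vb l m - g.b * Va l m)
        + m' g * (g.a * (Vb l m - Vb l m') - g.b * (Va l m - Va l m'))) (E l m - E l m')
    have t2 := abs_add_le ((m g - m' g) * (g.a * Vb l m - g.b * Va l m))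
        (m' g * (g.a * (Vb l m - Vb l m') - g.b * (Va l m - Va l m')))
    have hpos : 0 ≤ K ^ 2 * c * d := by positivity
    push_cast
    nlinarith [mul_nonneg hpos hn0]

/-- If all pairs with positive weight are parallel, the area vanishes. -/
lemma E_eq_zero (l : List Heis) (m : Heis → ℝ)
    (h : ∀ g ∈ l, ∀ k ∈ l, m g * m k * (g.a * k.b - g.b * k.a : ℝ) = 0) : E l m = 0 := by
  have aux : ∀ (g : Heis) (l : List Heis),
      (∀ k ∈ l, m g * m k * (g.a * k.b - g.b * k.a : ℝ) = 0) →
      m g * (g.a * Vb l m - g.b * Va l m) = 0 := by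
    intro g l
    induction l with
    | nil => intro _; simp [Va, Vb]
    | cons k l ih =>
      intro h
      have h1 := h k (by simp)
      have h2 := ih (fun k hk => h k (by simp [hk]))
      simp only [Va, Vb]
      linear_combination h1 + h2
  induction l with
  | nil => rfl
  | cons g l ih =>
    simp only [E]
    rw [aux g l (fun k hk => h g (by simp) k (by simp [hk])),
      ih (fun g hg k hk => h g (by simp [hg]) k (by simp [hk]))]
    simp

lemma Va_cont (l : List Heis) : Continuous (fun m : Heis → ℝ => Va l m) := by
  induction l with
  | nil => simp only [Va]; exact continuous_const
  | cons g l ih => simp only [Va]; fun_prop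

lemma Vb_cont (l : List Heis) : Continuous (fun m : Heis → ℝ => Vb l m) := by
  induction l with
  | nil => simp only [Vb]; exact continuous_const
  | cons g l ih => simp only [Vb]; fun_prop

lemma Wt_cont (l : List Heis) : Continuous (fun m : Heis → ℝ => Wt l m) := by
  induction l with
  | nil => simp only [Wt]; exact continuous_const
  | cons g l ih => simp only [Wt]; fun_prop

lemma E_cont (l : List Heis) : Continuous (fun m : Heis → ℝ => E l m) := by
  induction l with
  | nil => simp only [E]; exact continuous_const
  | cons g l ih =>
    have h1 := Va_cont l
    have h2 := Vb_cont l
    simp only [E]; fun_prop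

/-! ### Words -/

open Classical in
/-- indicator weight -/
noncomputable def dl (g k : Heis) : ℝ := if k = g then 1 else 0

lemma dl_self (g : Heis) : dl g g = 1 := by simp [dl]
lemma dl_ne {g k : Heis} (h : k ≠ g) : dl g k = 0 := by simp [dl, h]
lemma dl_nonneg (g k : Heis) : 0 ≤ dl g k := by unfold dl; split_ifs <;> norm_num
lemma dl_le (g k : Heis) : dl g k ≤ 1 := by unfold dl; split_ifs <;> norm_num

/-- letter counts of a word -/
noncomputable def cnt : List Heis → Heis → ℝ
  | [] => fun _ => 0
  | g :: w => fun k => 1 * cnt w k + 1 * dl g k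

lemma cnt_nonneg (w : List Heis) (k : Heis) : 0 ≤ cnt w k := by
  induction w with
  | nil => simp [cnt]
  | cons g w ih => simp only [cnt]; linarith [dl_nonneg g k]

lemma Va_dl {l : List Heis} {g : Heis} (hl : l.Nodup) (hg : g ∈ l) : Va l (dl g) = g.a := by
  induction l with
  | nil => simp at hg
  | cons k l ih =>
    rw [List.nodup_cons] at hl
    simp only [Va]
    rcases List.mem_cons.1 hg with rfl | h
    · rw [dl_self, Va_congr l (dl g) (fun _ => 0)
        (fun k hk => dl_ne (fun e => hl.1 (e ▸ hk))), Va_zero]; ring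
    · rw [dl_ne (g := g) (k := k) (fun e => hl.1 (e ▸ h)), ih hl.2 h]; ring

lemma Vb_dl {l : List Heis} {g : Heis} (hl : l.Nodup) (hg : g ∈ l) : Vb l (dl g) = g.b := by
  induction l with
  | nil => simp at hg
  | cons k l ih =>
    rw [List.nodup_cons] at hl
    simp only [Vb]
    rcases List.mem_cons.1 hg with rfl | h
    · rw [dl_self, Vb_congr l (dl g) (fun _ => 0)
        (fun k hk => dl_ne (fun e => hl.1 (e ▸ hk))), Vb_zero]; ring
    · rw [dl_ne (g := g) (k := k) (fun e => hl.1 (e ▸ h)), ih hl.2 h]; ring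

lemma Wt_congr (l : List Heis) (m m' : Heis → ℝ) (h : ∀ g ∈ l, m g = m' g) :
    Wt l m = Wt l m' := by
  induction l with
  | nil => rfl
  | cons g l ih =>
    simp only [Wt]
    rw [h g (by simp), ih (fun g hg => h g (by simp [hg]))]

lemma Wt_dl {l : List Heis} {g : Heis} (hl : l.Nodup) (hg : g ∈ l) : Wt l (dl g) = 1 := by
  induction l with
  | nil => simp at hg
  | cons k l ih =>
    rw [List.nodup_cons] at hl
    simp only [Wt]
    rcases List.mem_cons.1 hg with rfl | h
    · rw [dl_self, Wt_congr l (dl g) (fun _ => 0)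
        (fun k hk => dl_ne (fun e => hl.1 (e ▸ hk))), Wt_zero]; ring
    · rw [dl_ne (g := g) (k := k) (fun e => hl.1 (e ▸ h)), ih hl.2 h]; ring

lemma Va_cnt {L : List Heis} (hL : L.Nodup) (w : List Heis) (hw : ∀ g ∈ w, g ∈ L) :
    Va L (cnt w) = w.prod.a := by
  induction w with
  | nil => simp [cnt, Va_zero]
  | cons g w ih =>
    simp only [cnt]
    rw [Va_lin, ih (fun g hg => hw g (by simp [hg])), Va_dl hL (hw g (by simp)),
      List.prod_cons, Heis.mul_a]
    push_cast; ring

lemma Vb_cnt {L : List Heis} (hL : L.Nodup) (w : List Heis) (hw : ∀ g ∈ w, g ∈ L) :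
    Vb L (cnt w) = w.prod.b := by
  induction w with
  | nil => simp [cnt, Vb_zero]
  | cons g w ih =>
    simp only [cnt]
    rw [Vb_lin, ih (fun g hg => hw g (by simp [hg])), Vb_dl hL (hw g (by simp)),
      List.prod_cons, Heis.mul_b]
    push_cast; ring

lemma Wt_cnt {L : List Heis} (hL : L.Nodup) (w : List Heis) (hw : ∀ g ∈ w, g ∈ L) :
    Wt L (cnt w) = w.length := by
  induction w with
  | nil => simp [cnt, Wt_zero]
  | cons g w ih =>
    simp only [cnt]
    rw [Wt_lin, ih (fun g hg => hw g (by simp [hg])), Wt_dl hL (hw g (by simp)),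
      List.length_cons]
    push_cast; ring

/-- Every word is dominated in area by a block word with the same letter counts. -/
lemma merge {L : List Heis} (hL : L.Nodup) (K : ℝ) (hs : ∀ g ∈ L, |(sy g : ℝ)| ≤ K)
    (w : List Heis) (hw : ∀ g ∈ w, g ∈ L) :
    ∃ σ : List Heis, σ.Perm L ∧ (sy w.prod : ℝ) ≤ K * w.length + E σ (cnt w) := by
  induction w with
  | nil => exact ⟨L, List.Perm.refl _, by simp [cnt, E_zero, sy_one]⟩
  | cons g w ih =>
    have hw' : ∀ g ∈ w, g ∈ L := fun g hg => hw g (by simp [hg])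
    obtain ⟨σ, hσ, hle⟩ := ih hw'
    have hgL : g ∈ L := hw g (by simp)
    obtain ⟨Y, Z, rfl⟩ := List.append_of_mem (hσ.mem_iff.2 hgL)
    have hnd : (Y ++ g :: Z).Nodup := hσ.nodup_iff.2 hL
    have hnd2 : (g :: (Y ++ Z)).Nodup := (List.perm_middle.nodup_iff).1 hnd
    rw [List.nodup_cons, List.mem_append, not_or] at hnd2
    obtain ⟨⟨hgY, hgZ⟩, -⟩ := hnd2
    have cY : ∀ k ∈ Y, cnt (g :: w) k = cnt w k := by
      intro k hk
      simp only [cnt]; rw [dl_ne (g := g) (k := k) (fun e => hgY (e ▸ hk))]; ring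
    have cZ : ∀ k ∈ Z, cnt (g :: w) k = cnt w k := by
      intro k hk
      simp only [cnt]; rw [dl_ne (g := g) (k := k) (fun e => hgZ (e ▸ hk))]; ring
    have cg : cnt (g :: w) g = cnt w g + 1 := by
      simp only [cnt]; rw [dl_self]; ring
    have hq : 0 ≤ cnt w g := cnt_nonneg w g
    have ha : Va (Y ++ g :: Z) (cnt w) = w.prod.a := by rw [Va_perm hσ, Va_cnt hL w hw']
    have hb : Vb (Y ++ g :: Z) (cnt w) = w.prod.b := by rw [Vb_perm hσ, Vb_cnt hL w hw']
    have hsg := (abs_le.1 (hs g hgL)).2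
    have hprod : (sy (g :: w).prod : ℝ) = sy g + sy w.prod + (g.a * w.prod.b - g.b * w.prod.a) := by
      rw [List.prod_cons, sy_mul, om]; push_cast; ring
    rw [← ha, ← hb] at hprod
    rw [Va_append, Vb_append] at hprod
    rw [E_append] at hle
    simp only [E, Va, Vb] at hle hprod
    by_cases hsign : 0 ≤ (g.a * Vb Y (cnt w) - g.b * Va Y (cnt w) : ℝ)
    · refine ⟨g :: (Y ++ Z), List.perm_middle.symm.trans hσ, ?_⟩
      simp only [E]
      rw [Va_append, Vb_append, E_append, cg, Va_congr Y _ _ cY, Vb_congr Y _ _ cY,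
        E_congr Y _ _ cY, Va_congr Z _ _ cZ, Vb_congr Z _ _ cZ, E_congr Z _ _ cZ,
        hprod, List.length_cons]
      push_cast
      nlinarith [mul_nonneg hq hsign]
    · refine ⟨Y ++ g :: Z, hσ, ?_⟩
      rw [E_append]
      simp only [E, Va, Vb]
      rw [cg, Va_congr Y _ _ cY, Vb_congr Y _ _ cY,
        E_congr Y _ _ cY, Va_congr Z _ _ cZ, Vb_congr Z _ _ cZ, E_congr Z _ _ cZ,
        hprod, List.length_cons]
      push_cast
      nlinarith

/-- block word -/
def blk : List Heis → (Heis → ℕ) → List Heis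
  | [], _ => []
  | g :: l, n => List.replicate (n g) g ++ blk l n

lemma blk_mem (l : List Heis) (n : Heis → ℕ) : ∀ g ∈ blk l n, g ∈ l := by
  induction l with
  | nil => simp [blk]
  | cons g l ih =>
    intro k hk
    simp only [blk, List.mem_append, List.mem_replicate] at hk
    rcases hk with h | h
    · simp [h.2]
    · simp [ih k h]

lemma blk_length (l : List Heis) (n : Heis → ℕ) :
    ((blk l n).length : ℝ) = Wt l (fun g => (n g : ℝ)) := by
  induction l with
  | nil => simp [blk, Wt]
  | cons g l ih => simp [blk, Wt, ih]

lemma blk_a (l : List Heis) (n : Heis → ℕ) :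
    ((blk l n).prod.a : ℝ) = Va l (fun g => (n g : ℝ)) := by
  induction l with
  | nil => simp [blk, Va]
  | cons g l ih => simp [blk, Va, ← ih, List.prod_append, List.prod_replicate, pow_a]

lemma blk_b (l : List Heis) (n : Heis → ℕ) :
    ((blk l n).prod.b : ℝ) = Vb l (fun g => (n g : ℝ)) := by
  induction l with
  | nil => simp [blk, Vb]
  | cons g l ih => simp [blk, Vb, ← ih, List.prod_append, List.prod_replicate, pow_b]

lemma blk_sy (l : List Heis) (n : Heis → ℕ) (K : ℝ) (hs : ∀ g ∈ l, |(sy g : ℝ)| ≤ K) :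
    E l (fun g => (n g : ℝ)) - K * (blk l n).length ≤ (sy (blk l n).prod : ℝ) := by
  induction l with
  | nil => simp [blk, E, sy_one]
  | cons g l ih =>
    have h1 := ih (fun g hg => hs g (by simp [hg]))
    have h2 := (abs_le.1 (hs g (by simp))).1
    have h3 : (0 : ℝ) ≤ n g := by positivity
    simp only [blk, E]
    rw [List.prod_append, List.prod_replicate, sy_mul, sy_pow, om, pow_a, pow_b,
      List.length_append, List.length_replicate]
    push_cast
    rw [blk_a, blk_b]
    nlinarith

/-! ### Interpolation between permutations of a word -/

lemma prod_a_perm {l k : List Heis} (h : l.Perm k) : l.prod.a = k.prod.a := by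
  induction h with
  | nil => rfl
  | cons x _ ih => simp [ih]
  | swap x y l => simp; ring
  | trans _ _ h1 h2 => rw [h1, h2]

lemma prod_b_perm {l k : List Heis} (h : l.Perm k) : l.prod.b = k.prod.b := by
  induction h with
  | nil => rfl
  | cons x _ ih => simp [ih]
  | swap x y l => simp; ring
  | trans _ _ h1 h2 => rw [h1, h2]

lemma interp (L : List Heis) (C : ℤ) (hC0 : 0 ≤ C)
    (hC : ∀ g ∈ L, ∀ k ∈ L, |2 * om g k| ≤ C) {l k : List Heis} (h : l.Perm k) :
    (∀ g ∈ l, g ∈ L) → ∀ t ∈ Set.uIcc (sy l.prod) (sy k.prod),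
      ∃ u : List Heis, u.Perm l ∧ |sy u.prod - t| ≤ C := by
  induction h with
  | nil =>
    intro _ t ht
    refine ⟨[], List.Perm.refl _, ?_⟩
    rw [Set.uIcc_self, Set.mem_singleton_iff] at ht
    subst ht; simpa using hC0
  | @cons x l₁ l₂ hp ih =>
    intro hl t ht
    have e1 : sy (x :: l₁).prod = sy l₁.prod + (sy x + om x l₁.prod) := by
      rw [List.prod_cons, sy_mul]; ring
    have e2 : sy (x :: l₂).prod = sy l₂.prod + (sy x + om x l₁.prod) := by
      rw [List.prod_cons, sy_mul, om, om, prod_a_perm hp, prod_b_perm hp]; ring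
    have ht' : t - (sy x + om x l₁.prod) ∈ Set.uIcc (sy l₁.prod) (sy l₂.prod) := by
      rw [Set.mem_uIcc] at ht ⊢; omega
    obtain ⟨u, hu, hut⟩ := ih (fun g hg => hl g (by simp [hg])) _ ht'
    refine ⟨x :: u, hu.cons x, ?_⟩
    have e3 : sy (x :: u).prod = sy u.prod + (sy x + om x l₁.prod) := by
      rw [List.prod_cons, sy_mul, om, om, prod_a_perm hu, prod_b_perm hu]; ring
    rw [e3]
    rw [abs_le] at hut ⊢; omega
  | swap x y l =>
    intro hl t ht
    refine ⟨y :: x :: l, List.Perm.refl _, ?_⟩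
    have h1 := hC y (hl y (by simp)) x (hl x (by simp))
    have e : sy (y :: x :: l).prod = sy (x :: y :: l).prod + 2 * om y x := by
      simp only [List.prod_cons, sy_mul, om, Heis.mul_a, Heis.mul_b]; ring
    rw [Set.mem_uIcc] at ht
    rw [abs_le] at h1 ⊢
    omega
  | @trans l₁ l₂ l₃ h1 h2 ih1 ih2 =>
    intro hl t ht
    rcases Set.uIcc_subset_uIcc_union_uIcc (b := sy l₂.prod) ht with h | h
    · exact ih1 hl t h
    · obtain ⟨u, hu, hut⟩ := ih2 (fun g hg => hl g (h1.mem_iff.2 hg)) t h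
      exact ⟨u, hu.trans h1.symm, hut⟩

lemma sy_reverse (K : ℝ) (w : List Heis) (hs : ∀ g ∈ w, |(sy g : ℝ)| ≤ K) :
    (sy w.prod : ℝ) + sy w.reverse.prod ≤ 2 * K * w.length := by
  induction w with
  | nil => simp [sy_one]
  | cons g w ih =>
    have h1 := ih (fun g hg => hs g (by simp [hg]))
    have h2 := (abs_le.1 (hs g (by simp))).2
    have ea := prod_a_perm (List.reverse_perm w)
    have eb := prod_b_perm (List.reverse_perm w)
    rw [List.reverse_cons, List.prod_append, List.prod_cons, List.prod_singleton,
      sy_mul, sy_mul, om, om, ea, eb, List.length_cons]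
    push_cast
    linarith

lemma prod_bound (K : ℝ) (hK : 1 ≤ K) (w : List Heis) (ha : ∀ g ∈ w, |(g.a : ℝ)| ≤ K)
    (hb : ∀ g ∈ w, |(g.b : ℝ)| ≤ K) (hs : ∀ g ∈ w, |(sy g : ℝ)| ≤ K) :
    |(w.prod.a : ℝ)| ≤ K * w.length ∧ |(w.prod.b : ℝ)| ≤ K * w.length ∧
      |(sy w.prod : ℝ)| ≤ 3 * K ^ 2 * (w.length : ℝ) ^ 2 := by
  induction w with
  | nil => simp [sy_one]
  | cons g w ih =>
    obtain ⟨h1, h2, h3⟩ := ih (fun g hg => ha g (by simp [hg])) (fun g hg => hb g (by simp [hg]))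
      (fun g hg => hs g (by simp [hg]))
    have ga := ha g (by simp)
    have gb := hb g (by simp)
    have gs := hs g (by simp)
    have hom := om_bound _ _ _ _ _ _ ga gb h1 h2
    rw [List.prod_cons, Heis.mul_a, Heis.mul_b, sy_mul, om, List.length_cons]
    push_cast
    set n : ℝ := (w.length : ℝ)
    have hn : 0 ≤ n := by positivity
    refine ⟨?_, ?_, ?_⟩
    · refine (abs_add_le _ _).trans ?_; linarith
    · refine (abs_add_le _ _).trans ?_; linarith
    · refine (abs_add_le _ _).trans ?_
      have := abs_add_le (sy g : ℝ) (sy w.prod)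
      nlinarith [mul_nonneg (mul_nonneg (show (0 : ℝ) ≤ K by linarith) (show (0 : ℝ) ≤ K by linarith)) hn]

/-! ### The extremal polygon -/

lemma exists_max (L : List Heis) :
    ∃ (σ : List Heis) (m : Heis → ℝ), σ.Perm L ∧ (∀ g, 0 ≤ m g ∧ m g ≤ 1) ∧ Wt L m ≤ 1 ∧
      Va L m = 0 ∧ Vb L m = 0 ∧
      ∀ (σ' : List Heis) (m' : Heis → ℝ), σ'.Perm L → (∀ g, 0 ≤ m' g ∧ m' g ≤ 1) →
        Wt L m' ≤ 1 → Va L m' = 0 → Vb L m' = 0 → E σ' m' ≤ E σ m := by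
  let P : Set (Heis → ℝ) := Set.univ.pi (fun _ => Set.Icc (0 : ℝ) 1) ∩
    {m | Wt L m ≤ 1 ∧ Va L m = 0 ∧ Vb L m = 0}
  have hPc : IsCompact P := by
    refine (isCompact_univ_pi (fun _ => isCompact_Icc)).inter_right ?_
    refine (isClosed_le (Wt_cont L) continuous_const).inter ?_
    exact (isClosed_eq (Va_cont L) continuous_const).inter
      (isClosed_eq (Vb_cont L) continuous_const)
  have hPne : P.Nonempty := by
    refine ⟨fun _ => 0, ?_, ?_⟩
    · intro g _; simp
    · exact ⟨by rw [Wt_zero]; norm_num, Va_zero L, Vb_zero L⟩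
  have hmax : ∀ σ : List Heis, ∃ m ∈ P, ∀ m' ∈ P, E σ m' ≤ E σ m := fun σ =>
    hPc.exists_isMaxOn hPne (E_cont σ).continuousOn
  choose f hfP hf using hmax
  have hfin : {σ : List Heis | σ.Perm L}.Finite := by
    refine (List.finite_toSet L.permutations).subset ?_
    intro σ hσ
    exact List.mem_permutations.2 hσ
  obtain ⟨σ, hσ, hσmax⟩ := Set.exists_max_image _ (fun σ => E σ (f σ)) hfin
    ⟨L, List.Perm.refl L⟩
  refine ⟨σ, f σ, hσ, fun g => (hfP σ).1 g trivial, (hfP σ).2.1, (hfP σ).2.2.1, (hfP σ).2.2.2, ?_⟩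
  intro σ' m' h1 h2 h3 h4 h5
  exact (hf σ' m' ⟨fun g _ => h2 g, h3, h4, h5⟩).trans (hσmax σ' h1)

lemma cnt_le (w : List Heis) (k : Heis) : cnt w k ≤ w.length := by
  induction w with
  | nil => simp [cnt]
  | cons g w ih => simp only [cnt, List.length_cons]; push_cast; linarith [dl_le g k]

lemma area_upper {L : List Heis} (hL : L.Nodup) (K κ : ℝ) (hs : ∀ g ∈ L, |(sy g : ℝ)| ≤ K)
    (hκ : ∀ (σ' : List Heis) (m' : Heis → ℝ), σ'.Perm L → (∀ g, 0 ≤ m' g ∧ m' g ≤ 1) →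
        Wt L m' ≤ 1 → Va L m' = 0 → Vb L m' = 0 → E σ' m' ≤ κ)
    (w : List Heis) (hw : ∀ g ∈ w, g ∈ L) (ha : w.prod.a = 0) (hb : w.prod.b = 0) :
    (sy w.prod : ℝ) ≤ K * w.length + κ * (w.length : ℝ) ^ 2 := by
  obtain ⟨σ, hσ, hle⟩ := merge hL K hs w hw
  rcases Nat.eq_zero_or_pos w.length with h0 | hpos
  · have : w = [] := List.length_eq_zero_iff.1 h0
    subst this
    simp [sy_one]
  have hr : (0 : ℝ) < w.length := by exact_mod_cast hpos
  set r : ℝ := (w.length : ℝ) with hrdef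
  have h1 := hκ σ (fun g => r⁻¹ * cnt w g) hσ
    (fun g => ⟨mul_nonneg (by positivity) (cnt_nonneg w g), by
      rw [inv_mul_le_iff₀ hr, mul_one]; exact cnt_le w g⟩)
    (by
      have := Wt_lin L (cnt w) (cnt w) r⁻¹ 0
      simp only [zero_mul, add_zero] at this
      rw [this, Wt_cnt hL w hw, ← hrdef, inv_mul_cancel₀ hr.ne'])
    (by
      have := Va_lin L (cnt w) (cnt w) r⁻¹ 0
      simp only [zero_mul, add_zero] at this
      rw [this, Va_cnt hL w hw, ha]; simp)
    (by
      have := Vb_lin L (cnt w) (cnt w) r⁻¹ 0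
      simp only [zero_mul, add_zero] at this
      rw [this, Vb_cnt hL w hw, hb]; simp)
  rw [E_smul] at h1
  have h2 : E σ (cnt w) ≤ κ * r ^ 2 := by
    have h3 : r ^ 2 * (r⁻¹ ^ 2 * E σ (cnt w)) ≤ r ^ 2 * κ :=
      mul_le_mul_of_nonneg_left h1 (by positivity)
    have h4 : r ^ 2 * (r⁻¹ ^ 2 * E σ (cnt w)) = E σ (cnt w) := by
      field_simp
    linarith
  linarith

/-- Near the extremal closed polygon there are polygons with prescribed small
displacement and almost the same area. -/
lemma perturb {L : List Heis} (hL : L.Nodup) (hinv : ∀ g ∈ L, g⁻¹ ∈ L) (K : ℝ) (hK : 1 ≤ K)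
    (hKa : ∀ g ∈ L, |(g.a : ℝ)| ≤ K) (hKb : ∀ g ∈ L, |(g.b : ℝ)| ≤ K)
    (σ : List Heis) (m : Heis → ℝ) (hσ : σ.Perm L) (hm : ∀ g, 0 ≤ m g ∧ m g ≤ 1)
    (hW : Wt L m ≤ 1) (hVa : Va L m = 0) (hVb : Vb L m = 0) (hpos : 0 < E σ m) :
    ∃ C ρ : ℝ, 0 ≤ C ∧ 0 < ρ ∧ ∀ va vb τ : ℝ, |va| ≤ τ → |vb| ≤ τ → τ ≤ ρ →
      ∃ (σ' : List Heis) (m' : Heis → ℝ), σ'.Perm L ∧ (∀ g, 0 ≤ m' g) ∧ Wt L m' ≤ 1 ∧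
        Va L m' = va ∧ Vb L m' = vb ∧ E σ m - C * τ ^ 2 ≤ E σ' m' := by
  have hex : ∃ a ∈ L, ∃ b ∈ L, m a * m b * (a.a * b.b - a.b * b.a : ℝ) ≠ 0 := by
    by_contra hcon
    push Not at hcon
    have := E_eq_zero σ m (fun g hg k hk => hcon g (hσ.mem_iff.1 hg) k (hσ.mem_iff.1 hk))
    linarith
  obtain ⟨a, haL, b, hbL, hab⟩ := hex
  set ω : ℝ := a.a * b.b - a.b * b.a with hω
  have hω0 : ω ≠ 0 := fun h => hab (by rw [h]; ring)
  have hma : 0 < m a := lt_of_le_of_ne (hm a).1 (fun h => hab (by rw [← h]; ring))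
  have hmb : 0 < m b := lt_of_le_of_ne (hm b).1 (fun h => hab (by rw [← h]; ring))
  have hWa : m a ≤ Wt L m := le_Wt L m (fun g => (hm g).1) a haL
  set W := Wt L m with hWdef
  have hWpos : 0 < W := lt_of_lt_of_le hma hWa
  have hωpos : 0 < |ω| := abs_pos.2 hω0
  set c0 : ℝ := 2 * K / |ω| with hc0
  have hc0pos : 0 < c0 := by positivity
  set c1 : ℝ := 2 * c0 + 2 * c0 / W with hc1
  have hc1pos : 0 < c1 := by positivity
  set N : ℝ := (L.length : ℝ) with hN
  refine ⟨4 * K ^ 2 * c1 ^ 2 * N ^ 2, min (m a) (m b) / (4 * c0), by positivity,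
    div_pos (lt_min hma hmb) (by positivity), ?_⟩
  intro va vb τ hva hvb hτ
  have hτ0 : 0 ≤ τ := (abs_nonneg va).trans hva
  have hτ1 : c0 * τ ≤ min (m a) (m b) / 4 := by
    rw [le_div_iff₀ (by positivity)] at hτ
    linarith
  have hτa : c0 * τ ≤ m a / 4 := hτ1.trans (by linarith [min_le_left (m a) (m b)])
  have hτb : c0 * τ ≤ m b / 4 := hτ1.trans (by linarith [min_le_right (m a) (m b)])
  set α : ℝ := (va * b.b - vb * b.a) / ω with hα
  set β : ℝ := (a.a * vb - a.b * va) / ω with hβ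
  have hαb : |α| ≤ c0 * τ := by
    rw [hα, abs_div, hc0, div_mul_eq_mul_div]
    refine div_le_div_of_nonneg_right ?_ hωpos.le
    have := om_bound _ _ _ _ _ _ hva hvb (hKa b hbL) (hKb b hbL)
    linarith
  have hβb : |β| ≤ c0 * τ := by
    rw [hβ, abs_div, hc0, div_mul_eq_mul_div]
    refine div_le_div_of_nonneg_right ?_ hωpos.le
    have := om_bound _ _ _ _ _ _ (hKa a haL) (hKb a haL) hva hvb
    linarith
  set γ : ℝ := -(α + β) / W with hγ
  have hγb : |γ| ≤ 2 * c0 * τ / W := by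
    rw [hγ, abs_div, abs_neg, abs_of_pos hWpos]
    refine div_le_div_of_nonneg_right ?_ hWpos.le
    linarith [abs_add_le α β]
  have hγh : |γ| ≤ 1 / 2 := by
    refine hγb.trans ?_
    rw [div_le_iff₀ hWpos]; linarith
  let μ : Heis → ℝ := fun g => 1 * (α * dl a g + β * dl b g) + γ * m g
  have hμa : Va L μ = va := by
    show Va L (fun g => 1 * (α * dl a g + β * dl b g) + γ * m g) = va
    rw [Va_lin L (fun g => α * dl a g + β * dl b g) m, Va_lin, Va_dl hL haL, Va_dl hL hbL, hVa,
      hα, hβ]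
    field_simp
    rw [hω]; ring
  have hμb : Vb L μ = vb := by
    show Vb L (fun g => 1 * (α * dl a g + β * dl b g) + γ * m g) = vb
    rw [Vb_lin L (fun g => α * dl a g + β * dl b g) m, Vb_lin, Vb_dl hL haL, Vb_dl hL hbL, hVb,
      hα, hβ]
    field_simp
    rw [hω]; ring
  have hμW : Wt L μ = 0 := by
    show Wt L (fun g => 1 * (α * dl a g + β * dl b g) + γ * m g) = 0
    rw [Wt_lin L (fun g => α * dl a g + β * dl b g) m, Wt_lin, Wt_dl hL haL, Wt_dl hL hbL,
      ← hWdef, hγ]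
    field_simp
    ring
  have hμabs : ∀ g, |μ g| ≤ |α| * dl a g + |β| * dl b g + |γ| * m g := by
    intro g
    show |1 * (α * dl a g + β * dl b g) + γ * m g| ≤ _
    rw [one_mul]
    refine (abs_add_le _ _).trans ?_
    refine add_le_add ((abs_add_le _ _).trans ?_) ?_
    · rw [abs_mul, abs_mul, abs_of_nonneg (dl_nonneg a g), abs_of_nonneg (dl_nonneg b g)]
    · rw [abs_mul, abs_of_nonneg (hm g).1]
  have hμm : ∀ g, |μ g| ≤ m g := by
    intro g
    refine (hμabs g).trans ?_
    have t1 : |α| * dl a g ≤ m g / 4 := by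
      by_cases h : g = a
      · subst h; rw [dl_self]; linarith
      · rw [dl_ne h]; linarith [(hm g).1]
    have t2 : |β| * dl b g ≤ m g / 4 := by
      by_cases h : g = b
      · subst h; rw [dl_self]; linarith
      · rw [dl_ne h]; linarith [(hm g).1]
    have t3 : |γ| * m g ≤ 1 / 2 * m g := mul_le_mul_of_nonneg_right hγh (hm g).1
    linarith
  have hμc : ∀ g, |μ g| ≤ c1 * τ := by
    intro g
    refine (hμabs g).trans ?_
    have t1 : |α| * dl a g ≤ c0 * τ :=
      (mul_le_of_le_one_right (abs_nonneg _) (dl_le a g)).trans hαb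
    have t2 : |β| * dl b g ≤ c0 * τ :=
      (mul_le_of_le_one_right (abs_nonneg _) (dl_le b g)).trans hβb
    have t3 : |γ| * m g ≤ 2 * c0 * τ / W :=
      (mul_le_of_le_one_right (abs_nonneg _) (hm g).2).trans hγb
    have : c1 * τ = c0 * τ + c0 * τ + 2 * c0 * τ / W := by rw [hc1]; ring
    linarith
  have hEμ := E_diff σ K (c1 * τ) (c1 * τ) μ (fun _ => 0) (by linarith) (by positivity)
    (by positivity) (fun g hg => hKa g (hσ.mem_iff.1 hg)) (fun g hg => hKb g (hσ.mem_iff.1 hg))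
    (fun g _ => hμc g) (fun g _ => by rw [abs_zero]; positivity)
    (fun g _ => by rw [sub_zero]; exact hμc g)
  rw [E_zero, sub_zero, hσ.length_eq, ← hN] at hEμ
  have hEμ' := (abs_le.1 hEμ).1
  have hEμ2 : -(4 * K ^ 2 * c1 ^ 2 * N ^ 2 * τ ^ 2) ≤ E σ μ := by
    refine le_trans (le_of_eq ?_) hEμ'; ring
  have hpar := E_par σ m μ
  rcases le_total (E σ (fun g => 1 * m g + (-1) * μ g)) (E σ (fun g => 1 * m g + 1 * μ g))
    with hcase | hcase
  · refine ⟨σ, fun g => 1 * m g + 1 * μ g, hσ, ?_, ?_, ?_, ?_, by linarith⟩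
    · intro g; linarith [(abs_le.1 (hμm g)).1]
    · rw [Wt_lin, hμW]; linarith
    · rw [Va_lin, hμa, hVa]; ring
    · rw [Vb_lin, hμb, hVb]; ring
  · let m2 : Heis → ℝ := fun g => 1 * m g + (-1) * μ g
    have hp2 : (σ.map (fun g => g⁻¹)).Perm L := by
      have hndm : (σ.map (fun g : Heis => g⁻¹)).Nodup :=
        (hσ.nodup_iff.2 hL).map inv_injective
      rw [List.perm_ext_iff_of_nodup hndm hL]
      intro g
      rw [List.mem_map]
      constructor
      · rintro ⟨k, hk, rfl⟩; exact hinv k (hσ.mem_iff.1 hk)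
      · intro hg; exact ⟨g⁻¹, hσ.mem_iff.2 (hinv g hg), inv_inv g⟩
    refine ⟨σ.map (fun g => g⁻¹), fun g => m2 g⁻¹, hp2, ?_, ?_, ?_, ?_, ?_⟩
    · intro g
      show 0 ≤ 1 * m g⁻¹ + (-1) * μ g⁻¹
      linarith [(abs_le.1 (hμm g⁻¹)).2]
    · rw [← Wt_perm hp2, Wt_inv, Wt_perm hσ, Wt_lin, hμW]; linarith
    · rw [← Va_perm hp2, Va_inv, Va_perm hσ, Va_lin, hμa, hVa]; ring
    · rw [← Vb_perm hp2, Vb_inv, Vb_perm hσ, Vb_lin, hμb, hVb]; ring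
    · rw [E_inv]
      show _ ≤ E σ (fun g => 1 * m g + (-1) * μ g)
      linarith

/-- Discretization. -/
lemma disc {L : List Heis} (K : ℝ) (hK : 1 ≤ K)
    (hKa : ∀ g ∈ L, |(g.a : ℝ)| ≤ K) (hKb : ∀ g ∈ L, |(g.b : ℝ)| ≤ K)
    (hs : ∀ g ∈ L, |(sy g : ℝ)| ≤ K) (κ C ρ : ℝ)
    (hper : ∀ va vb τ : ℝ, |va| ≤ τ → |vb| ≤ τ → τ ≤ ρ →
      ∃ (σ' : List Heis) (m' : Heis → ℝ), σ'.Perm L ∧ (∀ g, 0 ≤ m' g) ∧ Wt L m' ≤ 1 ∧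
        Va L m' = va ∧ Vb L m' = vb ∧ κ - C * τ ^ 2 ≤ E σ' m') :
    ∃ C2 : ℝ, 0 ≤ C2 ∧ ∀ (M : ℕ) (va vb τ : ℝ), 1 ≤ M → |va| ≤ τ → |vb| ≤ τ → τ ≤ ρ * M →
      ∃ w : List Heis, (∀ g ∈ w, g ∈ L) ∧ w.length ≤ M ∧ |(w.prod.a : ℝ) - va| ≤ C2 ∧
        |(w.prod.b : ℝ) - vb| ≤ C2 ∧ κ * (M : ℝ) ^ 2 - C * τ ^ 2 - C2 * M ≤ sy w.prod := by
  set N : ℝ := (L.length : ℝ) with hN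
  refine ⟨N * K + 4 * K ^ 2 * N ^ 2 + K, by positivity, ?_⟩
  intro M va vb τ hM hva hvb hτ
  have hM1 : (1 : ℝ) ≤ M := by exact_mod_cast hM
  have hM0 : (0 : ℝ) < M := by linarith
  obtain ⟨σ, m, hσ, hm, hW, ha, hb, hE⟩ := hper (va / M) (vb / M) (τ / M)
    (by rw [abs_div, abs_of_pos hM0]; exact div_le_div_of_nonneg_right hva hM0.le)
    (by rw [abs_div, abs_of_pos hM0]; exact div_le_div_of_nonneg_right hvb hM0.le)
    (by rw [div_le_iff₀ hM0]; exact hτ)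
  let n : Heis → ℕ := fun g => ⌊(M : ℝ) * m g⌋₊
  have hmem : ∀ g ∈ σ, g ∈ L := fun g hg => hσ.mem_iff.1 hg
  have hnle : ∀ g, (n g : ℝ) ≤ M * m g := fun g =>
    Nat.floor_le (mul_nonneg hM0.le (hm g))
  have hnlt : ∀ g, (M : ℝ) * m g < n g + 1 := fun g => Nat.lt_floor_add_one _
  have hnd : ∀ g, |(n g : ℝ) - M * m g| ≤ 1 := fun g => by
    rw [abs_le]; constructor <;> linarith [hnle g, hnlt g]
  have hm1 : ∀ g ∈ σ, (M : ℝ) * m g ≤ M := fun g hg =>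
    mul_le_of_le_one_right hM0.le ((le_Wt L m hm g (hmem g hg)).trans hW)
  have hlen : ((blk σ n).length : ℝ) ≤ M := by
    rw [blk_length]
    have h1 := Wt_mono σ (fun g => (n g : ℝ)) (fun g => (M : ℝ) * m g) hnle
    have h2 := Wt_lin σ m m M 0
    simp only [zero_mul, add_zero] at h2
    rw [h2, Wt_perm hσ m] at h1
    nlinarith
  have hVa := Va_diff σ K 1 (fun g => (n g : ℝ)) (fun g => (M : ℝ) * m g) (by linarith)
    (fun g hg => hKa g (hmem g hg)) (fun g _ => hnd g)
  have hVb := Vb_diff σ K 1 (fun g => (n g : ℝ)) (fun g => (M : ℝ) * m g) (by linarith)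
    (fun g hg => hKb g (hmem g hg)) (fun g _ => hnd g)
  have hEd := E_diff σ K M 1 (fun g => (n g : ℝ)) (fun g => (M : ℝ) * m g) (by linarith) hM0.le
    (by norm_num) (fun g hg => hKa g (hmem g hg)) (fun g hg => hKb g (hmem g hg))
    (fun g hg => by
      rw [abs_of_nonneg (Nat.cast_nonneg _)]; exact (hnle g).trans (hm1 g hg))
    (fun g hg => by
      rw [abs_of_nonneg (mul_nonneg hM0.le (hm g))]; exact hm1 g hg)
    (fun g _ => hnd g)
  have la := Va_lin σ m m M 0
  have lb := Vb_lin σ m m M 0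
  simp only [zero_mul, add_zero] at la lb
  rw [la, Va_perm hσ m, ha, mul_div_cancel₀ _ hM0.ne', hσ.length_eq, ← hN] at hVa
  rw [lb, Vb_perm hσ m, hb, mul_div_cancel₀ _ hM0.ne', hσ.length_eq, ← hN] at hVb
  rw [E_smul, hσ.length_eq, ← hN] at hEd
  have hsy := blk_sy σ n K (fun g hg => hs g (hmem g hg))
  have hN0 : 0 ≤ N := by positivity
  have hKN : 0 ≤ 4 * K ^ 2 * N ^ 2 := by positivity
  have hNK : 0 ≤ N * K := by positivity
  refine ⟨blk σ n, fun g hg => hmem g (blk_mem σ n g hg), by exact_mod_cast hlen, ?_, ?_, ?_⟩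
  · rw [blk_a]; linarith
  · rw [blk_b]; linarith
  · have h1 := (abs_le.1 hEd).1
    have h2 : (M : ℝ) ^ 2 * (κ - C * (τ / M) ^ 2) ≤ (M : ℝ) ^ 2 * E σ m :=
      mul_le_mul_of_nonneg_left hE (by positivity)
    have h3 : (M : ℝ) ^ 2 * (κ - C * (τ / M) ^ 2) = κ * (M : ℝ) ^ 2 - C * τ ^ 2 := by
      field_simp
    have h4 : K * ((blk σ n).length : ℝ) ≤ K * M :=
      mul_le_mul_of_nonneg_left hlen (by linarith)
    have h5 : 0 ≤ N * K * M := by positivity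
    nlinarith

/-- Sharp upper bound for the word length. -/
lemma len_upper (A : Finset Heis) (hA : IsGenSet A) {L : List Heis}
    (hLA : ∀ g, g ∈ L ↔ (g ∈ A ∨ g⁻¹ ∈ A)) (K : ℝ) (hK : 1 ≤ K)
    (hKa : ∀ g ∈ L, |(g.a : ℝ)| ≤ K) (hKb : ∀ g ∈ L, |(g.b : ℝ)| ≤ K)
    (hs : ∀ g ∈ L, |(sy g : ℝ)| ≤ K) (κ C ρ C2 : ℝ) (hρ : 0 < ρ) (hC2 : 0 ≤ C2)
    (hdisc : ∀ (M : ℕ) (va vb τ : ℝ), 1 ≤ M → |va| ≤ τ → |vb| ≤ τ → τ ≤ ρ * M →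
      ∃ w : List Heis, (∀ g ∈ w, g ∈ L) ∧ w.length ≤ M ∧ |(w.prod.a : ℝ) - va| ≤ C2 ∧
        |(w.prod.b : ℝ) - vb| ≤ C2 ∧ κ * (M : ℝ) ^ 2 - C * τ ^ 2 - C2 * M ≤ sy w.prod) :
    ∃ C3 C6 : ℝ, 0 ≤ C3 ∧ 0 ≤ C6 ∧ ∀ (g : Heis) (M : ℕ) (τ : ℝ), 1 ≤ M → |(g.a : ℝ)| ≤ τ →
      |(g.b : ℝ)| ≤ τ → τ ≤ ρ * M → |(sy g : ℝ)| ≤ κ * (M : ℝ) ^ 2 - C * τ ^ 2 - C3 * M →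
      (wlen A g : ℝ) ≤ M + C6 * (Real.sqrt M + 1) := by
  set C0 : ℤ := ⌈4 * K ^ 2⌉ with hC0
  have hC0r : 4 * K ^ 2 ≤ (C0 : ℝ) := Int.le_ceil _
  have hC0n : (0 : ℝ) ≤ C0 := by nlinarith
  have hC0z : 0 ≤ C0 := by exact_mod_cast hC0n
  have hom : ∀ g ∈ L, ∀ k ∈ L, |2 * om g k| ≤ C0 := by
    intro g hg k hk
    have h := om_bound _ _ _ _ _ _ (hKa g hg) (hKb g hg) (hKa k hk) (hKb k hk)
    have h2 : |(2 * om g k : ℝ)| ≤ C0 := by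
      rw [abs_mul, abs_two, om]; push_cast; nlinarith
    exact_mod_cast h2
  set X : ℝ := 6 * ((wlen A Heis.x : ℝ) + wlen A Heis.y) with hX
  have hX0 : 0 ≤ X := by positivity
  set C7 : ℝ := C0 + 2 * C2 * ρ + C2 ^ 2 with hC7
  have hC70 : 0 ≤ C7 := by positivity
  refine ⟨C2 + 2 * K, X * (2 * C2 + Real.sqrt C7 + 1), by positivity, by positivity, ?_⟩
  intro g M τ hM hga hgb hτ hsg
  have hM1 : (1 : ℝ) ≤ M := by exact_mod_cast hM
  have hτ0 : 0 ≤ τ := (abs_nonneg _).trans hga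
  obtain ⟨w, hwL, hwlen, hwa, hwb, hws⟩ := hdisc M g.a g.b τ hM hga hgb hτ
  have hwlen' : (w.length : ℝ) ≤ M := by exact_mod_cast hwlen
  have hrev := sy_reverse K w (fun g hg => hs g (hwL g hg))
  obtain ⟨hs1, hs2⟩ := abs_le.1 hsg
  have hKw : K * (w.length : ℝ) ≤ K * M := mul_le_mul_of_nonneg_left hwlen' (by linarith)
  have hKM : 0 ≤ K * M := by positivity
  have ht : sy g ∈ Set.uIcc (sy w.prod) (sy w.reverse.prod) := by
    rw [Set.mem_uIcc]; right
    constructor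
    · have : (sy w.reverse.prod : ℝ) ≤ sy g := by linarith
      exact_mod_cast this
    · have : (sy g : ℝ) ≤ sy w.prod := by linarith
      exact_mod_cast this
  obtain ⟨u, hu, hut⟩ := interp L C0 hC0z hom (List.reverse_perm w).symm hwL _ ht
  have hua := prod_a_perm hu
  have hub := prod_b_perm hu
  rw [← hua] at hwa
  rw [← hub] at hwb
  have hwu : wlen A u.prod ≤ M := by
    have := wlen_le A u (fun a ha => (hLA a).1 (hwL a (hu.mem_iff.1 ha)))
    rw [hu.length_eq] at this; omega
  set e : Heis := u.prod⁻¹ * g with he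
  have hge : g = u.prod * e := by rw [he]; group
  have hut' : |(sy u.prod : ℝ) - sy g| ≤ C0 := by exact_mod_cast hut
  have hea : |(e.a : ℝ)| ≤ C2 := by
    rw [he, Heis.mul_a, Heis.inv_a]; push_cast
    rw [← abs_neg]; convert hwa using 2; ring
  have heb : |(e.b : ℝ)| ≤ C2 := by
    rw [he, Heis.mul_b, Heis.inv_b]; push_cast
    rw [← abs_neg]; convert hwb using 2; ring
  have hec : |((e.c - e.a * e.b : ℤ) : ℝ)| ≤ C7 * M := by
    have h1 : 2 * ((e.c - e.a * e.b : ℤ) : ℝ) = -((sy u.prod : ℝ) - sy g) +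
        -(((u.prod.a : ℝ) - g.a) * g.b - ((u.prod.b : ℝ) - g.b) * g.a) - e.a * e.b := by
      rw [he]; simp only [sy, Heis.mul_a, Heis.mul_b, Heis.mul_c, Heis.inv_a, Heis.inv_b,
        Heis.inv_c]; push_cast; ring
    have h2 := om_bound _ _ _ _ _ _ hwa hwb hga hgb
    have h3 : |(e.a : ℝ) * e.b| ≤ C2 * C2 := by
      rw [abs_mul]; exact mul_le_mul hea heb (abs_nonneg _) hC2
    have h4 : C2 * τ ≤ C2 * (ρ * M) := mul_le_mul_of_nonneg_left hτ hC2
    have h5 : C0 + 2 * (C2 * (ρ * M)) + C2 * C2 ≤ C7 * M := by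
      rw [hC7]; nlinarith [sq_nonneg C2]
    have h6 : 0 ≤ C7 * M := by positivity
    rw [abs_le] at hut' h2 h3 ⊢
    constructor <;> linarith [hut'.1, hut'.2, h2.1, h2.2, h3.1, h3.2]
  have hwe := wlen_general A hA e
  have hwe' : (wlen A e : ℝ) ≤ X * (C2 + C2 + Real.sqrt (C7 * M) + 1) := by
    have h1 : (wlen A e : ℝ) ≤ X * ((e.a.natAbs : ℝ) + e.b.natAbs +
        (Nat.sqrt (e.c - e.a * e.b).natAbs : ℝ) + 1) := by
      rw [hX]; exact_mod_cast hwe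
    refine h1.trans (mul_le_mul_of_nonneg_left ?_ hX0)
    have h2 : (e.a.natAbs : ℝ) ≤ C2 := by rw [Nat.cast_natAbs]; exact_mod_cast hea
    have h3 : (e.b.natAbs : ℝ) ≤ C2 := by rw [Nat.cast_natAbs]; exact_mod_cast heb
    have h4 : (Nat.sqrt (e.c - e.a * e.b).natAbs : ℝ) ≤ Real.sqrt (C7 * M) := by
      refine Real.nat_sqrt_le_real_sqrt.trans (Real.sqrt_le_sqrt ?_)
      rw [Nat.cast_natAbs, Int.cast_abs]; exact hec
    linarith
  have hfin : (wlen A g : ℝ) ≤ wlen A u.prod + wlen A e := by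
    have := wlen_mul_le A hA u.prod e
    rw [← hge] at this
    exact_mod_cast this
  have hwu' : (wlen A u.prod : ℝ) ≤ M := by exact_mod_cast hwu
  have hsq : Real.sqrt (C7 * M) = Real.sqrt C7 * Real.sqrt M := Real.sqrt_mul hC70 _
  have : X * (C2 + C2 + Real.sqrt (C7 * M) + 1)
      ≤ X * (2 * C2 + Real.sqrt C7 + 1) * (Real.sqrt M + 1) := by
    rw [mul_assoc X, hsq]
    refine mul_le_mul_of_nonneg_left ?_ hX0
    nlinarith [mul_nonneg hC2 (Real.sqrt_nonneg M), Real.sqrt_nonneg C7, Real.sqrt_nonneg M]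
  linarith

end DeadEnd

set_option maxHeartbeats 2000000 in
theorem DeadEnd.main_aux (A : Finset Heis) (hA : IsGenSet A) (n : ℕ) :
    ∃ h : Heis, ∀ h' : Heis, wlen A h < wlen A h' → n < wlen A (h⁻¹ * h') := by
  classical
  by_contra hcon
  push Not at hcon
  -- the symmetrized alphabet
  let L : List Heis := (A ∪ A.image (fun g => g⁻¹)).toList
  have hL : L.Nodup := Finset.nodup_toList _
  have hLA : ∀ g, g ∈ L ↔ (g ∈ A ∨ g⁻¹ ∈ A) := by
    intro g
    simp only [L, Finset.mem_toList, Finset.mem_union, Finset.mem_image]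
    constructor
    · rintro (h | ⟨k, hk, rfl⟩)
      · exact Or.inl h
      · right; rwa [inv_inv]
    · rintro (h | h)
      · exact Or.inl h
      · exact Or.inr ⟨g⁻¹, h, inv_inv g⟩
  have hinv : ∀ g ∈ L, g⁻¹ ∈ L := by
    intro g hg
    rw [hLA] at hg ⊢
    rw [inv_inv]; exact hg.symm
  -- a bound for all coordinates of the letters
  obtain ⟨K, hK, hKa, hKb, hs⟩ : ∃ K : ℝ, 1 ≤ K ∧ (∀ g ∈ L, |(g.a : ℝ)| ≤ K) ∧
      (∀ g ∈ L, |(g.b : ℝ)| ≤ K) ∧ (∀ g ∈ L, |(DeadEnd.sy g : ℝ)| ≤ K) := by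
    obtain ⟨K0, hK0⟩ := ((List.finite_toSet L).image
      (fun g : Heis => |(g.a : ℝ)| + |(g.b : ℝ)| + |(DeadEnd.sy g : ℝ)|)).bddAbove
    have hK1 : ∀ g ∈ L, |(g.a : ℝ)| + |(g.b : ℝ)| + |(DeadEnd.sy g : ℝ)| ≤ K0 :=
      fun g hg => hK0 ⟨g, hg, rfl⟩
    refine ⟨max 1 K0, le_max_left _ _, ?_, ?_, ?_⟩ <;> intro g hg <;>
      refine le_trans ?_ ((hK1 g hg).trans (le_max_right _ _)) <;>
      linarith [abs_nonneg (g.a : ℝ), abs_nonneg (g.b : ℝ), abs_nonneg (DeadEnd.sy g : ℝ)]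
  obtain ⟨σ, m, hσ, hm, hW, hVa, hVb, hmax⟩ := DeadEnd.exists_max L
  have hup := fun w hw ha hb => DeadEnd.area_upper hL K (DeadEnd.E σ m) hs hmax w hw ha hb
  have hwords : ∀ g : Heis, ∃ w : List Heis, (∀ k ∈ w, k ∈ L) ∧ w.length = wlen A g ∧
      w.prod = g := by
    intro g
    obtain ⟨w, h1, h2, h3⟩ := DeadEnd.exists_word A hA g
    exact ⟨w, fun k hk => (hLA k).2 (h1 k hk), h2, h3⟩
  -- positivity of the isoperimetric constant
  have hκ : 0 < DeadEnd.E σ m := by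
    by_contra hneg
    push Not at hneg
    set c : ℝ := 6 * ((wlen A Heis.x : ℝ) + wlen A Heis.y) with hc
    have hc0 : 0 ≤ c := by positivity
    obtain ⟨r, hr⟩ := exists_nat_gt (K * c + 1)
    obtain ⟨w, hwL, hwl, hwp⟩ := hwords ⟨0, 0, ((r * r : ℕ) : ℤ)⟩
    have h1 := hup w hwL (by rw [hwp]) (by rw [hwp])
    have h2 := DeadEnd.cent_wlen_nat A hA (r * r)
    rw [Nat.sqrt_eq] at h2
    have h3 : (wlen A ⟨0, 0, ((r * r : ℕ) : ℤ)⟩ : ℝ) ≤ c * (r + 1) := by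
      rw [hc]; exact_mod_cast h2
    rw [hwp, hwl] at h1
    simp only [DeadEnd.sy] at h1
    push_cast at h1 h3
    set W : ℝ := (wlen A ⟨0, 0, (r : ℤ) * r⟩ : ℝ) with hWd
    have h4 : DeadEnd.E σ m * W ^ 2 ≤ 0 := mul_nonpos_of_nonpos_of_nonneg hneg (sq_nonneg W)
    have h5 : K * W ≤ K * (c * (r + 1)) := mul_le_mul_of_nonneg_left h3 (by linarith)
    have h6 : 0 ≤ K * c := by positivity
    nlinarith
  obtain ⟨C, ρ, hC, hρ, hper⟩ := DeadEnd.perturb hL hinv K hK hKa hKb σ m hσ hm hW hVa hVb hκ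
  obtain ⟨C2, hC2, hdisc⟩ := DeadEnd.disc K hK hKa hKb hs _ C ρ hper
  obtain ⟨C3, C6, hC3, hC6, hlen⟩ :=
    DeadEnd.len_upper A hA hLA K hK hKa hKb hs _ C ρ C2 hρ hC2 hdisc
  set κ : ℝ := DeadEnd.E σ m with hκdef
  -- choice of the parameters
  obtain ⟨q, hq⟩ := exists_nat_gt (max 1 (max (K * n / ρ)
    ((12 * K ^ 2 * n ^ 2 + 4 * C * K ^ 2 * n ^ 2) / (2 * κ))))
  rw [max_lt_iff, max_lt_iff, div_lt_iff₀ hρ, div_lt_iff₀ (by positivity)] at hq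
  obtain ⟨hq1, hq2, hq3⟩ := hq
  obtain ⟨V, hV⟩ := exists_nat_gt (max 1 (max (C6 * (2 * q + 2))
    ((2 * K * q + 2 + C3 * (2 * q + 1)) / (2 * κ * q))))
  rw [max_lt_iff, max_lt_iff, div_lt_iff₀ (by positivity)] at hV
  obtain ⟨hV1, hV2, hV3⟩ := hV
  have hVV : (V : ℝ) ≤ (V : ℝ) ^ 2 := by nlinarith
  let U : ℕ := V ^ 2
  have hU : (U : ℝ) = (V : ℝ) ^ 2 := by simp [U]
  let R : ℕ := 2 * q * U
  have hR : (R : ℝ) = 2 * q * (V : ℝ) ^ 2 := by simp [R, hU]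
  let M : ℕ := R + U
  have hMr : (M : ℝ) = (2 * q + 1) * (V : ℝ) ^ 2 := by
    simp only [M]; push_cast; rw [hR, hU]; ring
  let k : ℤ := ⌊(κ * (R : ℝ) ^ 2 + K * R) / 2⌋ + 1
  have hk1 : κ * (R : ℝ) ^ 2 + K * R < 2 * k := by
    have := Int.lt_floor_add_one ((κ * (R : ℝ) ^ 2 + K * R) / 2)
    simp only [k]; push_cast; linarith
  have hk2 : 2 * (k : ℝ) ≤ κ * (R : ℝ) ^ 2 + K * R + 2 := by
    have := Int.floor_le ((κ * (R : ℝ) ^ 2 + K * R) / 2)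
    simp only [k]; push_cast; linarith
  have hR0 : (0 : ℝ) ≤ R := by positivity
  have hk0 : 0 ≤ 2 * (k : ℝ) := by
    have : 0 ≤ κ * (R : ℝ) ^ 2 + K * R := by positivity
    linarith
  let h : Heis := ⟨0, 0, k⟩
  -- `h` is long
  have hlong : R < wlen A h := by
    by_contra hle
    push Not at hle
    obtain ⟨w, hwL, hwl, hwp⟩ := hwords h
    have h1 := hup w hwL (by rw [hwp]) (by rw [hwp])
    rw [hwp, hwl] at h1
    have h2 : (wlen A h : ℝ) ≤ R := by exact_mod_cast hle
    have h3 : (DeadEnd.sy h : ℝ) = 2 * k := by simp [DeadEnd.sy, h]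
    have h4 : K * (wlen A h : ℝ) ≤ K * R := mul_le_mul_of_nonneg_left h2 (by linarith)
    have h5 : (wlen A h : ℝ) ^ 2 ≤ (R : ℝ) ^ 2 := pow_le_pow_left₀ (by positivity) h2 2
    have h6 : κ * (wlen A h : ℝ) ^ 2 ≤ κ * (R : ℝ) ^ 2 := mul_le_mul_of_nonneg_left h5 hκ.le
    linarith
  obtain ⟨b, hb1, hb2⟩ := DeadEnd.chain A hA n hcon h (2 * U)
  obtain ⟨w, hwL, hwl, hwp⟩ := hwords b
  obtain ⟨p1, p2, p3⟩ := DeadEnd.prod_bound K hK w (fun g hg => hKa g (hwL g hg))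
    (fun g hg => hKb g (hwL g hg)) (fun g hg => hs g (hwL g hg))
  rw [hwp, hwl] at p1 p2 p3
  have hbr : (wlen A b : ℝ) ≤ n * (2 * (V : ℝ) ^ 2) := by
    rw [← hU]; exact_mod_cast hb1
  set Q : ℝ := (V : ℝ) ^ 2 with hQ
  have hQ0 : 0 ≤ Q := by positivity
  have hKb' : K * (wlen A b : ℝ) ≤ K * (n * (2 * Q)) :=
    mul_le_mul_of_nonneg_left hbr (by linarith)
  have hsb : |(DeadEnd.sy b : ℝ)| ≤ 12 * K ^ 2 * n ^ 2 * Q ^ 2 := by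
    refine p3.trans ?_
    have : (wlen A b : ℝ) ^ 2 ≤ (n * (2 * Q)) ^ 2 := pow_le_pow_left₀ (by positivity) hbr 2
    calc 3 * K ^ 2 * (wlen A b : ℝ) ^ 2 ≤ 3 * K ^ 2 * (n * (2 * Q)) ^ 2 :=
          mul_le_mul_of_nonneg_left this (by positivity)
      _ = _ := by ring
  have hM1 : 1 ≤ M := by
    have : (1 : ℝ) ≤ M := by rw [hMr]; nlinarith
    exact_mod_cast this
  have hgoal := hlen (h * b) M (K * (n * (2 * Q))) hM1
    (by
      have : (h * b).a = b.a := by simp [h]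
      rw [this]; linarith)
    (by
      have : (h * b).b = b.b := by simp [h]
      rw [this]; linarith)
    (by
      rw [hMr]
      have h1 : K * n * (2 * Q) ≤ q * ρ * (2 * Q) :=
        mul_le_mul_of_nonneg_right hq2.le (by positivity)
      have h2 : 0 ≤ ρ * Q := by positivity
      linarith)
    (by
      have e1 : (DeadEnd.sy (h * b) : ℝ) = 2 * k + DeadEnd.sy b := by
        simp [DeadEnd.sy, h]; ring
      rw [e1]
      have h1 := abs_add_le (2 * (k : ℝ)) (DeadEnd.sy b)
      rw [abs_of_nonneg hk0] at h1
      refine h1.trans ?_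
      rw [hMr]
      rw [hR] at hk2
      have g1 : (12 * K ^ 2 * n ^ 2 + 4 * C * K ^ 2 * n ^ 2) * Q ^ 2 ≤ q * (2 * κ) * Q ^ 2 :=
        mul_le_mul_of_nonneg_right hq3.le (by positivity)
      have g2 : (2 * K * q + 2 + C3 * (2 * q + 1)) * Q ≤ Q * (2 * κ * q) * Q := by
        refine mul_le_mul_of_nonneg_right (hV3.le.trans ?_) hQ0
        exact mul_le_mul_of_nonneg_right hVV (by positivity)
      have g3 : 0 ≤ κ * Q ^ 2 := by positivity
      have g4 : (1 : ℝ) ≤ Q := by linarith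
      nlinarith)
  have hsq : Real.sqrt M ≤ (2 * q + 1) * V := by
    rw [hMr]
    refine Real.sqrt_le_iff.2 ⟨by positivity, ?_⟩
    have : (0 : ℝ) ≤ q * Q := by positivity
    have h2 : (0 : ℝ) ≤ q ^ 2 * Q := by positivity
    rw [mul_pow, ← hQ]; nlinarith
  have hlast : C6 * (Real.sqrt M + 1) ≤ Q := by
    have h1 : Real.sqrt M + 1 ≤ (2 * q + 2) * V := by linarith
    have h2 := mul_le_mul_of_nonneg_left h1 hC6
    have h3 : C6 * (2 * q + 2) * V ≤ V * V := mul_le_mul_of_nonneg_right hV2.le (by positivity)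
    rw [hQ, sq]; linarith
  have hb2r : (wlen A h : ℝ) + 2 * Q ≤ wlen A (h * b) := by
    rw [← hU]; exact_mod_cast hb2
  have hlr : (R : ℝ) < wlen A h := by exact_mod_cast hlong
  rw [hMr] at hgoal
  rw [hR] at hlr
  rw [hMr] at hlast
  linarith

/-- For every finite generating set `A` of the discrete Heisenberg group `H`,
dead-end depth is unbounded: for every `n ∈ ℕ` there is `h ∈ H` such that every `h' ∈ H` with
`|h'|_A > |h|_A` satisfies `d_A(h,h') > n`. -/
theorem heisenberg_unbounded_dead_end_depth
    (A : Finset Heis) (hA : IsGenSet A) (n : ℕ) :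
    ∃ h : Heis, ∀ h' : Heis, wlen A h < wlen A h' → n < wlen A (h⁻¹ * h') := by
  exact DeadEnd.main_aux A hA n
end

section
/- Let A be any finite generating set of the discrete Heisenberg group H. Then H has bounded retreat depth with respect to A: there exists r ∈ ℕ such that every h ∈ H lies in an unbounded connected component of the set {g ∈ H : |g|_A ≥ |h|_A − r}, where two elements g, g' are adjacent iff g⁻¹g' ∈ A ∪ A⁻¹. Equivalently, for every h ∈ H there is an infinite sequence h = h₀, h₁, h₂, … in H with h_i⁻¹h_{i+1} ∈ A ∪ A⁻¹ for all i, |h_i|_A ≥ |h|_A − r for all i, and |h_i|_A → ∞. -/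
section helpers
open Heis

def tau (g : Heis) : ℤ := 2 * g.c - g.a * g.b
def dt (g h : Heis) : ℤ := g.a * h.b - g.b * h.a
def zz (j : ℤ) : Heis := ⟨0, 0, j⟩
def xx (j : ℤ) : Heis := ⟨j, 0, 0⟩
def yy (j : ℤ) : Heis := ⟨0, j, 0⟩

lemma tau_mul (g h : Heis) : tau (g * h) = tau g + tau h + dt g h := by
  simp [tau, dt]; ring
lemma tau_one : tau 1 = 0 := by simp [tau]
lemma tau_inv (g : Heis) : tau g⁻¹ = - tau g := by simp [tau]; ring

lemma zz_comm (g : Heis) (j : ℤ) : zz j * g = g * zz j := by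
  ext <;> simp [zz]; ring
lemma zz_add (i j : ℤ) : zz (i + j) = zz i * zz j := by
  ext <;> simp [zz]
lemma eq_mul_zz (g h : Heis) (ha : g.a = h.a) (hb : g.b = h.b) :
    ∃ j : ℤ, h = g * zz j ∧ 2 * j = tau h - tau g := by
  refine ⟨h.c - g.c, ?_, ?_⟩
  · ext <;> simp [zz, ha, hb]
  · simp [tau, ha, hb]; ring
lemma conj_eq (U g : Heis) : U * g * U⁻¹ = g * zz (dt U g) := by
  ext <;> simp [zz, dt]; ring
lemma pow_a (g : Heis) (n : ℕ) : (g ^ n).a = n * g.a := by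
  induction n with
  | zero => simp
  | succ n ih => rw [pow_succ, mul_a, ih]; push_cast; ring
lemma pow_b (g : Heis) (n : ℕ) : (g ^ n).b = n * g.b := by
  induction n with
  | zero => simp
  | succ n ih => rw [pow_succ, mul_b, ih]; push_cast; ring
lemma zz_natpow (n : ℕ) : zz n = zz 1 ^ n := by
  induction n with
  | zero => rfl
  | succ n ih => rw [pow_succ, ← ih]; push_cast; rw [zz_add]
lemma zz_neg (n : ℤ) : zz (-n) = (zz n)⁻¹ := by ext <;> simp [zz]
lemma xx_natpow (n : ℕ) : xx n = xx 1 ^ n := by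
  induction n with
  | zero => rfl
  | succ n ih => rw [pow_succ, ← ih]; ext <;> simp [xx]
lemma xx_neg (n : ℤ) : xx (-n) = (xx n)⁻¹ := by ext <;> simp [xx]
lemma yy_natpow (n : ℕ) : yy n = yy 1 ^ n := by
  induction n with
  | zero => rfl
  | succ n ih => rw [pow_succ, ← ih]; ext <;> simp [yy]
lemma yy_neg (n : ℤ) : yy (-n) = (yy n)⁻¹ := by ext <;> simp [yy]

/-! Word length basics -/

lemma wlen_le {A : Finset Heis} {w : List Heis} (hw : IsWordOn A w) :
    wlen A w.prod ≤ w.length := Nat.sInf_le ⟨w, hw, rfl, rfl⟩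

lemma IsWordOn.append {A : Finset Heis} {v w : List Heis} (hv : IsWordOn A v)
    (hw : IsWordOn A w) : IsWordOn A (v ++ w) := by
  intro a ha
  rcases List.mem_append.1 ha with h | h
  exacts [hv a h, hw a h]

lemma IsWordOn.perm {A : Finset Heis} {v w : List Heis} (hv : IsWordOn A v)
    (h : v.Perm w) : IsWordOn A w := fun a ha => hv a (h.mem_iff.2 ha)

lemma exists_word {A : Finset Heis} (hA : IsGenSet A) (g : Heis) :
    ∃ w, IsWordOn A w ∧ w.prod = g := by
  have hg : g ∈ Subgroup.closure (A : Set Heis) := by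
    rw [show Subgroup.closure (A : Set Heis) = ⊤ from hA]; trivial
  rw [← Subgroup.mem_toSubmonoid, Subgroup.closure_toSubmonoid] at hg
  obtain ⟨l, hl, rfl⟩ := Submonoid.exists_list_of_mem_closure hg
  exact ⟨l, fun a ha => by simpa using hl a ha, rfl⟩

lemma exists_geo {A : Finset Heis} (hA : IsGenSet A) (g : Heis) :
    ∃ w, IsWordOn A w ∧ w.length = wlen A g ∧ w.prod = g := by
  obtain ⟨w, h1, h2⟩ := exists_word hA g
  exact Nat.sInf_mem (s := {n | ∃ w : List Heis, IsWordOn A w ∧ w.length = n ∧ w.prod = g})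
    ⟨w.length, w, h1, rfl, h2⟩

lemma wlen_mul {A : Finset Heis} (hA : IsGenSet A) (g h : Heis) :
    wlen A (g * h) ≤ wlen A g + wlen A h := by
  obtain ⟨v, h1, h2, h3⟩ := exists_geo hA g
  obtain ⟨w, h4, h5, h6⟩ := exists_geo hA h
  have := wlen_le (h1.append h4)
  rw [List.prod_append, h3, h6, List.length_append, h2, h5] at this
  exact this

lemma wlen_one (A : Finset Heis) : wlen A 1 = 0 := by
  have := wlen_le (A := A) (w := []) (by intro a ha; simp at ha)
  simpa using this

lemma wlen_inv_le {A : Finset Heis} (hA : IsGenSet A) (g : Heis) :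
    wlen A g⁻¹ ≤ wlen A g := by
  obtain ⟨v, h1, h2, h3⟩ := exists_geo hA g
  have : IsWordOn A (v.map (·⁻¹)).reverse := by
    intro a ha
    simp only [List.mem_reverse, List.mem_map] at ha
    obtain ⟨b, hb, rfl⟩ := ha
    rcases h1 b hb with h | h
    · right; simpa using h
    · left; exact h
  have := wlen_le this
  rw [← List.prod_inv_reverse, h3] at this
  simpa [h2] using this

lemma wlen_pow {A : Finset Heis} (hA : IsGenSet A) (g : Heis) (n : ℕ) :
    wlen A (g ^ n) ≤ n * wlen A g := by
  induction n with
  | zero => simp [wlen_one]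
  | succ n ih =>
    rw [pow_succ]
    have := wlen_mul hA (g ^ n) g
    nlinarith

lemma wlen_fam {A : Finset Heis} (hA : IsGenSet A) (f : ℤ → Heis)
    (hf : ∀ n : ℕ, f n = f 1 ^ n) (hn : ∀ n, f (-n) = (f n)⁻¹) (j : ℤ) :
    wlen A (f j) ≤ j.natAbs * wlen A (f 1) := by
  rcases Int.natAbs_eq j with h | h
  · have := wlen_pow hA (f 1) j.natAbs
    rw [← hf, ← h] at this; exact this
  · have := wlen_pow hA (f 1) j.natAbs
    rw [← hf] at this
    have h2 := wlen_inv_le hA (f j.natAbs)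
    rw [← hn, ← h] at h2; omega

/-- a uniform constant for the lengths of the standard one-parameter families -/
lemma exists_M {A : Finset Heis} (hA : IsGenSet A) : ∃ M : ℕ, 1 ≤ M ∧
    (∀ j, wlen A (zz j) ≤ j.natAbs * M) ∧ (∀ j, wlen A (xx j) ≤ j.natAbs * M) ∧
    (∀ j, wlen A (yy j) ≤ j.natAbs * M) := by
  refine ⟨wlen A (zz 1) + wlen A (xx 1) + wlen A (yy 1) + 1, by omega, ?_, ?_, ?_⟩
  · intro j
    refine (wlen_fam hA zz zz_natpow zz_neg j).trans (Nat.mul_le_mul_left _ (by omega))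
  · intro j
    refine (wlen_fam hA xx xx_natpow xx_neg j).trans (Nat.mul_le_mul_left _ (by omega))
  · intro j
    refine (wlen_fam hA yy yy_natpow yy_neg j).trans (Nat.mul_le_mul_left _ (by omega))

/-- `z^j` has sublinear length. -/
lemma zz_sublinear {A : Finset Heis} (hA : IsGenSet A) (E : ℕ) (hE : 1 ≤ E) :
    ∃ C : ℕ, ∀ j : ℤ, E * wlen A (zz j) ≤ j.natAbs + C := by
  obtain ⟨M, hM, hz, hx, hy⟩ := exists_M hA
  set n := 4 * M * E with hn
  have hnpos : 0 < n := by positivity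
  have hsq : wlen A (zz ((n : ℤ) * n)) ≤ 4 * n * M := by
    have : zz ((n : ℤ) * n) = xx n * yy n * xx (-n) * yy (-n) := by
      ext <;> simp [xx, yy, zz]
    rw [this]
    have h1 := wlen_mul hA (xx n * yy n * xx (-n)) (yy (-n))
    have h2 := wlen_mul hA (xx n * yy n) (xx (-n))
    have h3 := wlen_mul hA (xx n) (yy n)
    have h4 := hx n
    have h5 := hx (-n)
    have h6 := hy n
    have h7 := hy (-n)
    simp only [Int.natAbs_neg, Int.natAbs_natCast] at h4 h5 h6 h7
    linarith
  have key : ∀ m : ℕ, E * wlen A (zz m) ≤ m + E * (n * n * M) := by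
    intro m
    have hdm := Nat.div_add_mod m (n * n)
    have hlt := Nat.mod_lt m (show 0 < n * n by positivity)
    set q := m / (n * n)
    set r := m % (n * n)
    have e : zz m = zz ((n : ℤ) * n) ^ q * zz r := by
      rw [← hdm]; push_cast; rw [zz_add]; congr 1
      have : ∀ q : ℕ, zz ((n : ℤ) * n * q) = zz ((n : ℤ) * n) ^ q := by
        intro q
        induction q with
        | zero => simp; rfl
        | succ q ih => rw [pow_succ, ← ih, ← zz_add]; congr 1
      exact this q
    have h1 := wlen_mul hA (zz ((n : ℤ) * n) ^ q) (zz r)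
    have h2 := wlen_pow hA (zz ((n : ℤ) * n)) q
    have h3 := hz r
    simp only [Int.natAbs_natCast] at h3
    rw [e]
    have h4 : r * M ≤ n * n * M := Nat.mul_le_mul_right _ hlt.le
    have h5 : q * wlen A (zz ((n : ℤ) * n)) ≤ q * (4 * n * M) := Nat.mul_le_mul_left _ hsq
    have h6 : E * (q * (4 * n * M)) = n * n * q := by rw [hn]; ring
    have h7 : E * wlen A (zz ((n : ℤ) * n) ^ q * zz r) ≤
        E * (q * (4 * n * M) + n * n * M) := Nat.mul_le_mul_left _ (by omega)
    rw [mul_add, h6] at h7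
    omega
  refine ⟨E * (n * n * M), fun j => ?_⟩
  rcases Int.natAbs_eq j with h | h
  · have := key j.natAbs
    rw [← h] at this; exact this
  · have h1 := key j.natAbs
    have h2 := wlen_inv_le hA (zz j.natAbs)
    rw [← zz_neg, ← h] at h2
    exact (Nat.mul_le_mul_left _ h2).trans h1

/-! Letters -/

lemma exists_K (A : Finset Heis) : ∃ K : ℕ, 1 ≤ K ∧ ∀ s : Heis, (s ∈ A ∨ s⁻¹ ∈ A) →
    |s.a| ≤ K ∧ |s.b| ≤ K ∧ |tau s| ≤ K := by
  have : ∃ K : ℕ, ∀ s ∈ A, |s.a| + |s.b| + |tau s| ≤ K := by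
    refine ⟨∑ s ∈ A, (|s.a| + |s.b| + |tau s|).toNat, fun s hs => ?_⟩
    have := Finset.single_le_sum (f := fun s : Heis => (|s.a| + |s.b| + |tau s|).toNat)
      (fun _ _ => Nat.zero_le _) hs
    have h2 := Int.self_le_toNat (|s.a| + |s.b| + |tau s|)
    omega
  obtain ⟨K, hK⟩ := this
  refine ⟨K + 1, by omega, fun s hs => ?_⟩
  rcases hs with hs | hs
  · have := hK s hs
    have := abs_nonneg s.a; have := abs_nonneg s.b; have := abs_nonneg (tau s)
    push_cast
    refine ⟨?_, ?_, ?_⟩ <;> linarith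
  · have := hK _ hs
    simp only [inv_a, inv_b, tau_inv, abs_neg] at this
    have := abs_nonneg s.a; have := abs_nonneg s.b; have := abs_nonneg (tau s)
    push_cast
    refine ⟨?_, ?_, ?_⟩ <;> linarith

lemma prod_ab_perm {v w : List Heis} (h : v.Perm w) :
    v.prod.a = w.prod.a ∧ v.prod.b = w.prod.b := by
  induction h with
  | nil => simp
  | cons x _ ih => simp [ih.1, ih.2]
  | swap x y l => simp; constructor <;> ring
  | trans _ _ h1 h2 => exact ⟨h1.1.trans h2.1, h1.2.trans h2.2⟩

lemma tau_reverse (w : List Heis) :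
    tau w.prod + tau w.reverse.prod = 2 * (w.map tau).sum := by
  induction w with
  | nil => simp [tau_one]
  | cons x l ih =>
    obtain ⟨h1, h2⟩ := prod_ab_perm l.reverse_perm
    simp only [List.prod_cons, List.reverse_cons, List.prod_append, List.map_cons,
      List.sum_cons, List.prod_nil, mul_one]
    rw [tau_mul, tau_mul]
    simp only [dt, h1, h2]
    linarith

lemma sum_tau_le {A : Finset Heis} {K : ℕ}
    (hK : ∀ s : Heis, (s ∈ A ∨ s⁻¹ ∈ A) → |s.a| ≤ K ∧ |s.b| ≤ K ∧ |tau s| ≤ K)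
    (w : List Heis) (hw : IsWordOn A w) : |(w.map tau).sum| ≤ K * w.length := by
  induction w with
  | nil => simp
  | cons x l ih =>
    have h1 := ih (fun a ha => hw a (by simp [ha]))
    have h2 := (hK x (hw x (by simp))).2.2
    simp only [List.map_cons, List.sum_cons, List.length_cons]
    have := abs_add_le (tau x) (l.map tau).sum
    push_cast
    linarith

lemma ab_le {A : Finset Heis} {K : ℕ}
    (hK : ∀ s : Heis, (s ∈ A ∨ s⁻¹ ∈ A) → |s.a| ≤ K ∧ |s.b| ≤ K ∧ |tau s| ≤ K)
    (w : List Heis) (hw : IsWordOn A w) :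
    |w.prod.a| ≤ K * w.length ∧ |w.prod.b| ≤ K * w.length := by
  induction w with
  | nil => simp
  | cons x l ih =>
    have h1 := ih (fun a ha => hw a (by simp [ha]))
    have h2 := hK x (hw x (by simp))
    simp only [List.prod_cons, mul_a, mul_b, List.length_cons]
    have := abs_add_le x.a l.prod.a
    have := abs_add_le x.b l.prod.b
    push_cast
    constructor <;> linarith [h1.1, h1.2, h2.1, h2.2.1]

lemma dt_le {g h : Heis} {B D : ℤ} (h1 : |g.a| ≤ B) (h2 : |g.b| ≤ B) (h3 : |h.a| ≤ D)
    (h4 : |h.b| ≤ D) : |dt g h| ≤ 2 * (B * D) := by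
  have hB : 0 ≤ B := (abs_nonneg _).trans h1
  have e1 : |g.a * h.b| ≤ B * D := by
    rw [abs_mul]; exact mul_le_mul h1 h4 (abs_nonneg _) hB
  have e2 : |g.b * h.a| ≤ B * D := by
    rw [abs_mul]; exact mul_le_mul h2 h3 (abs_nonneg _) hB
  have := abs_sub (g.a * h.b) (g.b * h.a)
  unfold dt
  linarith

lemma tau_crude {A : Finset Heis} {K : ℕ}
    (hK : ∀ s : Heis, (s ∈ A ∨ s⁻¹ ∈ A) → |s.a| ≤ K ∧ |s.b| ≤ K ∧ |tau s| ≤ K)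
    (w : List Heis) (hw : IsWordOn A w) :
    |tau w.prod| ≤ K * w.length + 2 * K * K * w.length * w.length := by
  induction w with
  | nil => simp [tau_one]
  | cons x l ih =>
    have hl : IsWordOn A l := fun a ha => hw a (by simp [ha])
    have h1 := ih hl
    have h2 := hK x (hw x (by simp))
    have h3 := ab_le hK l hl
    have h4 := dt_le h2.1 h2.2.1 h3.1 h3.2
    simp only [List.prod_cons, List.length_cons, tau_mul]
    have h5 := abs_add_three (tau x) (tau l.prod) (dt x l.prod)
    push_cast
    have : (0 : ℤ) ≤ K * K * l.length := by positivity
    have : (0 : ℤ) ≤ (K : ℤ) * K := by positivity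
    nlinarith [h2.2.2]

/-- Discrete intermediate values along permutations of a word. -/
lemma ivt {D : ℤ} (v w : List Heis) (h : v.Perm w)
    (hD : ∀ s ∈ v, ∀ t ∈ v, 2 * |dt s t| ≤ D) (t : ℤ)
    (h1 : min (tau v.prod) (tau w.prod) ≤ t) (h2 : t ≤ max (tau v.prod) (tau w.prod)) :
    ∃ u : List Heis, v.Perm u ∧ |tau u.prod - t| ≤ max D 0 := by
  induction h generalizing t with
  | nil =>
    refine ⟨[], List.Perm.refl _, ?_⟩
    simp at h1 h2
    have : t = tau 1 := by omega
    simp [this]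
  | @cons x l₁ l₂ hp ih =>
    obtain ⟨ha, hb⟩ := prod_ab_perm hp
    have e : ∀ l : List Heis, l₁.Perm l →
        tau (x :: l).prod = tau l.prod + (tau x + dt x l₁.prod) := by
      intro l hl
      obtain ⟨ha, hb⟩ := prod_ab_perm hl
      rw [List.prod_cons, tau_mul]; simp only [dt, ha, hb]; ring
    rw [e _ (List.Perm.refl _), e _ hp] at h1 h2
    obtain ⟨u, hu, hu2⟩ := ih (fun s hs t ht => hD s (by simp [hs]) t (by simp [ht]))
      (t - (tau x + dt x l₁.prod)) (by omega) (by omega)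
    refine ⟨x :: u, hu.cons x, ?_⟩
    rw [e _ hu]
    convert hu2 using 2
    ring
  | swap x y l =>
    refine ⟨y :: x :: l, List.Perm.refl _, ?_⟩
    have h3 := hD y (by simp) x (by simp)
    have e : tau (y :: x :: l).prod - tau (x :: y :: l).prod = 2 * dt y x := by
      simp only [List.prod_cons, tau_mul, dt, mul_a, mul_b]; ring
    have h4 : |2 * dt y x| = 2 * |dt y x| := by rw [abs_mul]; simp
    rw [← e] at h4
    rw [← h4] at h3
    refine le_trans ?_ (h3.trans (le_max_left _ _))
    have h5 := le_abs_self (tau (y :: x :: l).prod - tau (x :: y :: l).prod)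
    have h6 := neg_abs_le (tau (y :: x :: l).prod - tau (x :: y :: l).prod)
    rw [abs_le]
    omega
  | @trans l₁ l₂ l₃ hp hq ih1 ih2 =>
    by_cases hc : min (tau l₁.prod) (tau l₂.prod) ≤ t ∧ t ≤ max (tau l₁.prod) (tau l₂.prod)
    · exact ih1 hD t hc.1 hc.2
    · obtain ⟨u, hu, hu2⟩ := ih2
        (fun s hs t ht => hD s (hp.mem_iff.2 hs) t (hp.mem_iff.2 ht)) t (by omega) (by omega)
      exact ⟨u, hp.trans hu, hu2⟩

/-- Case 1: large central part; length does not drop much along the central direction. -/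
lemma case_one {A : Finset Heis} (hA : IsGenSet A) {K : ℕ}
    (hK : ∀ s : Heis, (s ∈ A ∨ s⁻¹ ∈ A) → |s.a| ≤ K ∧ |s.b| ≤ K ∧ |tau s| ≤ K) :
    ∃ C : ℕ, ∀ (h : Heis) (e : ℤ), (e = 1 ∨ e = -1) → (K : ℤ) * wlen A h ≤ e * tau h →
      ∀ k : ℕ, wlen A h ≤ wlen A (h * zz (e * k)) + C := by
  obtain ⟨M, hM, hz, -, -⟩ := exists_M hA
  refine ⟨(4 * (K * K)) * M, fun h e he hh k => ?_⟩
  by_cases hle : wlen A h ≤ wlen A (h * zz (e * k))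
  · omega
  push Not at hle
  obtain ⟨w, hw, hwl, hwp⟩ := exists_geo hA (h * zz (e * k))
  have hS := sum_tau_le hK w hw
  have hrev := tau_reverse w
  have htg : tau w.prod = tau h + 2 * (e * k) := by
    rw [hwp, tau_mul]; simp [tau, dt, zz]
  have hKL : (K : ℤ) * w.length ≤ K * wlen A h := by
    rw [hwl]; exact mul_le_mul_of_nonneg_left (by exact_mod_cast hle.le) (by positivity)
  have hSle := abs_le.1 (hS.trans hKL)
  obtain ⟨u, hu, hu2⟩ := ivt (D := 2 * (2 * (K * K))) w w.reverse w.reverse_perm.symm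
    (by
      intro s hs t ht
      have h1 := hK s (hw s hs)
      have h2 := hK t (hw t ht)
      have := dt_le h1.1 h1.2.1 h2.1 h2.2.1
      linarith) (tau h)
    (by rcases he with rfl | rfl <;> omega) (by rcases he with rfl | rfl <;> omega)
  obtain ⟨ha, hb⟩ := prod_ab_perm hu
  obtain ⟨j, hj, hj2⟩ := eq_mul_zz u.prod h (by rw [← ha, hwp]; simp [zz])
    (by rw [← hb, hwp]; simp [zz])
  have h1 := wlen_mul hA u.prod (zz j)
  rw [← hj] at h1
  have h2 := wlen_le (hw.perm hu)
  rw [← hu.length_eq, hwl] at h2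
  have h3 := hz j
  have h4 : j.natAbs ≤ 4 * (K * K) := by
    have h5 : max (2 * (2 * ((K : ℤ) * K))) 0 = 4 * (K * K) := by
      rw [max_eq_left (by positivity)]; ring
    rw [h5] at hu2
    zify
    have h6 : |2 * j| = 2 * |j| := by rw [abs_mul]; simp
    have h7 : |2 * j| ≤ 4 * (K * K) := by rw [hj2, abs_sub_comm]; exact hu2
    have := abs_nonneg j
    linarith
  have := Nat.mul_le_mul_right M h4
  omega

/-! Paths in the central direction -/

lemma ball_finite {A : Finset Heis} (hA : IsGenSet A) (n : ℕ) :
    {g : Heis | wlen A g ≤ n}.Finite := by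
  classical
  obtain ⟨K, -, hK⟩ := exists_K A
  have key : {g : Heis | wlen A g ≤ n} ⊆
      (fun t : ℤ × ℤ × ℤ => (⟨t.1, t.2.1, t.2.2⟩ : Heis)) ''
      ((Set.Icc (-(K * n : ℤ)) (K * n)) ×ˢ (Set.Icc (-(K * n : ℤ)) (K * n)) ×ˢ
       (Set.Icc (-((K * n + 2 * K * K * n * n + K * n * (K * n)) : ℤ))
        (K * n + 2 * K * K * n * n + K * n * (K * n)))) := by
    intro g hg
    obtain ⟨w, hw, hwl, rfl⟩ := exists_geo hA g
    have hg : wlen A w.prod ≤ n := hg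
    rw [← hwl] at hg
    have h1 := ab_le hK w hw
    have h2 := tau_crude hK w hw
    have hg' : (w.length : ℤ) ≤ n := by exact_mod_cast hg
    have h3 : (K : ℤ) * w.length ≤ K * n := by gcongr
    have h4 : (2 * K * K * w.length * w.length : ℤ) ≤ 2 * K * K * n * n := by gcongr
    have h5 := h1.1.trans h3
    have h6 := h1.2.trans h3
    have h7 : |w.prod.a * w.prod.b| ≤ K * n * (K * n) := by
      rw [abs_mul]; exact mul_le_mul h5 h6 (abs_nonneg _) (by positivity)
    have h8 : |2 * w.prod.c| ≤ K * n + 2 * K * K * n * n + K * n * (K * n) := by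
      have : 2 * w.prod.c = tau w.prod + w.prod.a * w.prod.b := by simp [tau]
      rw [this]
      have := abs_add_le (tau w.prod) (w.prod.a * w.prod.b)
      linarith
    have h9 := abs_le.1 h8
    refine ⟨(w.prod.a, w.prod.b, w.prod.c), ?_, rfl⟩
    simp only [Set.mem_prod, Set.mem_Icc]
    refine ⟨abs_le.1 h5, abs_le.1 h6, ?_, ?_⟩ <;> omega
  refine Set.Finite.subset (Set.Finite.image _ ?_) key
  exact (Set.finite_Icc _ _).prod ((Set.finite_Icc _ _).prod (Set.finite_Icc _ _))

lemma central_path {A : Finset Heis} (hA : IsGenSet A) : ∃ m : ℕ,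
    ∀ (h : Heis) (e : ℤ) (C : ℕ), (e = 1 ∨ e = -1) →
    (∀ k : ℕ, wlen A h ≤ wlen A (h * zz (e * k)) + C) →
    ∃ seq : ℕ → Heis,
      seq 0 = h ∧
      (∀ i : ℕ, (seq i)⁻¹ * seq (i + 1) ∈ A ∨ ((seq i)⁻¹ * seq (i + 1))⁻¹ ∈ A) ∧
      (∀ i : ℕ, (wlen A h : ℤ) - ((C + m : ℕ) : ℤ) ≤ (wlen A (seq i) : ℤ)) ∧
      Filter.Tendsto (fun i => wlen A (seq i)) Filter.atTop Filter.atTop := by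
  obtain ⟨w1, hw1, hp1⟩ := exists_word hA (zz 1)
  obtain ⟨w2, hw2, hp2⟩ := exists_word hA (zz (-1))
  refine ⟨w1.length + w2.length, fun h e C he hC => ?_⟩
  obtain ⟨w, hw, hp, hl⟩ : ∃ w, IsWordOn A w ∧ w.prod = zz e ∧
      w.length ≤ w1.length + w2.length := by
    rcases he with rfl | rfl
    · exact ⟨w1, hw1, hp1, by omega⟩
    · exact ⟨w2, hw2, hp2, by omega⟩
  have hpos : 0 < w.length := by
    rcases Nat.eq_zero_or_pos w.length with h0 | h0
    · rw [List.length_eq_zero_iff] at h0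
      subst h0
      have := congrArg Heis.c hp
      simp [zz] at this
      omega
    · exact h0
  set m := w.length with hm
  have near : ∀ (g : Heis) (j : ℕ), wlen A g ≤ wlen A (g * (w.take j).prod) + m := by
    intro g j
    have h1 := wlen_mul hA (g * (w.take j).prod) (w.take j).prod⁻¹
    rw [mul_inv_cancel_right] at h1
    have h2 := wlen_inv_le hA (w.take j).prod
    have h3 := wlen_le (A := A) (w := w.take j) (fun a ha => hw a (List.mem_of_mem_take ha))
    have h4 : (w.take j).length ≤ m := by simp [hm]
    omega
  set base : ℕ → Heis := fun k => h * zz (e * k) with hbase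
  refine ⟨fun i => base (i / m) * (w.take (i % m)).prod, ?_, ?_, ?_, ?_⟩
  · simp [hbase]
    ext <;> simp [zz]
  · intro i
    have hlt := Nat.mod_lt i hpos
    have hstep : (base (i / m) * (w.take (i % m)).prod)⁻¹ *
        (base ((i + 1) / m) * (w.take ((i + 1) % m)).prod) = w[i % m]'hlt := by
      have e1 : (w.take (i % m + 1)).prod = (w.take (i % m)).prod * w[i % m]'hlt :=
        List.prod_take_succ w (i % m) hlt
      have e2 : base ((i + 1) / m) * (w.take ((i + 1) % m)).prod =
          base (i / m) * (w.take (i % m + 1)).prod := by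
        rcases Nat.lt_or_ge (i % m + 1) m with h1 | h1
        · have a1 : (i + 1) % m = i % m + 1 := by
            rw [Nat.add_mod]
            rcases Nat.lt_or_ge 1 m with h2 | h2
            · rw [Nat.mod_eq_of_lt h2, Nat.mod_eq_of_lt h1]
            · omega
          have a2 : (i + 1) / m = i / m := by
            have b1 := Nat.div_add_mod i m
            have b2 := Nat.div_add_mod (i + 1) m
            have : m * ((i + 1) / m) = m * (i / m) := by omega
            exact Nat.eq_of_mul_eq_mul_left hpos this
          rw [a1, a2]
        · have h2 : i % m + 1 = m := by omega
          have b1 := Nat.div_add_mod i m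
          have b3 : i + 1 = m * (i / m + 1) := by rw [mul_add]; omega
          have a2 : (i + 1) / m = i / m + 1 := by
            rw [b3]; exact Nat.mul_div_cancel_left _ hpos
          have a1 : (i + 1) % m = 0 := by rw [b3]; exact Nat.mul_mod_right _ _
          rw [a1, a2, h2, hm, List.take_length, hp]
          simp only [hbase, List.take_zero, List.prod_nil, mul_one]
          rw [mul_assoc, ← zz_add]
          congr 2
          push_cast; ring
      rw [e2, e1]
      group
    have := hw (w[i % m]'hlt) (List.getElem_mem _)
    simp only [hstep]
    exact this
  · intro i
    have h1 := hC (i / m)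
    have h2 := near (base (i / m)) (i % m)
    simp only [hbase] at h2 ⊢
    omega
  · have inj : Function.Injective base := by
      intro k l hkl
      have := congrArg Heis.c hkl
      simp [hbase, zz] at this
      rcases this with h1 | h1
      · exact h1
      · rcases he with rfl | rfl <;> omega
    rw [Filter.tendsto_atTop]
    intro b
    have fin : (base ⁻¹' {g | wlen A g ≤ b + m}).Finite :=
      (ball_finite hA (b + m)).preimage inj.injOn
    obtain ⟨B, hB⟩ := fin.bddAbove
    filter_upwards [Filter.eventually_ge_atTop (m * (B + 1))] with i hi
    have h1 : B + 1 ≤ i / m := (Nat.le_div_iff_mul_le hpos).2 (by rw [mul_comm]; exact hi)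
    have h2 := near (base (i / m)) (i % m)
    by_contra hcon
    have : i / m ≤ B := hB (by change wlen A (base (i / m)) ≤ b + m; omega)
    omega

end helpers

section counts
open Heis

/-- The letters `A ∪ A⁻¹`. -/
abbrev Lt (A : Finset Heis) := {s : Heis // s ∈ A ∨ s⁻¹ ∈ A}

lemma lt_finite (A : Finset Heis) : Finite (Lt A) := by
  have h1 : ({s : Heis | s ∈ A} ∪ {s : Heis | s⁻¹ ∈ A}).Finite := by
    refine Set.Finite.union (Finset.finite_toSet A) ?_
    exact (Finset.finite_toSet A).preimage inv_injective.injOn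
  exact h1.to_subtype

noncomputable instance (A : Finset Heis) : Fintype (Lt A) :=
  @Fintype.ofFinite _ (lt_finite A)

noncomputable instance (A : Finset Heis) : DecidableEq (Lt A) := Classical.decEq _

variable {A : Finset Heis}

noncomputable def csz (n : Lt A → ℕ) : ℕ := ∑ i, n i
noncomputable def ca (n : Lt A → ℕ) : ℤ := ∑ i, (n i : ℤ) * i.1.a
noncomputable def cb (n : Lt A → ℕ) : ℤ := ∑ i, (n i : ℤ) * i.1.b

/-- `n` is a shortest way of writing its value in the abelianization. -/
def Geo (n : Lt A → ℕ) : Prop :=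
  ∀ n' : Lt A → ℕ, ca n' = ca n → cb n' = cb n → csz n ≤ csz n'

lemma csz_add (m n : Lt A → ℕ) : csz (m + n) = csz m + csz n := by
  simp [csz, Finset.sum_add_distrib]
lemma ca_add (m n : Lt A → ℕ) : ca (m + n) = ca m + ca n := by
  simp [ca, Finset.sum_add_distrib, add_mul]
lemma cb_add (m n : Lt A → ℕ) : cb (m + n) = cb m + cb n := by
  simp [cb, Finset.sum_add_distrib, add_mul]
lemma csz_single (p : Lt A) (k : ℕ) : csz (Pi.single p k) = k := by
  simp [csz]
lemma ca_single (p : Lt A) (k : ℕ) : ca (Pi.single p k) = k * p.1.a := by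
  unfold ca
  rw [Finset.sum_eq_single p]
  · simp
  · intro b _ hb; simp [hb]
  · simp
lemma cb_single (p : Lt A) (k : ℕ) : cb (Pi.single p k) = k * p.1.b := by
  unfold cb
  rw [Finset.sum_eq_single p]
  · simp
  · intro b _ hb; simp [hb]
  · simp

lemma counts_of_word (w : List Heis) (hw : IsWordOn A w) :
    ∃ n : Lt A → ℕ, csz n = w.length ∧ ca n = w.prod.a ∧ cb n = w.prod.b := by
  induction w with
  | nil => exact ⟨0, by simp [csz], by simp [ca], by simp [cb]⟩
  | cons x l ih =>
    obtain ⟨n, h1, h2, h3⟩ := ih (fun a ha => hw a (by simp [ha]))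
    refine ⟨Pi.single ⟨x, hw x (by simp)⟩ 1 + n, ?_, ?_, ?_⟩
    · rw [csz_add, csz_single, h1, List.length_cons]; omega
    · rw [ca_add, ca_single, h2, List.prod_cons, mul_a]; simp
    · rw [cb_add, cb_single, h3, List.prod_cons, mul_b]; simp

lemma word_replicate (p : Lt A) (k : ℕ) : IsWordOn A (List.replicate k p.1) := by
  intro a ha
  rw [List.eq_of_mem_replicate ha]; exact p.2

lemma word_of_counts (n : Lt A → ℕ) (s : Finset (Lt A)) :
    ∃ w : List Heis, IsWordOn A w ∧ w.length = ∑ i ∈ s, n i ∧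
      w.prod.a = ∑ i ∈ s, (n i : ℤ) * i.1.a ∧ w.prod.b = ∑ i ∈ s, (n i : ℤ) * i.1.b := by
  induction s using Finset.induction_on with
  | empty => exact ⟨[], by intro a ha; simp at ha, by simp, by simp, by simp⟩
  | insert p s hp ih =>
    obtain ⟨w, h1, h2, h3, h4⟩ := ih
    refine ⟨List.replicate (n p) p.1 ++ w, (word_replicate p _).append h1, ?_, ?_, ?_⟩
    · rw [Finset.sum_insert hp, List.length_append, List.length_replicate, h2]
    · rw [Finset.sum_insert hp, List.prod_append, List.prod_replicate, mul_a, pow_a, h3]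
    · rw [Finset.sum_insert hp, List.prod_append, List.prod_replicate, mul_b, pow_b, h4]

lemma exists_geo_counts (hA : IsGenSet A) (h : Heis) :
    ∃ n : Lt A → ℕ, Geo n ∧ ca n = h.a ∧ cb n = h.b := by
  classical
  obtain ⟨w, hw, hp⟩ := exists_word hA h
  obtain ⟨n0, -, h2, h3⟩ := counts_of_word w hw
  have hex : ∃ k : ℕ, ∃ n : Lt A → ℕ, csz n = k ∧ ca n = h.a ∧ cb n = h.b :=
    ⟨_, n0, rfl, by rw [h2, hp], by rw [h3, hp]⟩
  obtain ⟨n, e1, e2, e3⟩ := Nat.find_spec hex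
  refine ⟨n, ?_, e2, e3⟩
  intro n' f1 f2
  rw [e1]
  exact Nat.find_min' hex ⟨n', rfl, f1.trans e2, f2.trans e3⟩

lemma geo_le_wlen (hA : IsGenSet A) (n : Lt A → ℕ) (hn : Geo n) (g : Heis)
    (ha : ca n = g.a) (hb : cb n = g.b) : csz n ≤ wlen A g := by
  obtain ⟨w, hw, hl, hp⟩ := exists_geo hA g
  obtain ⟨m, h1, h2, h3⟩ := counts_of_word w hw
  rw [← hl, ← h1]
  exact hn m (by rw [h2, hp, ha]) (by rw [h3, hp, hb])

lemma not_geo_mono {m n : Lt A → ℕ} (hmn : m ≤ n) (hm : ¬ Geo m) : ¬ Geo n := by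
  obtain ⟨d, rfl⟩ := exists_add_of_le hmn
  unfold Geo at hm
  push Not at hm
  obtain ⟨m', h1, h2, h3⟩ := hm
  intro hg
  have := hg (m' + d) (by rw [ca_add, ca_add, h1]) (by rw [cb_add, cb_add, h2])
  rw [csz_add, csz_add] at this
  omega

lemma dickson (A : Finset Heis) : ∃ M : ℕ, ∀ n : Lt A → ℕ, Geo n → ∀ p, M ≤ n p →
    ∀ k : ℕ, Geo (n + Pi.single p k) := by
  have hfin : {m : Lt A → ℕ | Minimal (fun m => ¬ Geo m) m}.Finite :=
    WellQuasiOrderedLE.finite_of_isAntichain (setOfPred_minimal_antichain _)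
  refine ⟨∑ m ∈ hfin.toFinset, csz m, fun n hn p hp k => ?_⟩
  by_contra hcon
  obtain ⟨m, hm, hmin⟩ := exists_minimal_le_of_wellFoundedLT (fun m : Lt A → ℕ => ¬ Geo m) _ hcon
  refine not_geo_mono (m := m) (n := n) ?_ hmin.1 hn
  intro i
  by_cases hi : i = p
  · subst hi
    change m i ≤ n i
    have h1 : csz m ≤ ∑ m ∈ hfin.toFinset, csz m :=
      Finset.single_le_sum (f := fun m : Lt A → ℕ => csz m) (fun _ _ => Nat.zero_le _)
        (hfin.mem_toFinset.2 hmin)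
    have h2 : m i ≤ csz m :=
      Finset.single_le_sum (f := m) (fun _ _ => Nat.zero_le _) (Finset.mem_univ i)
    omega
  · have := hm i
    simpa [hi] using this

lemma geo_noncentral (n : Lt A → ℕ) (hn : Geo n) (p : Lt A) (hp : 1 ≤ n p) :
    p.1.a ≠ 0 ∨ p.1.b ≠ 0 := by
  by_contra hcon
  push Not at hcon
  have hle : Pi.single p 1 ≤ n := by
    intro i
    by_cases hi : i = p
    · subst hi; simpa using hp
    · simp [hi]
  obtain ⟨d, rfl⟩ := exists_add_of_le hle
  have := hn d (by rw [ca_add, ca_single, hcon.1]; simp) (by rw [cb_add, cb_single, hcon.2]; simp)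
  rw [csz_add, csz_single] at this
  omega

/-- Balanced words. -/
lemma balanced {K : ℕ}
    (hK : ∀ s : Heis, (s ∈ A ∨ s⁻¹ ∈ A) → |s.a| ≤ K ∧ |s.b| ≤ K ∧ |tau s| ≤ K) :
    ∃ B : ℕ, ∀ (n : Lt A → ℕ) (p : Lt A), ∃ R : List Heis, IsWordOn A R ∧
      n p / 2 + R.length = csz n ∧ (p.1 ^ (n p / 2) * R.prod).a = ca n ∧
      (p.1 ^ (n p / 2) * R.prod).b = cb n ∧
      |tau (p.1 ^ (n p / 2) * R.prod)| ≤ B * csz n + B := by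
  set F := Fintype.card (Lt A) with hF
  refine ⟨K + 2 * K * K * F + K * F + 2 * K * K * F * F, fun n p => ?_⟩
  obtain ⟨w, hw, wl, wa, wb⟩ := word_of_counts (fun i => n i / 2) (Finset.univ.erase p)
  obtain ⟨e, he, el, ea, eb⟩ := word_of_counts (fun i => n i % 2) Finset.univ
  set P := List.replicate (n p / 2) p.1 with hP
  have hPw : IsWordOn A P := word_replicate p _
  have hPp : P.prod = p.1 ^ (n p / 2) := by simp [hP]
  set W := P ++ w with hW
  have hWw : IsWordOn A W := hPw.append hw
  have hWr : IsWordOn A W.reverse := hWw.perm W.reverse_perm.symm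
  have hWl : W.length = ∑ i, n i / 2 := by
    rw [hW, List.length_append, wl, hP, List.length_replicate,
      Finset.add_sum_erase Finset.univ (fun i => n i / 2) (Finset.mem_univ p)]
  have hWa : W.prod.a = ∑ i, ((n i / 2 : ℕ) : ℤ) * i.1.a := by
    rw [hW, List.prod_append, mul_a, wa, hPp, pow_a]
    exact Finset.add_sum_erase Finset.univ (fun i : Lt A => ((n i / 2 : ℕ) : ℤ) * i.1.a)
      (Finset.mem_univ p)
  have hWb : W.prod.b = ∑ i, ((n i / 2 : ℕ) : ℤ) * i.1.b := by
    rw [hW, List.prod_append, mul_b, wb, hPp, pow_b]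
    exact Finset.add_sum_erase Finset.univ (fun i : Lt A => ((n i / 2 : ℕ) : ℤ) * i.1.b)
      (Finset.mem_univ p)
  have hra := (prod_ab_perm W.reverse_perm).1
  have hrb := (prod_ab_perm W.reverse_perm).2
  have hprod : p.1 ^ (n p / 2) * (w ++ W.reverse ++ e).prod =
      (W ++ W.reverse).prod * e.prod := by
    rw [← hPp, hW]; simp only [List.prod_append, mul_assoc]
  have hsz : 2 * W.length + e.length = csz n := by
    rw [hWl, el, Finset.mul_sum, ← Finset.sum_add_distrib]
    refine Finset.sum_congr rfl fun i _ => ?_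
    exact Nat.div_add_mod _ _
  have hel : e.length ≤ F := by
    rw [el, hF, Fintype.card_eq_sum_ones]
    refine Finset.sum_le_sum fun i _ => ?_
    have := Nat.mod_lt (n i) (show 0 < 2 by norm_num)
    omega
  refine ⟨w ++ W.reverse ++ e, (hw.append hWr).append he, ?_, ?_, ?_, ?_⟩
  · have : W.length = n p / 2 + w.length := by simp [hW, hP]
    simp only [List.length_append, List.length_reverse]
    omega
  · rw [hprod, mul_a, List.prod_append, mul_a, hra, hWa, ea, ca, ← Finset.sum_add_distrib,
      ← Finset.sum_add_distrib]
    refine Finset.sum_congr rfl fun i _ => ?_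
    have : (n i : ℤ) = 2 * ((n i / 2 : ℕ) : ℤ) + ((n i % 2 : ℕ) : ℤ) := by omega
    rw [this]; ring
  · rw [hprod, mul_b, List.prod_append, mul_b, hrb, hWb, eb, cb, ← Finset.sum_add_distrib,
      ← Finset.sum_add_distrib]
    refine Finset.sum_congr rfl fun i _ => ?_
    have : (n i : ℤ) = 2 * ((n i / 2 : ℕ) : ℤ) + ((n i % 2 : ℕ) : ℤ) := by omega
    rw [this]; ring
  · rw [hprod, tau_mul]
    have t1 : tau (W ++ W.reverse).prod = 2 * (W.map tau).sum := by
      rw [List.prod_append, tau_mul, ← tau_reverse]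
      simp only [dt, hra, hrb]; ring
    have t2 := sum_tau_le hK W hWw
    have t3 := tau_crude hK e he
    have t4 := ab_le hK _ (hWw.append hWr)
    have t5 := ab_le hK e he
    have t6 := dt_le t4.1 t4.2 t5.1 t5.2
    have t7 : (W ++ W.reverse).length = 2 * W.length := by simp; omega
    rw [t7] at t6
    have t8 := abs_add_three (tau (W ++ W.reverse).prod) (tau e.prod)
      (dt (W ++ W.reverse).prod e.prod)
    have t9 : |tau (W ++ W.reverse).prod| ≤ K * (2 * W.length) := by
      rw [t1, abs_mul]; simp only [abs_two]; linarith
    have hel' : (e.length : ℤ) ≤ F := by exact_mod_cast hel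
    have hWc : (2 * W.length : ℤ) ≤ csz n := by zify at hsz; omega
    have u1 : (K : ℤ) * (2 * W.length) ≤ K * csz n := by gcongr
    have u2 : (K : ℤ) * e.length + 2 * K * K * e.length * e.length
        ≤ K * F + 2 * K * K * F * F := by gcongr
    have u3 : 2 * ((K : ℤ) * ((2 * W.length : ℕ) : ℤ) * (K * e.length))
        ≤ 2 * (K * csz n * (K * F)) := by push_cast; gcongr
    have u4 : (0 : ℤ) ≤ (K * F + 2 * K * K * F * F) * csz n := by positivity
    have u5 : (0 : ℤ) ≤ K + 2 * K * K * F := by positivity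
    push_cast at *
    nlinarith

lemma detour_elem (hA : IsGenSet A) {K M : ℕ}
    (hx : ∀ j, wlen A (xx j) ≤ j.natAbs * M) (hy : ∀ j, wlen A (yy j) ≤ j.natAbs * M)
    (hK : ∀ s : Heis, (s ∈ A ∨ s⁻¹ ∈ A) → |s.a| ≤ K ∧ |s.b| ≤ K ∧ |tau s| ≤ K)
    (p : Lt A) (hp : p.1.a ≠ 0 ∨ p.1.b ≠ 0) (T : ℕ) (j : ℤ) :
    ∃ U : Heis, wlen A U ≤ T * M ∧ 0 ≤ dt U p.1 * j ∧ T ≤ |dt U p.1| ∧ |dt U p.1| ≤ T * K := by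
  have hkp := hK p.1 p.2
  have main : ∀ (f : ℤ → Heis) (q : ℤ), q ≠ 0 → |q| ≤ K → (∀ t, dt (f t) p.1 = t * q) →
      (∀ t, wlen A (f t) ≤ t.natAbs * M) →
      ∃ U : Heis, wlen A U ≤ T * M ∧ 0 ≤ dt U p.1 * j ∧ T ≤ |dt U p.1| ∧
        |dt U p.1| ≤ T * K := by
    intro f q hq hqK hf hl
    have habs : ∀ t : ℤ, |t| = T → (T : ℤ) ≤ |t * q| ∧ |t * q| ≤ T * K := by
      intro t ht
      have := Int.one_le_abs hq
      rw [abs_mul, ht]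
      constructor
      · nlinarith
      · gcongr
    rcases le_total 0 (q * j) with h | h
    · refine ⟨f T, by simpa using hl T, ?_, ?_⟩
      · rw [hf, mul_assoc]; positivity
      · rw [hf]; exact habs _ (by simp)
    · refine ⟨f (-T), by simpa using hl (-T), ?_, ?_⟩
      · rw [hf, mul_assoc]; nlinarith
      · rw [hf]; exact habs _ (by simp)
  by_cases hb : p.1.b = 0
  · refine main yy (-p.1.a) (by rcases hp with h | h; · simpa using h
                                · exact absurd hb h) (by simpa using hkp.1) ?_ hy
    intro t; simp [dt, yy]
  · refine main xx p.1.b hb hkp.2.1 ?_ hx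
    intro t; simp [dt, xx]

lemma detour (hA : IsGenSet A) (T : ℕ) (hT : 1 ≤ T) : ∃ C : ℕ, ∀ (p : Lt A),
    (p.1.a ≠ 0 ∨ p.1.b ≠ 0) → ∀ (m : ℕ) (j : ℤ), |j| ≤ T * m →
    wlen A (p.1 ^ m * zz j) ≤ m + C := by
  obtain ⟨K, hK1, hK⟩ := exists_K A
  obtain ⟨M, hM, hz, hx, hy⟩ := exists_M hA
  refine ⟨2 * (T * M) + T * K * M, fun p hp m j hj => ?_⟩
  obtain ⟨U, hU, hs, hlow, hup⟩ := detour_elem hA hx hy hK p hp T j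
  set D := dt U p.1 with hD
  have hD0 : D ≠ 0 := by
    intro h; rw [h] at hlow; simp at hlow; omega
  have hDpos : 0 < |D| := abs_pos.2 hD0
  have e1 := Int.mul_ediv_add_emod j D
  have e2 := Int.emod_nonneg j hD0
  have e3 := Int.emod_lt_abs j hD0
  set i := j / D
  set r := j % D
  have key : i * |D| ≤ |j| + r := by
    have : i * D ^ 2 ≤ |D| * (|j| + r) := by
      have a1 : D * j = |D| * |j| := by rw [← abs_mul, abs_of_nonneg hs]
      have a2 : i * D ^ 2 = D * j - D * r := by rw [← e1]; ring
      have a3 : -(D * r) ≤ |D| * r := by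
        have := neg_abs_le D
        nlinarith
      rw [a2, a1]; linarith
    rw [← sq_abs] at this
    by_contra hc
    push Not at hc
    nlinarith
  have him : i ≤ m := by
    by_contra hc
    push Not at hc
    have : (m + 1) * |D| ≤ i * |D| := by gcongr; omega
    have : (T : ℤ) * m ≤ |D| * m := by gcongr
    nlinarith
  have hi0 : 0 ≤ i := by
    by_contra hc
    push Not at hc
    have a1 : D * j = i * D ^ 2 + D * r := by rw [← e1]; ring
    have a3 : D * r ≤ |D| * r := by
      have := le_abs_self D
      nlinarith
    have a4 : |D| * r < |D| * |D| := by gcongr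
    have a5 : |D| * |D| = D ^ 2 := by rw [← sq, sq_abs]
    nlinarith
  obtain ⟨i', hi'⟩ := Int.eq_ofNat_of_zero_le hi0
  have him' : i' ≤ m := by omega
  have hdt : dt U (p.1 ^ i') = D * i := by
    rw [hi', hD]; simp only [dt, pow_a, pow_b]; push_cast; ring
  have heq : p.1 ^ m * zz j = U * p.1 ^ i' * U⁻¹ * p.1 ^ (m - i') * zz r := by
    rw [conj_eq, hdt, ← e1, zz_add]
    have : p.1 ^ m = p.1 ^ i' * p.1 ^ (m - i') := by rw [← pow_add]; congr 1; omega
    rw [this]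
    simp only [mul_assoc]
    rw [← mul_assoc (zz (D * i)) (p.1 ^ (m - i')), zz_comm (p.1 ^ (m - i')) (D * i), mul_assoc]
  have hp1 : wlen A p.1 ≤ 1 := by
    have := wlen_le (word_replicate p 1)
    simpa using this
  rw [heq]
  have w1 := wlen_mul hA (U * p.1 ^ i' * U⁻¹ * p.1 ^ (m - i')) (zz r)
  have w2 := wlen_mul hA (U * p.1 ^ i' * U⁻¹) (p.1 ^ (m - i'))
  have w3 := wlen_mul hA (U * p.1 ^ i') U⁻¹
  have w4 := wlen_mul hA U (p.1 ^ i')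
  have w5 := wlen_inv_le hA U
  have w6 := wlen_pow hA p.1 i'
  have w7 := wlen_pow hA p.1 (m - i')
  have w8 := hz r
  have w9 : r.natAbs ≤ T * K := by zify; rw [abs_of_nonneg e2]; linarith
  have w10 := Nat.mul_le_mul_right M w9
  have w11 : i' * wlen A p.1 ≤ i' * 1 := Nat.mul_le_mul_left _ hp1
  have w12 : (m - i') * wlen A p.1 ≤ (m - i') * 1 := Nat.mul_le_mul_left _ hp1
  omega

end counts

/-- For every finite generating set `A` of the discrete Heisenberg group `H`,
retreat depth is bounded: there is `r ∈ ℕ` such that every `h ∈ H` lies in an unbounded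
component of `{g : |g|_A ≥ |h|_A - r}`, witnessed by an infinite path `h = h₀, h₁, h₂, …`
in the Cayley graph with `|h_i|_A ≥ |h|_A - r` for all `i` and `|h_i|_A → ∞`. -/
theorem heisenberg_bounded_retreat_depth
    (A : Finset Heis) (hA : IsGenSet A) :
    ∃ r : ℕ, ∀ h : Heis, ∃ seq : ℕ → Heis,
      seq 0 = h ∧
      (∀ i : ℕ, (seq i)⁻¹ * seq (i + 1) ∈ A ∨ ((seq i)⁻¹ * seq (i + 1))⁻¹ ∈ A) ∧
      (∀ i : ℕ, (wlen A h : ℤ) - (r : ℤ) ≤ (wlen A (seq i) : ℤ)) ∧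
      Filter.Tendsto (fun i => wlen A (seq i)) Filter.atTop Filter.atTop := by

  obtain ⟨K, hK1, hK⟩ := exists_K A
  obtain ⟨Q, hQ⟩ := dickson A
  obtain ⟨B, hB⟩ := balanced hK
  obtain ⟨C1, hC1⟩ := case_one hA hK
  obtain ⟨mz, hmz⟩ := central_path hA
  obtain ⟨C2, hC2⟩ := zz_sublinear hA K hK1
  set F := Fintype.card (Lt A) with hF
  -- upper bound on lengths
  have UB : ∀ (h : Heis) (n : Lt A → ℕ), ca n = h.a → cb n = h.b → 
      2 * (K * (wlen A h : ℤ)) ≤ (2 * K + B) * csz n + |tau h| + (2 * C2 + B) := by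
    intro h n ha hb
    have hne : Nonempty (Lt A) := by
      by_contra hemp
      rw [not_nonempty_iff] at hemp
      obtain ⟨w, hw, hp⟩ := exists_word hA (Heis.x)
      rcases w with _ | ⟨s, l⟩
      · have := congrArg Heis.a hp
        simp [Heis.x] at this
      · exact hemp.false ⟨s, hw s (by simp)⟩
    obtain ⟨p⟩ := hne
    obtain ⟨R, hR, hl, ra, rb, rt⟩ := hB n p
    obtain ⟨j, hj, hj2⟩ := eq_mul_zz _ h (ra.trans ha) (rb.trans hb)
    have w1 := wlen_mul hA (p.1 ^ (n p / 2) * R.prod) (zz j)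
    rw [← hj] at w1
    have w2 := wlen_le ((word_replicate p (n p / 2)).append hR)
    simp only [List.prod_append, List.prod_replicate, List.length_append,
      List.length_replicate] at w2
    rw [hl] at w2
    have w3 := hC2 j
    zify at w1 w2 w3
    have w4 : 2 * |j| ≤ |tau h| + (B * csz n + B) := by
      have : |2 * j| = 2 * |j| := by rw [abs_mul]; simp
      rw [← this, hj2]
      have := abs_sub (tau h) (tau (p.1 ^ (n p / 2) * R.prod))
      linarith
    have w5 : (K : ℤ) * wlen A h ≤ K * (csz n + wlen A (zz j)) := by gcongr; linarith
    linarith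
  set T := 3 * F * (2 * K + 2 * B + B) + 2 * C2 + 2 * B + 1 with hT
  obtain ⟨C3, hC3⟩ := detour hA T (by omega)
  set N0 := F * (Q + 2) with hN0
  set R0 := 2 * ((2 * K + B) * N0 + (2 * C2 + B)) with hR0
  refine ⟨C1 + R0 + mz + C3, fun h => ?_⟩
  have weaken : ∀ r : ℕ, r ≤ C1 + R0 + mz + C3 → (∃ seq : ℕ → Heis,
      seq 0 = h ∧
      (∀ i : ℕ, (seq i)⁻¹ * seq (i + 1) ∈ A ∨ ((seq i)⁻¹ * seq (i + 1))⁻¹ ∈ A) ∧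
      (∀ i : ℕ, (wlen A h : ℤ) - (r : ℤ) ≤ (wlen A (seq i) : ℤ)) ∧
      Filter.Tendsto (fun i => wlen A (seq i)) Filter.atTop Filter.atTop) →
      ∃ seq : ℕ → Heis,
      seq 0 = h ∧
      (∀ i : ℕ, (seq i)⁻¹ * seq (i + 1) ∈ A ∨ ((seq i)⁻¹ * seq (i + 1))⁻¹ ∈ A) ∧
      (∀ i : ℕ, (wlen A h : ℤ) - ((C1 + R0 + mz + C3 : ℕ) : ℤ) ≤ (wlen A (seq i) : ℤ)) ∧
      Filter.Tendsto (fun i => wlen A (seq i)) Filter.atTop Filter.atTop := by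
    rintro r hr ⟨seq, s1, s2, s3, s4⟩
    exact ⟨seq, s1, s2, fun i => by have := s3 i; omega, s4⟩
  by_cases hbig : (K : ℤ) * wlen A h ≤ |tau h|
  · have : ∃ e : ℤ, (e = 1 ∨ e = -1) ∧ e * tau h = |tau h| := by
      rcases abs_choice (tau h) with h1 | h1
      · exact ⟨1, Or.inl rfl, by rw [h1]; ring⟩
      · exact ⟨-1, Or.inr rfl, by rw [h1]; ring⟩
    obtain ⟨e, he, het⟩ := this
    refine weaken (C1 + mz) (by omega) (hmz h e C1 he (hC1 h e he (by rw [het]; exact hbig)))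
  push Not at hbig
  obtain ⟨n, hn, ha, hb⟩ := exists_geo_counts hA h
  have ub := UB h n ha hb
  have ht : |tau h| ≤ (2 * K + B) * csz n + (2 * C2 + B) := by linarith
  by_cases hsmall : csz n ≤ N0
  · have hlen : wlen A h ≤ R0 := by
      have h1 : (wlen A h : ℤ) ≤ K * wlen A h := by
        have : (1 : ℤ) ≤ K := by exact_mod_cast hK1
        nlinarith
      have h2 : ((2 * K + B) * csz n : ℤ) ≤ (2 * K + B) * N0 := by gcongr
      zify
      rw [hR0]; push_cast
      nlinarith
    exact weaken (R0 + mz) (by omega) (hmz h 1 R0 (Or.inl rfl) (fun k => by omega))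
  push Not at hsmall
  obtain ⟨p, hp⟩ : ∃ p : Lt A, csz n ≤ F * n p := by
    by_contra hcon
    push Not at hcon
    have : ∑ i : Lt A, F * n i ≤ ∑ i : Lt A, csz n :=
      Finset.sum_le_sum fun i _ => (hcon i).le
    rw [← Finset.mul_sum] at this
    have hne : (Finset.univ : Finset (Lt A)).Nonempty := by
      by_contra hemp
      rw [Finset.not_nonempty_iff_eq_empty] at hemp
      have : csz n = 0 := by simp [csz, hemp]
      omega
    have h2 : ∑ i : Lt A, F * n i < ∑ i : Lt A, csz n :=
      Finset.sum_lt_sum_of_nonempty hne fun i _ => hcon i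
    rw [← Finset.mul_sum] at h2
    simp only [Finset.sum_const, Finset.card_univ, smul_eq_mul] at h2
    exact lt_irrefl _ h2
  have hnp : Q + 2 ≤ n p := by
    by_contra hc
    push Not at hc
    have := Nat.mul_le_mul_left F hc.le
    omega
  have hpc := geo_noncentral n hn p (by omega)
  set m := n p / 2 with hm
  have hm1 : 1 ≤ m := by omega
  have hNm : csz n ≤ 3 * F * m := by
    have : F * n p ≤ F * (3 * m) := Nat.mul_le_mul_left _ (by omega)
    calc csz n ≤ F * (3 * m) := by omega
      _ = 3 * F * m := by ring
  have hup : wlen A h ≤ csz n + C3 := by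
    obtain ⟨R, hR, hl, ra, rb, rt⟩ := hB n p
    rw [← hm] at hl ra rb rt
    obtain ⟨j, hj, hj2⟩ := eq_mul_zz _ h (ra.trans ha) (rb.trans hb)
    have hjle : |j| ≤ T * m := by
      have h1 : |2 * j| = 2 * |j| := by rw [abs_mul]; simp
      have h2 := abs_sub (tau h) (tau (p.1 ^ m * R.prod))
      rw [← hj2, h1] at h2
      have h3 : |j| ≤ (2 * K + 2 * B) * csz n + (2 * C2 + 2 * B) := by
        have := abs_nonneg j
        have : (0 : ℤ) ≤ (2 * K + B) * csz n := by positivity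
        have : (0 : ℤ) ≤ B * csz n := by positivity
        linarith
      have h4 : ((2 * K + 2 * B) * csz n : ℤ) ≤ (2 * K + 2 * B) * (3 * F * m) := by
        gcongr; exact_mod_cast hNm
      have h5 : ((2 * C2 + 2 * B) * 1 : ℤ) ≤ (2 * C2 + 2 * B) * m := by
        gcongr; exact_mod_cast hm1
      have h6 : (0 : ℤ) ≤ 3 * F * B * m := by positivity
      rw [hT]; push_cast
      nlinarith
    have w1 := hC3 p hpc m j hjle
    have e : h = p.1 ^ m * zz j * R.prod := by
      rw [hj, mul_assoc, mul_assoc, zz_comm]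
    have w2 := wlen_mul hA (p.1 ^ m * zz j) R.prod
    rw [← e] at w2
    have w3 := wlen_le hR
    omega
  have hlow : ∀ k : ℕ, csz n + k ≤ wlen A (h * p.1 ^ k) := by
    intro k
    have hg := hQ n hn p (by omega) k
    have := geo_le_wlen hA _ hg (h * p.1 ^ k)
      (by rw [ca_add, ca_single, ha, Heis.mul_a, pow_a])
      (by rw [cb_add, cb_single, hb, Heis.mul_b, pow_b])
    rwa [csz_add, csz_single] at this
  refine ⟨fun k => h * p.1 ^ k, by simp, ?_, ?_, ?_⟩
  · intro k
    have : (h * p.1 ^ k)⁻¹ * (h * p.1 ^ (k + 1)) = p.1 := by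
      rw [pow_succ]; group
    simp only [this]
    exact p.2
  · intro k
    have := hlow k
    push_cast
    omega
  · refine Filter.tendsto_atTop_mono (fun k => ?_) Filter.tendsto_id
    have := hlow k
    simp only [id]
    omega
end

section
/- Let A be a finite generating set for the discrete Heisenberg group H. Then there exist real numbers G and I, nonnegative integers i₁, i₂, i₃, …, and a sequence of words w₀₀; w₁₀, …, w₁ᵢ₁; w₂₀, …, w₂ᵢ₂; w₃₀, … in the letters of A ∪ A⁻¹ such that: (1) the word w_{n,i} has length 2n for all n and all 0 ≤ i ≤ i_n; (2) for all n, the word w_{n+1,0} is obtained from w_{n,i_n} by inserting a letter a ∈ A ∪ A⁻¹ and its inverse a⁻¹ at positions separated by exactly one letter; (3) for all n > 0 and 0 ≤ i < i_n, the word w_{n,i+1} is obtained from w_{n,i} by interchanging one of the two letters inserted at stage n with an adjacent letter; (4) each w_{n,i} represents a central element z^{k_{n,i}} of H, and for every m ∈ ℕ there are n, i with |m − k_{n,i}| ≤ G; (5) for all n and i, 2n − |z^{k_{n,i}}|_A ≤ I. -/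
namespace HC

set_option linter.unusedSectionVars false

open Heis

/-- determinant of the abelianizations -/
def dt (g h : Heis) : ℤ := g.a * h.b - g.b * h.a

/-- symmetrized central coordinate -/
def sc (g : Heis) : ℤ := 2 * g.c - g.a * g.b

lemma sc_mul (g h : Heis) : sc (g * h) = sc g + sc h + dt g h := by
  simp [sc, dt]; ring

lemma dt_mul (a g h : Heis) : dt a (g * h) = dt a g + dt a h := by
  simp [dt]; ring

lemma dt_one (a : Heis) : dt a 1 = 0 := by simp [dt]

lemma dt_inv (a g : Heis) : dt a g⁻¹ = - dt a g := by simp [dt]; ring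

lemma dt_inv_left (a g : Heis) : dt a⁻¹ g = - dt a g := by simp [dt]; ring

lemma dt_self (a : Heis) : dt a a = 0 := by simp [dt]; ring

lemma dt_comm (a b : Heis) : dt a b = - dt b a := by simp [dt]; ring

lemma dt_prod (a : Heis) (l : List Heis) : dt a l.prod = (l.map (dt a)).sum := by
  induction l with
  | nil => simp [dt_one]
  | cons b l ih => simp [dt_mul, ih]

lemma z_zpow (k : ℤ) : Heis.z ^ k = ⟨0, 0, k⟩ := by
  have hn : ∀ n : ℕ, Heis.z ^ n = ⟨0, 0, n⟩ := by
    intro n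
    induction n with
    | zero => rfl
    | succ n ih => rw [pow_succ, ih]; ext <;> simp [Heis.z]
  rcases Int.eq_nat_or_neg k with ⟨n, rfl | rfl⟩
  · rw [zpow_natCast, hn]
  · rw [zpow_neg, zpow_natCast, hn]; ext <;> simp

lemma insert_prod (X Y Z : List Heis) (a : Heis) :
    (X ++ a :: (Y ++ a⁻¹ :: Z)).prod.a = (X ++ Y ++ Z).prod.a ∧
    (X ++ a :: (Y ++ a⁻¹ :: Z)).prod.b = (X ++ Y ++ Z).prod.b ∧
    (X ++ a :: (Y ++ a⁻¹ :: Z)).prod.c = (X ++ Y ++ Z).prod.c + dt a Y.prod := by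
  simp only [List.prod_append, List.prod_cons, mul_a, mul_b, mul_c, inv_a, inv_b, inv_c, dt]
  refine ⟨by ring, by ring, by ring⟩

section opt
variable {ι : Type} [Fintype ι] [DecidableEq ι]

def FF (d : ι → ι → ℝ) (t : ι → ℝ) : ℝ := ∑ i, ∑ j, t i * t j * d i j

lemma FF_smul (d : ι → ι → ℝ) (t : ι → ℝ) (s : ℝ) : FF d (fun i => s * t i) = s ^ 2 * FF d t := by
  simp only [FF, Finset.mul_sum]
  refine Finset.sum_congr rfl fun i _ => Finset.sum_congr rfl fun j _ => by ring

lemma FF_single (d : ι → ι → ℝ) (hs : ∀ i j, d i j = d j i) (h0 : ∀ i, d i i = 0)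
    (t : ι → ℝ) (p : ι) :
    FF d (fun i => t i + (Pi.single p 1 : ι → ℝ) i) = FF d t + 2 * ∑ j, t j * d p j := by
  have : ∀ i j, (t i + (Pi.single p 1 : ι → ℝ) i) * (t j + (Pi.single p 1 : ι → ℝ) j) * d i j
      = t i * t j * d i j + (Pi.single p 1 : ι → ℝ) j * (t i * d i j)
        + (Pi.single p 1 : ι → ℝ) i * (t j * d i j)
        + (Pi.single p 1 : ι → ℝ) i * ((Pi.single p 1 : ι → ℝ) j * d i j) := by
    intro i j; ring
  simp only [FF, this, Finset.sum_add_distrib, ← Finset.mul_sum]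
  simp only [Pi.single_apply, ite_mul, one_mul, zero_mul, Finset.sum_ite_eq', Finset.mem_univ,
    if_true, h0]
  simp only [hs _ p]; ring

lemma opt_exists [Nonempty ι] (d : ι → ι → ℝ) :
    ∃ t ∈ stdSimplex ℝ ι, ∀ u : ι → ℝ, (∀ i, 0 ≤ u i) → FF d u ≤ FF d t * (∑ i, u i) ^ 2 := by
  have hne : (stdSimplex ℝ ι).Nonempty :=
    ⟨_, single_mem_stdSimplex ℝ (Classical.arbitrary ι)⟩
  have hc : Continuous (FF d) := by unfold FF; fun_prop
  obtain ⟨t, ht, hmax⟩ := (isCompact_stdSimplex (𝕜 := ℝ) ι).exists_isMaxOn hne hc.continuousOn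
  refine ⟨t, ht, fun u hu => ?_⟩
  by_cases hz : ∑ i, u i = 0
  · have : u = fun _ => 0 := by
      funext i
      exact (Finset.sum_eq_zero_iff_of_nonneg (fun i _ => hu i)).1 hz i (Finset.mem_univ i)
    subst this; simp [FF]
  · have hmem : (fun i => (∑ i, u i)⁻¹ * u i) ∈ stdSimplex ℝ ι := by
      refine ⟨fun i => mul_nonneg (inv_nonneg.2 (Finset.sum_nonneg fun i _ => hu i)) (hu i), ?_⟩
      rw [← Finset.mul_sum, inv_mul_cancel₀ hz]
    have h := hmax hmem
    simp only [Set.mem_ofPred_eq] at h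
    rw [FF_smul, inv_pow] at h
    have hp : 0 < (∑ i, u i) ^ 2 := by positivity
    rw [inv_mul_le_iff₀ hp] at h
    linarith

lemma round_exists (t : ι → ℝ) (ht : t ∈ stdSimplex ℝ ι) :
    ∃ (c : ℕ → ι → ℕ) (p : ℕ → ι), c 0 = 0 ∧ (∀ n, c (n + 1) = c n + Pi.single (p n) 1) ∧
      (∀ n, ∑ i, c n i = n) ∧ ∀ n i, (c n i : ℝ) ≤ n * t i + 1 := by
  have hnext : ∀ (n : ℕ) (c : ι → ℕ), ∃ p : ι, ∑ i, c i = n → (c p : ℝ) < (n + 1) * t p := by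
    intro n c
    by_contra! hcon
    have hι : Nonempty ι := by
      by_contra hne
      rw [not_nonempty_iff] at hne
      have := ht.2
      simp at this
    have hs := (hcon (Classical.arbitrary ι)).1
    have h2 : ∑ i, ((n : ℝ) + 1) * t i ≤ ∑ i, (c i : ℝ) :=
      Finset.sum_le_sum fun i _ => (hcon i).2
    rw [← Finset.mul_sum, ht.2, ← Nat.cast_sum, hs] at h2
    linarith
  choose P hP using hnext
  let c : ℕ → ι → ℕ := fun n => Nat.rec 0 (fun n c => c + Pi.single (P n c) 1) n
  have hc : ∀ n, c (n + 1) = c n + Pi.single (P n (c n)) 1 := fun n => rfl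
  have hsum : ∀ n, ∑ i, c n i = n := by
    intro n
    induction n with
    | zero => simp [c]
    | succ n ih => rw [hc]; simp [Finset.sum_add_distrib, ih]
  refine ⟨c, fun n => P n (c n), rfl, hc, hsum, ?_⟩
  intro n
  induction n with
  | zero => intro i; simp [c]
  | succ n ih =>
    intro i
    rw [hc]
    have hti := ht.1 i
    by_cases h : i = P n (c n)
    · have := hP n (c n) (hsum n)
      rw [← h] at this ⊢
      simp; linarith
    · have := ih i
      simp [h]; linarith

lemma main_opt [Nonempty ι] (d : ι → ι → ℝ) (hd : ∀ i j, 0 ≤ d i j) :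
    ∃ q C : ℝ, 0 ≤ C ∧ (∀ u : ι → ℝ, (∀ i, 0 ≤ u i) → FF d u ≤ q * (∑ i, u i) ^ 2) ∧
    ∃ (c : ℕ → ι → ℕ) (p : ℕ → ι), c 0 = 0 ∧ (∀ n, c (n + 1) = c n + Pi.single (p n) 1) ∧
      (∀ n, ∑ i, c n i = n) ∧ ∀ n : ℕ, q * n ^ 2 - C * n ≤ FF d (fun i => (c n i : ℝ)) := by
  obtain ⟨t, ht, hmax⟩ := opt_exists d
  obtain ⟨c, p, h0, hs, hsum, hup⟩ := round_exists t ht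
  set m : ℝ := (Fintype.card ι : ℝ) with hm
  have hlow : ∀ (n : ℕ) (i : ι), (n : ℝ) * t i - m ≤ c n i := by
    intro n i
    have h1 : ∑ j ∈ Finset.univ.erase i, (c n j : ℝ) ≤ ∑ j ∈ Finset.univ.erase i, (n * t j + 1) :=
      Finset.sum_le_sum fun j _ => hup n j
    have h2 := Finset.add_sum_erase Finset.univ (fun j => (c n j : ℝ)) (Finset.mem_univ i)
    have h3 := Finset.add_sum_erase Finset.univ (fun j => ((n : ℝ) * t j + 1)) (Finset.mem_univ i)
    have h4 : ∑ j, (c n j : ℝ) = n := by exact_mod_cast hsum n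
    have h5 : ∑ j, ((n : ℝ) * t j + 1) = n + m := by
      rw [Finset.sum_add_distrib, ← Finset.mul_sum, ht.2]; simp [hm]
    linarith
  have hm0 : 0 ≤ m := by positivity
  refine ⟨FF d t, ∑ i, ∑ j, 2 * m * d i j, ?_, hmax, c, p, h0, hs, hsum, ?_⟩
  · exact Finset.sum_nonneg fun i _ => Finset.sum_nonneg fun j _ =>
      mul_nonneg (by positivity) (hd i j)
  intro n
  have hkey : FF d t * n ^ 2 = FF d (fun i => (n : ℝ) * t i) := by rw [FF_smul]; ring
  rw [hkey, FF, FF, Finset.sum_mul, ← Finset.sum_sub_distrib]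
  refine Finset.sum_le_sum fun i _ => ?_
  rw [Finset.sum_mul, ← Finset.sum_sub_distrib]
  refine Finset.sum_le_sum fun j _ => ?_
  have hcn : (c n j : ℝ) ≤ n := by
    have : c n j ≤ ∑ i, c n i := Finset.single_le_sum (fun _ _ => Nat.zero_le _) (Finset.mem_univ j)
    rw [hsum] at this; exact_mod_cast this
  have hti := ht.1 i
  have hti1 : t i ≤ 1 := by
    rw [← ht.2]; exact Finset.single_le_sum (fun j _ => ht.1 j) (Finset.mem_univ i)
  have hn0 : (0 : ℝ) ≤ n := by positivity
  have e1 : -(m * n) ≤ ((c n i : ℝ) - n * t i) * c n j := by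
    have := hlow n i
    have hc0 : (0 : ℝ) ≤ c n j := by positivity
    nlinarith
  have e2 : -(m * n) ≤ (n * t i) * ((c n j : ℝ) - n * t j) := by
    have := hlow n j
    have a1 : 0 ≤ n * t i := by positivity
    have a2 : n * t i ≤ n := by nlinarith
    nlinarith
  have := mul_nonneg (hd i j) (by linarith : 0 ≤ (c n i : ℝ) * c n j - n * t i * (n * t j) + 2 * m * n)
  nlinarith
end opt

section words
variable {ι : Type} [Fintype ι] [DecidableEq ι]

def UU (f : ι → Heis) (L : List ι) (c : ι → ℕ) : List Heis :=
  L.flatMap fun i => List.replicate (c i) (f i)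

lemma UU_append (f : ι → Heis) (L M : List ι) (c : ι → ℕ) :
    UU f (L ++ M) c = UU f L c ++ UU f M c := by simp [UU]

lemma UU_cons (f : ι → Heis) (i : ι) (M : List ι) (c : ι → ℕ) :
    UU f (i :: M) c = List.replicate (c i) (f i) ++ UU f M c := by simp [UU]

lemma UU_congr (f : ι → Heis) (L : List ι) (c c' : ι → ℕ) (h : ∀ i ∈ L, c i = c' i) :
    UU f L c = UU f L c' := by
  unfold UU
  induction L with
  | nil => rfl
  | cons i L ih =>
    simp only [List.flatMap_cons]
    rw [h i (by simp), ih (fun j hj => h j (by simp [hj]))]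

lemma UU_length (f : ι → Heis) (L : List ι) (c : ι → ℕ) :
    (UU f L c).length = (L.map c).sum := by
  simp [UU, List.length_flatMap]

lemma UU_dt (f : ι → Heis) (L : List ι) (c : ι → ℕ) (a : Heis) :
    dt a (UU f L c).prod = (L.map fun i => (c i : ℤ) * dt a (f i)).sum := by
  induction L with
  | nil => simp [UU, dt_one]
  | cons i L ih => rw [UU_cons, List.prod_append, dt_mul, ih, dt_prod]; simp

lemma mem_UU (f : ι → Heis) (L : List ι) (c : ι → ℕ) (y : Heis) (h : y ∈ UU f L c) :
    ∃ i ∈ L, y = f i := by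
  simp only [UU, List.mem_flatMap, List.mem_replicate] at h
  obtain ⟨i, hi, -, h⟩ := h
  exact ⟨i, hi, h⟩

lemma step (f : ι → Heis) (L : List ι) (hnd : L.Nodup) (hall : ∀ i, i ∈ L)
    (hpw : L.Pairwise fun i j => 0 ≤ dt (f i) (f j)) (c : ι → ℕ) (p : ι) :
    ∃ X Y Z : List Heis,
      UU f L c ++ UU (fun i => (f i)⁻¹) L c = X ++ Y ++ Z ∧
      UU f L (c + Pi.single p 1) ++ UU (fun i => (f i)⁻¹) L (c + Pi.single p 1)
        = X ++ f p :: (Y ++ (f p)⁻¹ :: Z) ∧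
      Y.length = ∑ i, c i ∧ (∀ y ∈ Y, 0 ≤ dt (f p) y) ∧
      (∀ y ∈ X ++ Y ++ Z, ∃ i, y = f i ∨ y = (f i)⁻¹) ∧
      dt (f p) Y.prod = ∑ j, (c j : ℤ) * |dt (f p) (f j)| := by
  have hmem : ∀ y ∈ UU f L c ++ UU (fun i => (f i)⁻¹) L c, ∃ i, y = f i ∨ y = (f i)⁻¹ := by
    intro y hy
    rcases List.mem_append.1 hy with hy | hy
    · obtain ⟨i, -, h⟩ := mem_UU _ _ _ _ hy; exact ⟨i, Or.inl h⟩
    · obtain ⟨i, -, h⟩ := mem_UU _ _ _ _ hy; exact ⟨i, Or.inr h⟩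
  have huniv : L.toFinset = Finset.univ := by ext i; simp [hall i]
  obtain ⟨L₁, L₂, rfl⟩ := List.append_of_mem (hall p)
  have hp1 : p ∉ L₁ := by
    intro h; rw [List.nodup_append] at hnd; exact hnd.2.2 p h p (by simp) rfl
  have hp2 : p ∉ L₂ := by
    rw [List.nodup_append, List.nodup_cons] at hnd; exact hnd.2.1.1
  have hc1 : ∀ g : ι → Heis, UU g L₁ (c + Pi.single p 1) = UU g L₁ c := fun g =>
    UU_congr _ _ _ _ fun i hi => by
      have : i ≠ p := by rintro rfl; exact hp1 hi
      simp [this]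
  have hc2 : ∀ g : ι → Heis, UU g L₂ (c + Pi.single p 1) = UU g L₂ c := fun g =>
    UU_congr _ _ _ _ fun i hi => by
      have : i ≠ p := by rintro rfl; exact hp2 hi
      simp [this]
  have hcp : ∀ a : Heis, List.replicate ((c + Pi.single p 1 : ι → ℕ) p) a = List.replicate (c p) a ++ [a] := by
    intro a; simp [List.replicate_succ']
  have hd1 : ∀ j ∈ L₁, 0 ≤ dt (f j) (f p) := fun j hj =>
    (List.pairwise_append.1 hpw).2.2 j hj p (by simp)
  have hd2 : ∀ j ∈ L₂, 0 ≤ dt (f p) (f j) := fun j hj =>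
    (List.pairwise_cons.1 (List.pairwise_append.1 hpw).2.1).1 j hj
  refine ⟨UU f L₁ c ++ List.replicate (c p) (f p),
    UU f L₂ c ++ UU (fun i => (f i)⁻¹) L₁ c ++ List.replicate (c p) (f p)⁻¹,
    UU (fun i => (f i)⁻¹) L₂ c, ?_, ?_, ?_, ?_, ?_, ?_⟩
  · simp [UU_append, UU_cons]
  · simp only [UU_append, UU_cons, hc1, hc2, hcp]; simp
  · rw [← huniv, List.sum_toFinset _ hnd]
    simp [UU_length]; ring
  · intro y hy
    simp only [List.mem_append] at hy
    rcases hy with (hy | hy) | hy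
    · obtain ⟨j, hj, rfl⟩ := mem_UU _ _ _ _ hy; exact hd2 j hj
    · obtain ⟨j, hj, rfl⟩ := mem_UU _ _ _ _ hy
      have := hd1 j hj
      rw [dt_inv, ← dt_comm]; exact this
    · rw [List.eq_of_mem_replicate hy, dt_inv, dt_self]; simp
  · intro y hy
    refine hmem y ?_
    convert hy using 1
    simp [UU_append, UU_cons]
  · rw [← huniv, List.sum_toFinset _ hnd]
    rw [List.prod_append, List.prod_append, dt_mul, dt_mul, UU_dt, UU_dt, dt_prod]
    have e1 : (L₁.map fun j => (c j : ℤ) * |dt (f p) (f j)|)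
        = L₁.map fun j => (c j : ℤ) * dt (f p) (f j)⁻¹ := by
      refine List.map_congr_left fun j hj => ?_
      have := hd1 j hj
      rw [dt_inv, ← dt_comm, dt_comm (f p), abs_neg, abs_of_nonneg this]
    have e2 : (L₂.map fun j => (c j : ℤ) * |dt (f p) (f j)|)
        = L₂.map fun j => (c j : ℤ) * dt (f p) (f j) := by
      refine List.map_congr_left fun j hj => ?_
      rw [abs_of_nonneg (hd2 j hj)]
    simp only [List.map_append, List.map_cons, List.sum_append, List.sum_cons, e1, e2, dt_self]
    simp [dt_inv, dt_self]; ring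
end words

section upper
variable {ι : Type} [Fintype ι] [DecidableEq ι]

lemma upper (f : ι → Heis) (S : Heis → Prop) (hS : ∀ a, S a → ∃ i, f i = a ∨ f i = a⁻¹)
    (B : ℝ) (hB : ∀ a, S a → (sc a : ℝ) ≤ B) (u : List Heis) (hu : ∀ a ∈ u, S a) :
    ∃ c : ι → ℕ, ∑ i, c i = u.length ∧
      (∀ i, |(dt (f i) u.prod : ℝ)| ≤ ∑ j, (c j : ℝ) * |(dt (f i) (f j) : ℝ)|) ∧
      2 * (sc u.prod : ℝ) ≤ 2 * B * u.length
        + FF (fun i j => |(dt (f i) (f j) : ℝ)|) (fun i => (c i : ℝ)) := by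
  induction u with
  | nil => exact ⟨0, by simp, by simp [dt_one], by simp [FF, sc]⟩
  | cons a u ih =>
    obtain ⟨c, h1, h2, h3⟩ := ih fun b hb => hu b (by simp [hb])
    have ha := hu a (by simp)
    obtain ⟨p, hp⟩ := hS a ha
    have hab : ∀ g, |(dt g a : ℝ)| = |(dt g (f p) : ℝ)| := by
      intro g
      rcases hp with hp | hp
      · rw [hp]
      · rw [hp, dt_inv]; simp
    have hba : ∀ g, |(dt a g : ℝ)| = |(dt (f p) g : ℝ)| := by
      intro g
      rcases hp with hp | hp
      · rw [hp]
      · rw [hp, dt_inv_left]; simp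
    refine ⟨c + Pi.single p 1, by simp [Finset.sum_add_distrib, h1], ?_, ?_⟩
    · intro i
      rw [List.prod_cons, dt_mul]
      have : ∑ j, ((c + Pi.single p 1 : ι → ℕ) j : ℝ) * |(dt (f i) (f j) : ℝ)|
          = ∑ j, (c j : ℝ) * |(dt (f i) (f j) : ℝ)| + |(dt (f i) (f p) : ℝ)| := by
        simp [add_mul, Finset.sum_add_distrib, Pi.single_apply]
      rw [this, ← hab]
      push_cast
      have := abs_add_le (dt (f i) a : ℝ) (dt (f i) u.prod : ℝ)
      have := h2 i
      linarith
    · have e : (fun i => ((c + Pi.single p 1 : ι → ℕ) i : ℝ))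
          = fun i => (c i : ℝ) + (Pi.single p 1 : ι → ℝ) i := by
        funext i
        by_cases h : i = p
        · subst h; simp
        · simp [h]
      rw [e, FF_single _ (fun i j => by rw [dt_comm]; simp) (fun i => by simp [dt_self])]
      rw [List.prod_cons, sc_mul, List.length_cons]
      push_cast
      have := h2 p
      have := hB a ha
      have := le_abs_self (dt a u.prod : ℝ)
      rw [hba] at this
      linarith
end upper

lemma arg_det (a b : Heis) (ha : 0 ≤ a.b)
    (h : Complex.arg ⟨a.a, a.b⟩ ≤ Complex.arg ⟨b.a, b.b⟩) : 0 ≤ dt a b := by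
  set z : ℂ := ⟨a.a, a.b⟩ with hz
  set w : ℂ := ⟨b.a, b.b⟩ with hw
  have h1 : 0 ≤ z.arg := Complex.arg_nonneg_iff.2 (by simpa [hz] using ha)
  have h2 : w.arg ≤ Real.pi := Complex.arg_le_pi w
  have hs : 0 ≤ Real.sin (w.arg - z.arg) :=
    Real.sin_nonneg_of_nonneg_of_le_pi (by linarith) (by linarith)
  rw [Real.sin_sub] at hs
  have e1 := Complex.norm_mul_cos_arg z
  have e2 := Complex.norm_mul_sin_arg z
  have e3 := Complex.norm_mul_cos_arg w
  have e4 := Complex.norm_mul_sin_arg w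
  have : (dt a b : ℝ) = z.re * w.im - z.im * w.re := by simp [dt, hz, hw]
  have h5 : (0 : ℝ) ≤ dt a b := by
    rw [this, ← e1, ← e2, ← e3, ← e4]
    have := mul_nonneg (mul_nonneg (norm_nonneg z) (norm_nonneg w)) hs
    linarith
  exact_mod_cast h5

lemma exists_noncomm (A : Finset Heis) (hA : IsGenSet A) : ∃ a ∈ A, ∃ b ∈ A, dt a b ≠ 0 := by
  by_contra! hcon
  have hcomm : ∀ a ∈ (A : Set Heis), ∀ b ∈ (A : Set Heis), a * b = b * a := by
    intro a ha b hb
    have := hcon a ha b hb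
    simp only [dt] at this
    ext <;> simp
    · ring
    · ring
    · linarith
  have hc := Subgroup.isMulCommutative_closure hcomm
  rw [show Subgroup.closure (A : Set Heis) = ⊤ from hA] at hc
  have h := hc.is_comm.comm (⟨Heis.x, trivial⟩ : (⊤ : Subgroup Heis)) ⟨Heis.y, trivial⟩
  have h2 := congrArg (fun g : (⊤ : Subgroup Heis) => (g : Heis).c) h
  simp [Heis.x, Heis.y] at h2

lemma exists_list (A : Finset Heis) :
    ∃ (P : Finset Heis) (L : List P), L.Nodup ∧ (∀ i, i ∈ L) ∧
      (L.Pairwise fun i j => 0 ≤ dt i.1 j.1) ∧ (∀ i : P, i.1 ∈ A ∨ i.1⁻¹ ∈ A) ∧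
      (∀ a, (a ∈ A ∨ a⁻¹ ∈ A) → ∃ i : P, i.1 = a ∨ i.1 = a⁻¹) := by
  classical
  let P : Finset Heis := (A ∪ A.image (·⁻¹)).filter fun g => 0 ≤ g.b
  let r : P → P → Prop := fun i j =>
    Complex.arg ⟨i.1.a, i.1.b⟩ ≤ Complex.arg ⟨j.1.a, j.1.b⟩
  have : Std.Total r := ⟨fun i j => le_total _ _⟩
  have : IsTrans P r := ⟨fun i j k h1 h2 => le_trans h1 h2⟩
  have hperm := List.perm_insertionSort r (Finset.univ : Finset P).toList
  refine ⟨P, (Finset.univ : Finset P).toList.insertionSort r, ?_, ?_, ?_, ?_, ?_⟩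
  · exact hperm.nodup_iff.2 (Finset.nodup_toList _)
  · intro i; exact hperm.mem_iff.2 (by simp)
  · refine (List.pairwise_insertionSort r _).imp ?_
    intro i j h
    exact arg_det _ _ (Finset.mem_filter.1 i.2).2 h
  · intro i
    have := (Finset.mem_filter.1 i.2).1
    simp only [Finset.mem_union, Finset.mem_image] at this
    rcases this with h | ⟨b, hb, h⟩
    · exact Or.inl h
    · right; rw [← h]; simpa using hb
  · intro a ha
    have hmem : ∀ b : Heis, (b ∈ A ∨ b⁻¹ ∈ A) → 0 ≤ b.b → b ∈ P := by
      intro b hb h0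
      simp only [P, Finset.mem_filter, Finset.mem_union, Finset.mem_image]
      refine ⟨?_, h0⟩
      rcases hb with hb | hb
      · exact Or.inl hb
      · exact Or.inr ⟨_, hb, inv_inv b⟩
    by_cases h0 : 0 ≤ a.b
    · exact ⟨⟨a, hmem a ha h0⟩, Or.inl rfl⟩
    · refine ⟨⟨a⁻¹, hmem a⁻¹ ?_ (by simp; omega)⟩, Or.inr rfl⟩
      rw [inv_inv]; exact ha.symm

/-- the final arithmetic estimate -/
lemma final_est (q C B x l : ℝ) (hq : 0 < q) (hC : 0 ≤ C) (hB : 0 ≤ B) (hx : 0 ≤ x) (hl : 0 ≤ l)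
    (h : q * x ^ 2 - C * x ≤ B * l + q * ((l + 1) / 2) ^ 2) :
    2 * x - l ≤ 1 + (4 * C + 4 * B + 1) / q := by
  by_contra! hcon
  have hM : 0 < 2 * x - l - 1 - (4 * C + 4 * B + 1) / q := by linarith
  have h1 : 4 * C + 4 * B + 1 < q * (2 * x - l - 1) := by
    have := mul_pos hq hM
    have e : q * ((4 * C + 4 * B + 1) / q) = 4 * C + 4 * B + 1 := by field_simp
    nlinarith
  have h2 : (4 * C + 4 * B + 1) * (2 * x + l + 1) ≤ q * (2 * x - l - 1) * (2 * x + l + 1) :=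
    mul_le_mul_of_nonneg_right h1.le (by linarith)
  have := mul_nonneg hC hx
  have := mul_nonneg hC hl
  have := mul_nonneg hB hx
  have := mul_nonneg hB hl
  nlinarith

lemma UU_zero {ι : Type} (f : ι → Heis) (L : List ι) : UU f L 0 = [] := by simp [UU]

end HC

/-- Proposition `cobound`. For every finite generating set `A` of the
discrete Heisenberg group there exist `G, I ∈ ℝ`, nonnegative integers `i₁, i₂, …` and a
sequence of words `w₀₀; w₁₀, …, w₁ᵢ₁; w₂₀, …` in the letters of `A ∪ A⁻¹` such that:
(1) `w_{n,i}` has length `2n`;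
(2) `w_{n+1,0}` is obtained from `w_{n,i_n}` by inserting a letter `a ∈ A ∪ A⁻¹` and its
inverse at positions separated by exactly one letter (for `n > 0`; for the empty word `w₀₀`
they are inserted adjacently);
(3) for `n > 0` and `i < i_n`, `w_{n,i+1}` is obtained from `w_{n,i}` by interchanging one of
the two letters inserted at stage `n` with an adjacent letter;
(4) each `w_{n,i}` represents `z^{k_{n,i}}`, and for every `m ∈ ℕ` there are `n, i` with
`|m − k_{n,i}| ≤ G`;
(5) `2n − |z^{k_{n,i}}|_A ≤ I` for all `n, i`. -/
theorem heisenberg_cobound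
    (A : Finset Heis) (hA : IsGenSet A) :
    ∃ (G I : ℝ) (iseq : ℕ → ℕ) (w : ℕ → ℕ → List Heis) (k : ℕ → ℕ → ℤ) (aseq : ℕ → Heis),
      iseq 0 = 0 ∧
      (∀ n i, i ≤ iseq n → IsWordOn A (w n i)) ∧
      (∀ n i, i ≤ iseq n → (w n i).length = 2 * n) ∧
      (∀ n : ℕ, (aseq (n + 1) ∈ A ∨ (aseq (n + 1))⁻¹ ∈ A) ∧
        ∃ u₁ u₂ u₃ : List Heis,
          u₂.length ≤ 1 ∧ (0 < n → u₂.length = 1) ∧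
          w n (iseq n) = u₁ ++ u₂ ++ u₃ ∧
          w (n + 1) 0 = u₁ ++ aseq (n + 1) :: (u₂ ++ (aseq (n + 1))⁻¹ :: u₃)) ∧
      (∀ n : ℕ, 0 < n → ∀ i, i < iseq n →
        ∃ (u₁ u₂ : List Heis) (c d : Heis),
          (c = aseq n ∨ c = (aseq n)⁻¹ ∨ d = aseq n ∨ d = (aseq n)⁻¹) ∧
          w n i = u₁ ++ c :: d :: u₂ ∧ w n (i + 1) = u₁ ++ d :: c :: u₂) ∧
      (∀ n i, i ≤ iseq n → (w n i).prod = Heis.z ^ (k n i)) ∧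
      (∀ m : ℕ, ∃ n i, i ≤ iseq n ∧ |(m : ℝ) - (k n i : ℝ)| ≤ G) ∧
      (∀ n i, i ≤ iseq n → (2 * n : ℝ) - (wlen A (Heis.z ^ (k n i)) : ℝ) ≤ I) := by
  classical
  obtain ⟨P, L, hnd, hall, hpw, hPA, hAP⟩ := HC.exists_list A
  obtain ⟨a₀, ha₀, b₀, hb₀, hab⟩ := HC.exists_noncomm A hA
  obtain ⟨i₀, hi₀⟩ := hAP a₀ (Or.inl ha₀)
  obtain ⟨j₀, hj₀⟩ := hAP b₀ (Or.inl hb₀)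
  let f : P → Heis := fun i => i.1
  have hne : Nonempty P := ⟨i₀⟩
  let d : P → P → ℝ := fun i j => |(HC.dt (f i) (f j) : ℝ)|
  have hd0 : ∀ i j, 0 ≤ d i j := fun i j => abs_nonneg _
  have hdpos : 0 < d i₀ j₀ := by
    have : HC.dt (f i₀) (f j₀) ≠ 0 := by
      rcases hi₀ with h | h <;> rcases hj₀ with hx | hx <;>
        simp only [f, h, hx, HC.dt_inv, HC.dt_inv_left, neg_neg, ne_eq, neg_eq_zero] <;> exact hab
    exact abs_pos.2 (by exact_mod_cast this)
  obtain ⟨q, C, hC, hmax, c, p, h0, hs, hsum, hlow⟩ := HC.main_opt d hd0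
  have hq : 0 < q := by
    have h1 := hmax (fun _ => 1) (fun _ => zero_le_one)
    have h2 : 0 < HC.FF d (fun _ => 1) := by
      have e1 : d i₀ j₀ ≤ ∑ j, d i₀ j :=
        Finset.single_le_sum (fun j _ => hd0 i₀ j) (Finset.mem_univ j₀)
      have e2 : ∑ j, d i₀ j ≤ ∑ i, ∑ j, d i j :=
        Finset.single_le_sum (f := fun i => ∑ j, d i j)
          (fun i _ => Finset.sum_nonneg fun j _ => hd0 i j) (Finset.mem_univ i₀)
      simp only [HC.FF, one_mul]
      linarith
    exact pos_of_mul_pos_left (h2.trans_le h1) (sq_nonneg _)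
  have hstep := fun n => HC.step f L hnd hall hpw (c n) (p n)
  choose X Y Z hW hW' hYlen hYpos hlet hYdt using hstep
  let W : ℕ → List Heis := fun n => HC.UU f L (c n) ++ HC.UU (fun i => (f i)⁻¹) L (c n)
  have hWn : ∀ n, W n = X n ++ Y n ++ Z n := hW
  have hWs : ∀ n, W (n + 1) = X n ++ f (p n) :: (Y n ++ (f (p n))⁻¹ :: Z n) := by
    intro n; rw [← hW' n, ← hs n]
  have hW0 : W 0 = [] := by simp only [W, h0, HC.UU_zero, List.append_nil]
  have hYl : ∀ n, (Y n).length = n := fun n => by rw [hYlen, hsum]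
  have hWlen : ∀ n, (W n).length = 2 * n := by
    intro n
    induction n with
    | zero => rw [hW0]; rfl
    | succ n ih =>
      rw [hWn] at ih
      rw [hWs]
      simp only [List.length_append, List.length_cons] at ih ⊢
      omega
  -- bounds for letters
  let Gm : ℤ := ∑ i : P, ∑ j : P, |HC.dt (f i) (f j)|
  have hGm : ∀ i j, |HC.dt (f i) (f j)| ≤ Gm := by
    intro i j
    have e1 : |HC.dt (f i) (f j)| ≤ ∑ j, |HC.dt (f i) (f j)| :=
      Finset.single_le_sum (f := fun j => |HC.dt (f i) (f j)|)
        (fun j _ => abs_nonneg _) (Finset.mem_univ j)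
    have e2 : ∑ j, |HC.dt (f i) (f j)| ≤ Gm :=
      Finset.single_le_sum (f := fun i => ∑ j, |HC.dt (f i) (f j)|)
        (fun i _ => Finset.sum_nonneg fun j _ => abs_nonneg _) (Finset.mem_univ i)
    linarith
  have hGm0 : 0 ≤ Gm := (abs_nonneg _).trans (hGm i₀ i₀)
  let B : ℝ := ∑ i : P, |(HC.sc (f i) : ℝ)|
  have hB0 : 0 ≤ B := Finset.sum_nonneg fun i _ => abs_nonneg _
  have hB : ∀ a, (a ∈ A ∨ a⁻¹ ∈ A) → (HC.sc a : ℝ) ≤ B := by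
    intro a ha
    obtain ⟨i, hi⟩ := hAP a ha
    have e1 : |(HC.sc (f i) : ℝ)| ≤ B :=
      Finset.single_le_sum (f := fun i => |(HC.sc (f i) : ℝ)|)
        (fun j _ => abs_nonneg _) (Finset.mem_univ i)
    have e2 : |(HC.sc (f i) : ℝ)| = |(HC.sc a : ℝ)| := by
      rcases hi with hi | hi
      · simp only [f, hi]
      · have : HC.sc a⁻¹ = - HC.sc a := by simp [HC.sc]; ring
        simp only [f, hi, this]; simp
    rw [e2] at e1
    exact (le_abs_self _).trans e1
  -- the partial gains
  let T : ℕ → ℕ → ℤ := fun n j => HC.dt (f (p n)) ((Y n).take j).prod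
  have hT0 : ∀ n, T n 0 = 0 := fun n => by simp [T, HC.dt_one]
  have hTpos : ∀ n j, 0 ≤ T n j := by
    intro n j
    simp only [T, HC.dt_prod]
    refine List.sum_nonneg ?_
    intro x hx
    obtain ⟨y, hy, rfl⟩ := List.mem_map.1 hx
    exact hYpos n y (List.mem_of_mem_take hy)
  have hTs : ∀ n j, T n (j + 1) ≤ T n j + Gm := by
    intro n j
    simp only [T, List.take_add_one, List.prod_append, HC.dt_mul]
    by_cases hj : j < (Y n).length
    · have hm : (Y n)[j] ∈ X n ++ Y n ++ Z n := by simp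
      obtain ⟨i, hi⟩ := hlet n _ hm
      have hle : HC.dt (f (p n)) (Y n)[j] ≤ Gm := by
        have h1 := hGm (p n) i
        rw [abs_le] at h1
        rcases hi with hi | hi
        · rw [hi]; exact h1.2
        · rw [hi, HC.dt_inv]; linarith [h1.1]
      simpa [hj] using hle
    · simp only [not_lt] at hj
      simp [hj, HC.dt_one, hGm0]
  have hTfull : ∀ n j, n ≤ j → T n j = HC.dt (f (p n)) (Y n).prod := by
    intro n j hj
    simp only [T]
    rw [List.take_of_length_le (by rw [hYl]; exact hj)]
  have hWab : ∀ n, (W n).prod.a = 0 ∧ (W n).prod.b = 0 := by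
    intro n
    induction n with
    | zero => rw [hW0]; exact ⟨rfl, rfl⟩
    | succ n ih =>
      obtain ⟨e1, e2, -⟩ := HC.insert_prod (X n) (Y n) (Z n) (f (p n))
      rw [hWs, e1, e2, ← hWn]; exact ih
  have hKs : ∀ n, (W (n + 1)).prod.c = (W n).prod.c + HC.dt (f (p n)) (Y n).prod := by
    intro n
    rw [hWs, (HC.insert_prod (X n) (Y n) (Z n) (f (p n))).2.2, ← hWn]
  have hK : ∀ n, 2 * ((W n).prod.c : ℝ) = HC.FF d (fun i => (c n i : ℝ)) := by
    intro n
    induction n with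
    | zero => rw [hW0, h0]; simp [HC.FF]
    | succ n ih =>
      have e : (fun i => (c (n + 1) i : ℝ))
          = fun i => (c n i : ℝ) + (Pi.single (p n) 1 : P → ℝ) i := by
        funext i
        rw [hs]
        by_cases h : i = p n
        · subst h; simp
        · simp [h]
      rw [e, HC.FF_single d (fun i j => by simp only [d]; rw [HC.dt_comm]; simp)
        (fun i => by simp [d, HC.dt_self]), ← ih, hKs, hYdt]
      push_cast
      simp only [d]; ring
  let w : ℕ → ℕ → List Heis := fun n i => match n with
    | 0 => []
    | n + 1 => X n ++ f (p n) :: ((Y n).take (i + 1) ++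
        (f (p n))⁻¹ :: ((Y n).drop (i + 1) ++ Z n))
  have hws : ∀ n i, w (n + 1) i = X n ++ f (p n) :: ((Y n).take (i + 1) ++
        (f (p n))⁻¹ :: ((Y n).drop (i + 1) ++ Z n)) := fun n i => rfl
  have hglue : ∀ n j, X n ++ (Y n).take j ++ ((Y n).drop j ++ Z n) = W n := by
    intro n j
    rw [hWn]
    conv_rhs => rw [← List.take_append_drop j (Y n)]
    simp only [List.append_assoc]
  have hwfin : ∀ n, w n (n - 2) = W n := by
    intro n
    cases n with
    | zero => rw [hW0]
    | succ n =>
      have hle : (Y n).length ≤ n + 1 - 2 + 1 := by rw [hYl]; omega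
      rw [hws, hWs, List.take_of_length_le hle, List.drop_of_length_le hle, List.nil_append]
  have hwprod : ∀ n i, (w (n + 1) i).prod.a = 0 ∧ (w (n + 1) i).prod.b = 0 ∧
      (w (n + 1) i).prod.c = (W n).prod.c + T n (i + 1) := by
    intro n i
    obtain ⟨e1, e2, e3⟩ := HC.insert_prod (X n) ((Y n).take (i + 1)) ((Y n).drop (i + 1) ++ Z n)
      (f (p n))
    rw [hws, e1, e2, e3, hglue]
    exact ⟨(hWab n).1, (hWab n).2, rfl⟩
  have hwz : ∀ n i, (w n i).prod = Heis.z ^ ((w n i).prod.c) := by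
    intro n i
    rw [HC.z_zpow]
    cases n with
    | zero => rfl
    | succ n =>
      obtain ⟨e1, e2, -⟩ := hwprod n i
      ext
      · exact e1
      · exact e2
      · rfl
  have hletA : ∀ i : P, (f i ∈ A ∨ (f i)⁻¹ ∈ A) ∧ ((f i)⁻¹ ∈ A ∨ ((f i)⁻¹)⁻¹ ∈ A) := by
    intro i
    have := hPA i
    exact ⟨this, by rw [inv_inv]; exact this.symm⟩
  have hword : ∀ n i, IsWordOn A (w n i) := by
    intro n i a ha
    cases n with
    | zero => simp [w] at ha
    | succ n =>
      have h1 : a = f (p n) ∨ a = (f (p n))⁻¹ ∨ a ∈ W n := by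
        rw [← hglue n (i + 1)]
        rw [hws] at ha
        simp only [List.mem_append, List.mem_cons] at ha ⊢
        tauto
      rcases h1 with rfl | rfl | h1
      · exact (hletA _).1
      · exact (hletA _).2
      · rw [hWn] at h1
        obtain ⟨j, rfl | rfl⟩ := hlet n a h1
        · exact (hletA _).1
        · exact (hletA _).2
  refine ⟨Gm, 3 + (4 * C + 4 * B + 1) / q, fun n => n - 2, w, fun n i => (w n i).prod.c,
    fun n => f (p (n - 1)), rfl, fun n i _ => hword n i, ?_, ?_, ?_, fun n i _ => hwz n i, ?_, ?_⟩
  · intro n i _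
    cases n with
    | zero => rfl
    | succ n =>
      have h1 := hWlen n
      rw [← hglue n (i + 1)] at h1
      rw [hws]
      simp only [List.length_append, List.length_cons] at h1 ⊢
      omega
  · intro n
    refine ⟨(hletA _).1, X n, (Y n).take 1, (Y n).drop 1 ++ Z n, ?_, ?_, ?_, ?_⟩
    · simp
    · intro hn
      rw [List.length_take, hYl]; omega
    · rw [hwfin, hglue]
    · exact hws n 0
  · intro n hn i hi
    obtain ⟨n, rfl⟩ : ∃ m, n = m + 1 := ⟨n - 1, by omega⟩
    have hi2 : i < n + 1 - 2 := hi
    have hlt : i + 1 < (Y n).length := by rw [hYl]; omega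
    refine ⟨X n ++ f (p n) :: (Y n).take (i + 1), (Y n).drop (i + 2) ++ Z n, (f (p n))⁻¹,
      (Y n)[i + 1], Or.inr (Or.inl rfl), ?_, ?_⟩
    · rw [hws, List.drop_eq_getElem_cons hlt]
      simp only [List.append_assoc, List.cons_append]
    · rw [hws, List.take_add_one (i := i + 1), List.getElem?_eq_getElem hlt]
      simp only [List.append_assoc, List.cons_append, Option.toList_some, List.nil_append]
  · intro m
    have hex : ∃ n, (m : ℤ) < (W n).prod.c := by
      obtain ⟨N, hN⟩ := exists_nat_gt ((2 * m + C + 1) / q + 1)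
      refine ⟨N, ?_⟩
      have h1 := hlow N
      rw [← hK] at h1
      have h2 : (2 * m + C + 1) < q * N := by
        have : (2 * m + C + 1) / q < N := by linarith
        rw [div_lt_iff₀ hq] at this
        linarith
      have h3 : (1 : ℝ) ≤ N := by
        have : 0 ≤ (2 * m + C + 1) / q := by positivity
        linarith
      have h4 : (m : ℝ) < (W N).prod.c := by
        have hm0 : (0 : ℝ) ≤ m := by positivity
        nlinarith
      exact_mod_cast h4
    have hmin := fun r => Nat.find_min hex (m := r)
    have hsp := Nat.find_spec hex
    generalize Nat.find hex = N at hmin hsp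
    obtain ⟨n, rfl⟩ : ∃ n, N = n + 1 := by
      cases N with
      | zero => rw [hW0] at hsp; simp at hsp; omega
      | succ n => exact ⟨n, rfl⟩
    have hle : (W n).prod.c ≤ m := not_lt.1 (hmin _ (Nat.lt_succ_self n))
    have hex2 : ∃ j, (m : ℤ) < (W n).prod.c + T n j :=
      ⟨n, by rw [hTfull n n le_rfl, ← hKs]; exact hsp⟩
    have hj2 : Nat.find hex2 ≤ n :=
      Nat.find_min' hex2 (by rw [hTfull n n le_rfl, ← hKs]; exact hsp)
    have hmin2 := fun r => Nat.find_min hex2 (m := r)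
    have hsp2 := Nat.find_spec hex2
    generalize Nat.find hex2 = J at hmin2 hsp2 hj2
    obtain ⟨j, rfl⟩ : ∃ j, J = j + 1 := by
      cases J with
      | zero => rw [hT0] at hsp2; omega
      | succ n => exact ⟨n, rfl⟩
    have hle2 : (W n).prod.c + T n j ≤ m := not_lt.1 (hmin2 _ (Nat.lt_succ_self j))
    refine ⟨n + 1, j, by simp only; omega, ?_⟩
    have e3 := (hwprod n j).2.2
    have e4 := hTs n j
    have e5 : |(m : ℤ) - (w (n + 1) j).prod.c| ≤ Gm := by
      rw [abs_le]; constructor <;> linarith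
    exact_mod_cast e5
  · intro n i _
    have hlen : ∃ v : List Heis, IsWordOn A v ∧ v.length = wlen A (Heis.z ^ (w n i).prod.c) ∧
        v.prod = Heis.z ^ (w n i).prod.c :=
      Nat.sInf_mem (s := {n' | ∃ v : List Heis, IsWordOn A v ∧ v.length = n' ∧
        v.prod = Heis.z ^ (w n i).prod.c}) ⟨_, w n i, hword n i, rfl, hwz n i⟩
    obtain ⟨v, hvA, hvl, hvp⟩ := hlen
    simp only
    rw [← hvl]
    cases n with
    | zero =>
      have : 0 ≤ (4 * C + 4 * B + 1) / q := by positivity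
      have : (0 : ℝ) ≤ v.length := by positivity
      push_cast; linarith
    | succ n =>
      have hkge : q * n ^ 2 - C * n ≤ 2 * ((w (n + 1) i).prod.c : ℝ) := by
        have h1 := hlow n
        rw [← hK] at h1
        have h2 := (hwprod n i).2.2
        have h3 := hTpos n (i + 1)
        have h4 : ((W n).prod.c : ℝ) ≤ (w (n + 1) i).prod.c := by
          have : (W n).prod.c ≤ (w (n + 1) i).prod.c := by omega
          exact_mod_cast this
        linarith
      generalize (w (n + 1) i).prod.c = k at hkge hvp
      set h := v.length / 2 with hh
      obtain ⟨c₁, a1, -, a3⟩ := HC.upper f (fun a => a ∈ A ∨ a⁻¹ ∈ A) hAP B hB (v.take h)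
        (fun a ha => hvA a (List.mem_of_mem_take ha))
      obtain ⟨c₂, b1, -, b3⟩ := HC.upper f (fun a => a ∈ A ∨ a⁻¹ ∈ A) hAP B hB (v.drop h)
        (fun a ha => hvA a (List.mem_of_mem_drop ha))
      have m1 := hmax (fun i => (c₁ i : ℝ)) (fun i => by positivity)
      have m2 := hmax (fun i => (c₂ i : ℝ)) (fun i => by positivity)
      rw [← Nat.cast_sum, a1, List.length_take] at m1
      rw [← Nat.cast_sum, b1, List.length_drop] at m2
      rw [List.length_take] at a3
      rw [List.length_drop] at b3
      have hsplit : (v.take h).prod * (v.drop h).prod = ⟨0, 0, k⟩ := by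
        rw [← List.prod_append, List.take_append_drop, hvp, HC.z_zpow]
      have hsc : HC.sc (v.take h).prod + HC.sc (v.drop h).prod = 2 * k := by
        have e1 := congrArg HC.sc hsplit
        have e2 := congrArg Heis.a hsplit
        have e3 := congrArg Heis.b hsplit
        rw [HC.sc_mul] at e1
        simp only [Heis.mul_a, Heis.mul_b] at e2 e3
        have e4 : HC.dt (v.take h).prod (v.drop h).prod = 0 := by
          have f2 : (v.drop h).prod.a = - (v.take h).prod.a := by linarith
          have f3 : (v.drop h).prod.b = - (v.take h).prod.b := by linarith
          simp only [HC.dt, f2, f3]; ring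
        rw [e4] at e1
        simpa [HC.sc] using e1
      have hscR : (HC.sc (v.take h).prod : ℝ) + (HC.sc (v.drop h).prod : ℝ) = 2 * k := by
        exact_mod_cast hsc
      have l1 : ((min h v.length : ℕ) : ℝ) ≤ (v.length + 1) / 2 := by
        rw [le_div_iff₀ two_pos]
        have : (min h v.length) * 2 ≤ v.length + 1 := by omega
        exact_mod_cast this
      have l2 : ((v.length - h : ℕ) : ℝ) ≤ (v.length + 1) / 2 := by
        rw [le_div_iff₀ two_pos]
        have : (v.length - h) * 2 ≤ v.length + 1 := by omega
        exact_mod_cast this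
      have l3 : ((min h v.length : ℕ) : ℝ) + ((v.length - h : ℕ) : ℝ) = v.length := by
        have : min h v.length + (v.length - h) = v.length := by omega
        exact_mod_cast this
      have s1 : q * ((min h v.length : ℕ) : ℝ) ^ 2 ≤ q * (((v.length : ℝ) + 1) / 2) ^ 2 := by
        gcongr
      have s2 : q * ((v.length - h : ℕ) : ℝ) ^ 2 ≤ q * (((v.length : ℝ) + 1) / 2) ^ 2 := by
        gcongr
      have s3 : 2 * B * ((min h v.length : ℕ) : ℝ) + 2 * B * ((v.length - h : ℕ) : ℝ)
          = 2 * B * v.length := by rw [← mul_add, l3]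
      have hfin := HC.final_est q C B n v.length hq hC hB0 (by positivity) (by positivity)
        (by simp only [d] at m1 m2; linarith)
      push_cast
      linarith
end
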